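/- arXiv:1706.04773 — 6 statements merged into one kernel-verified Lean document; each statement's English description precedes it below -/
import Mathlib

section
/- Let I be a calibrated σ-ideal on a compactum X without isolated points such that I contains all singletons, let B ⊆ X be a Borel set with B ∉ I, and let f : B → Y be a Borel-measurable map into a compactum Y without isolated points. Then there exists a compact meager (i.e., closed and nowhere dense) set C ⊆ Y such that f⁻¹(C) ∉ I. -/
open MeasureTheory Topology Filter Set

/-- A σ-ideal of Borel sets: closed under Borel subsets and countable unions. -/
def SigmaIdeal {X : Type*} [TopologicalSpace X] [MeasurableSpace X]
    (I : Set (Set X)) : Prop :=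
  (∀ A ∈ I, MeasurableSet A) ∧
  (∀ A ∈ I, ∀ B : Set X, MeasurableSet B → B ⊆ A → B ∈ I) ∧
  (∀ A : ℕ → Set X, (∀ n, A n ∈ I) → (⋃ n, A n) ∈ I)

/-- `I` is generated by compact sets: every member of `I` is contained in a
σ-compact set belonging to `I`. -/
def GenByCompacts {X : Type*} [TopologicalSpace X] (I : Set (Set X)) : Prop :=
  ∀ A ∈ I, ∃ S : ℕ → Set X, (∀ n, IsCompact (S n)) ∧ (⋃ n, S n) ∈ I ∧ A ⊆ ⋃ n, S n

/-- A calibrated σ-ideal: a σ-ideal generated by compact sets such that for every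
compact `K ∉ I` and every sequence of compact sets `Kₙ ∈ I` there is a compact
`L ⊆ K \ ⋃ₙ Kₙ` with `L ∉ I`. -/
def Calibrated {X : Type*} [TopologicalSpace X] [MeasurableSpace X]
    (I : Set (Set X)) : Prop :=
  SigmaIdeal I ∧ GenByCompacts I ∧
    ∀ K : Set X, IsCompact K → K ∉ I →
      ∀ Kn : ℕ → Set X, (∀ n, IsCompact (Kn n) ∧ Kn n ∈ I) →
        ∃ L : Set X, IsCompact L ∧ L ⊆ K \ (⋃ n, Kn n) ∧ L ∉ I

open TopologicalSpace

/-- First projection of the part of the closure of `g '' U` lying over `C`. -/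
def PP {X Y Z : Type*} [TopologicalSpace X] [TopologicalSpace Y] (g : Z → X × Y)
    (U : Set Z) (C : Set Y) : Set X :=
  Prod.fst '' (closure (g '' U) ∩ Prod.snd ⁻¹' C)

section core

variable {X Y Z : Type*}
    [MetricSpace X] [CompactSpace X] [MeasurableSpace X] [BorelSpace X]
    [MetricSpace Y] [CompactSpace Y]

lemma PP_compact (g : Z → X × Y) (U : Set Z) {C : Set Y} (hC : IsClosed C) :
    IsCompact (PP g U C) := by
  refine IsCompact.image ?_ continuous_fst
  exact (isClosed_closure.inter (hC.preimage continuous_snd)).isCompact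

lemma PP_mono (g : Z → X × Y) {U V : Set Z} (h : U ⊆ V) (C : Set Y) :
    PP g U C ⊆ PP g V C := by
  apply image_mono
  apply inter_subset_inter_left
  exact closure_mono (image_mono h)

/-- The calibration step. -/
lemma key1 (I : Set (Set X)) (hI : Calibrated I) (g : Z → X × Y) (U : Set Z)
    (hU : ∀ S ∈ I, ¬ ((fun z => (g z).1) '' U ⊆ S)) (q : ℕ → Y)
    (hq : ∀ n, PP g U {q n} ∈ I) :
    ∃ C : Set Y, IsClosed C ∧ (∀ n, q n ∉ C) ∧ PP g U C ∉ I := by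
  obtain ⟨L, hLc, hLs, hLI⟩ := hI.2.2 (PP g U univ) (PP_compact g U isClosed_univ) (by
    intro h
    refine hU _ h ?_
    rintro _ ⟨z, hz, rfl⟩
    exact ⟨g z, ⟨subset_closure ⟨z, hz, rfl⟩, mem_univ _⟩, rfl⟩)
    (fun n => PP g U {q n}) (fun n => ⟨PP_compact g U isClosed_singleton, hq n⟩)
  refine ⟨Prod.snd '' (closure (g '' U) ∩ Prod.fst ⁻¹' L), ?_, ?_, ?_⟩
  · exact ((isClosed_closure.inter (hLc.isClosed.preimage continuous_fst)).isCompact.image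
      continuous_snd).isClosed
  · rintro n ⟨p, ⟨hp, hpL⟩, hpq⟩
    exact (hLs hpL).2 (mem_iUnion.2 ⟨n, p, ⟨hp, hpq⟩, rfl⟩)
  · intro h
    refine hLI (hI.1.2.1 _ h L hLc.isClosed.measurableSet ?_)
    intro x hx
    obtain ⟨p, ⟨hp, -⟩, rfl⟩ := (hLs hx).1
    exact ⟨p, ⟨hp, ⟨p, ⟨hp, hx⟩, rfl⟩⟩, rfl⟩

lemma two_dense [Nonempty Y] (hY : ∀ y : Y, ¬ IsOpen ({y} : Set Y)) :
    ∃ q r : ℕ → Y, DenseRange q ∧ DenseRange r ∧ ∀ n m, r n ≠ q m := by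
  obtain ⟨q, hq⟩ := exists_dense_seq Y
  have hd : Dense (⋂ n, ({q n}ᶜ : Set Y)) := by
    refine dense_iInter_of_isOpen (fun n => isOpen_compl_singleton) (fun n => ?_)
    exact dense_compl_singleton_iff_not_open.2 (hY _)
  obtain ⟨t, hts, htc, htd⟩ := hd.exists_countable_dense_subset
  obtain ⟨r, hr⟩ := htc.exists_eq_range htd.nonempty
  refine ⟨q, r, hq, ?_, ?_⟩
  · unfold DenseRange; rwa [← hr]
  · intro n m h
    have : r n ∈ t := hr ▸ mem_range_self n
    exact (mem_iInter.1 (hts this) m) h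

variable [MetricSpace Z]

lemma key2 [Nonempty Y] (hY : ∀ y : Y, ¬ IsOpen ({y} : Set Y)) [Nonempty Z]
    (I : Set (Set X)) (hI : Calibrated I) (g : Z → X × Y)
    (hpos : ∀ U : Set Z, IsOpen U → U.Nonempty →
      ∀ S ∈ I, ¬ ((fun z => (g z).1) '' U ⊆ S)) :
    ∃ (q : ℕ → Y) (U₀ : Set Z), DenseRange q ∧ IsOpen U₀ ∧ U₀.Nonempty ∧
      ∀ U ⊆ U₀, IsOpen U → U.Nonempty →
        ∃ C : Set Y, IsClosed C ∧ (∀ n, q n ∉ C) ∧ PP g U C ∉ I := by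
  obtain ⟨q, r, hq, hr, hne⟩ := two_dense hY
  by_cases h : ∀ U : Set Z, IsOpen U → U.Nonempty →
        ∃ C : Set Y, IsClosed C ∧ (∀ n, q n ∉ C) ∧ PP g U C ∉ I
  · exact ⟨q, univ, hq, isOpen_univ, univ_nonempty, fun U _ => h U⟩
  · push Not at h
    obtain ⟨U₀, ho, hn, hbad⟩ := h
    refine ⟨r, U₀, hr, ho, hn, fun U hU hUo hUn => ?_⟩
    refine key1 I hI g U (hpos U hUo hUn) r (fun n => ?_)
    refine hI.1.2.1 _ (hbad {r n} isClosed_singleton (fun m hm => hne n m hm.symm)) _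
      (PP_compact g U isClosed_singleton).isClosed.measurableSet (PP_mono g hU _)

lemma shrink {V : Set Z} {h : Z → Y} (hh : Continuous h) (hV : IsOpen V) (q : Y)
    (hVq : ¬ V ⊆ h ⁻¹' {q}) (δ : ℝ) (hδ : 0 < δ) :
    ∃ U : Set Z, IsOpen U ∧ U.Nonempty ∧ closure U ⊆ V ∧
      Metric.ediam U ≤ ENNReal.ofReal δ ∧ q ∉ closure (h '' U) := by
  obtain ⟨z, hz, hzq⟩ := not_subset.1 hVq
  have hd : 0 < dist (h z) q := dist_pos.2 hzq
  set r := dist (h z) q / 2 with hr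
  have hW : IsOpen (V ∩ {w | r < dist (h w) q}) :=
    hV.inter (isOpen_lt continuous_const (hh.dist continuous_const))
  obtain ⟨ε, hε, hsub⟩ := Metric.nhds_basis_closedBall.mem_iff.1
    (hW.mem_nhds ⟨hz, by simp only [mem_ofPred_eq]; linarith⟩)
  have hm : 0 < min ε (δ / 2) := lt_min hε (by linarith)
  refine ⟨Metric.ball z (min ε (δ / 2)), Metric.isOpen_ball, ⟨z, Metric.mem_ball_self hm⟩,
    ?_, ?_, ?_⟩
  · refine Metric.closure_ball_subset_closedBall.trans
      ((Metric.closedBall_subset_closedBall (min_le_left _ _)).trans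
        (hsub.trans inter_subset_left))
  · refine Metric.ediam_le (fun x hx y hy => ?_)
    rw [edist_dist]
    apply ENNReal.ofReal_le_ofReal
    have h1 := Metric.mem_ball.1 hx
    have h2 := Metric.mem_ball.1 hy
    have h3 := dist_triangle_right x y z
    have h4 := min_le_right ε (δ / 2)
    linarith
  · intro hcl
    have hc : IsClosed {y : Y | r ≤ dist y q} :=
      isClosed_le continuous_const (continuous_id.dist continuous_const)
    have : q ∈ {y : Y | r ≤ dist y q} := by
      refine closure_minimal ?_ hc hcl
      rintro _ ⟨w, hw, rfl⟩
      have := (hsub (Metric.closedBall_subset_closedBall (min_le_left _ _)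
        (Metric.ball_subset_closedBall hw))).2
      rw [mem_ofPred_eq] at this ⊢
      exact le_of_lt this
    simp only [mem_ofPred_eq, dist_self] at this
    linarith

lemma step (I : Set (Set X)) (hemp : ∅ ∈ I) (g : Z → X × Y) (hg : Continuous g)
    (q : Y) (hq : ∀ V : Set Z, IsOpen V → V.Nonempty → ¬ V ⊆ (fun z => (g z).2) ⁻¹' {q})
    (δ : ℝ) (hδ : 0 < δ) (U : Set Z) (hU : IsOpen U) (C : Set Y) (hC : IsClosed C)
    (hP : PP g U C ∉ I) :
    ∃ D : ℕ → Set Z, (∀ n, IsOpen (D n) ∧ (D n).Nonempty ∧ closure (D n) ⊆ U ∧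
      Metric.ediam (D n) ≤ ENNReal.ofReal δ ∧ q ∉ closure ((fun z => (g z).2) '' D n)) ∧
      (∀ x ∈ PP g U C, ∀ ε > 0, ∃ n, ∀ z ∈ D n, dist (g z).1 x < ε) ∧
      (∀ n, ∀ z ∈ D n, ∃ y ∈ C, dist (g z).2 y < 1 / ((n : ℝ) + 1)) := by
  set E : Set (X × Y) := closure (g '' U) ∩ Prod.snd ⁻¹' C with hE
  have hEn : E.Nonempty := by
    by_contra h
    rw [not_nonempty_iff_eq_empty] at h
    apply hP
    rw [PP, ← hE, h, image_empty]
    exact hemp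
  have : Nonempty E := hEn.to_subtype
  obtain ⟨e, he⟩ := exists_dense_seq E
  have hV : ∀ n : ℕ, ∃ D : Set Z, IsOpen D ∧ D.Nonempty ∧
      closure D ⊆ U ∩ g ⁻¹' Metric.ball (e (Nat.unpair n).1 : X × Y) (1 / ((n : ℝ) + 1)) ∧
      Metric.ediam D ≤ ENNReal.ofReal δ ∧ q ∉ closure ((fun z => (g z).2) '' D) := by
    intro n
    have ho : IsOpen (U ∩ g ⁻¹' Metric.ball (e (Nat.unpair n).1 : X × Y) (1 / ((n : ℝ) + 1))) :=
      hU.inter (Metric.isOpen_ball.preimage hg)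
    refine shrink (h := fun z => (g z).2) (continuous_snd.comp hg) ho q (hq _ ho ?_) δ hδ
    have hcl := (e (Nat.unpair n).1).2.1
    obtain ⟨_, ⟨z, hz, rfl⟩, hd⟩ := Metric.mem_closure_iff.1 hcl (1 / ((n : ℝ) + 1))
      (by positivity)
    exact ⟨z, hz, by rwa [mem_preimage, Metric.mem_ball, dist_comm]⟩
  choose D h1 h2 h3 h4 h5 using hV
  refine ⟨D, fun n => ⟨h1 n, h2 n, (h3 n).trans inter_subset_left, h4 n, h5 n⟩, ?_, ?_⟩
  · rintro _ ⟨p, hp, rfl⟩ ε hε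
    obtain ⟨k, hk⟩ := Metric.denseRange_iff.1 he ⟨p, hp⟩ (ε / 2) (by linarith)
    obtain ⟨m, hm⟩ := exists_nat_one_div_lt (show 0 < ε / 2 by linarith)
    refine ⟨Nat.pair k m, fun z hz => ?_⟩
    have hb := (h3 _ (subset_closure hz)).2
    rw [Nat.unpair_pair, mem_preimage, Metric.mem_ball] at hb
    have hle : 1 / (((Nat.pair k m : ℕ) : ℝ) + 1) ≤ 1 / ((m : ℝ) + 1) := by
      apply one_div_le_one_div_of_le (by positivity)
      have : (m : ℝ) ≤ (Nat.pair k m : ℕ) := by exact_mod_cast Nat.right_le_pair k m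
      linarith
    have hk' : dist p (e k : X × Y) < ε / 2 := hk
    have h6 : dist (g z) p < ε := by
      have := dist_triangle_right (g z) p (e k : X × Y)
      linarith
    exact lt_of_le_of_lt (by rw [Prod.dist_eq]; exact le_max_left _ _) h6
  · intro n z hz
    refine ⟨_, (e (Nat.unpair n).1).2.2, ?_⟩
    have hb := (h3 _ (subset_closure hz)).2
    rw [mem_preimage, Metric.mem_ball] at hb
    exact lt_of_le_of_lt (by rw [Prod.dist_eq]; exact le_max_right _ _) hb

lemma res_ext (s : List ℕ) (α : ℕ → ℕ) (j n : ℕ) : ∃ β : ℕ → ℕ,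
    PiNat.res β (j + 1) = n :: PiNat.res α j := by
  refine ⟨Function.update α j n, ?_⟩
  rw [PiNat.res_succ, Function.update_self]
  congr 1
  rw [PiNat.res_eq_res]
  intro m hm
  rw [Function.update_of_ne hm.ne]

theorem core [CompleteSpace Z] [Nonempty Z] [Nonempty X] [Nonempty Y]
    (hY : ∀ y : Y, ¬ IsOpen ({y} : Set Y))
    (I : Set (Set X)) (hI : Calibrated I) (hemp : ∅ ∈ I) (g : Z → X × Y) (hg : Continuous g)
    (hpos : ∀ U : Set Z, IsOpen U → U.Nonempty →
      ∀ S ∈ I, ¬ ((fun z => (g z).1) '' U ⊆ S)) :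
    ∃ C : Set Y, IsCompact C ∧ IsNowhereDense C ∧
      ∀ S ∈ I, ¬ ((fun z => (g z).1) '' ((fun z => (g z).2) ⁻¹' C) ⊆ S) := by
  by_cases hsingle : ∃ y : Y, ∀ S ∈ I, ¬ ((fun z => (g z).1) '' ((fun z => (g z).2) ⁻¹' {y}) ⊆ S)
  · obtain ⟨y, hy⟩ := hsingle
    refine ⟨{y}, isCompact_singleton, ?_, hy⟩
    rw [isClosed_singleton.isNowhereDense_iff, interior_eq_empty_iff_dense_compl]
    exact dense_compl_singleton_iff_not_open.2 (hY _)
  push Not at hsingle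
  have hq0 : ∀ q : Y, ∀ V : Set Z, IsOpen V → V.Nonempty →
      ¬ V ⊆ (fun z => (g z).2) ⁻¹' {q} := by
    intro q V hV hVn hsub
    obtain ⟨S, hS, hSs⟩ := hsingle q
    exact hpos V hV hVn S hS ((image_mono hsub).trans hSs)
  obtain ⟨q, U₀, hqd, hU₀, hU₀n, hkey⟩ := key2 hY I hI g hpos
  -- the type of pieces
  let T := {U : Set Z // U ⊆ U₀ ∧ IsOpen U ∧ U.Nonempty}
  have hC : ∀ U : T, ∃ C : Set Y, IsClosed C ∧ (∀ n, q n ∉ C) ∧ PP g U.1 C ∉ I :=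
    fun U => hkey U.1 U.2.1 U.2.2.1 U.2.2.2
  choose CC hCc hCq hCI using hC
  have hD : ∀ (m : ℕ) (U : T), ∃ D : ℕ → T,
      (∀ n, closure (D n).1 ⊆ U.1 ∧ Metric.ediam (D n).1 ≤ ENNReal.ofReal (1 / ((m : ℝ) + 1)) ∧
        q m ∉ closure ((fun z => (g z).2) '' (D n).1)) ∧
      (∀ x ∈ PP g U.1 (CC U), ∀ ε > 0, ∃ n, ∀ z ∈ (D n).1, dist (g z).1 x < ε) ∧
      (∀ n, ∀ z ∈ (D n).1, ∃ y ∈ CC U, dist (g z).2 y < 1 / ((n : ℝ) + 1)) := by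
    intro m U
    obtain ⟨D, h1, h2, h3⟩ := step I hemp g hg (q m) (hq0 _) (1 / ((m : ℝ) + 1)) (by positivity)
      U.1 U.2.2.1 (CC U) (hCc U) (hCI U)
    exact ⟨fun n => ⟨D n, (subset_closure.trans (h1 n).2.2.1).trans U.2.1, (h1 n).1, (h1 n).2.1⟩,
      fun n => (h1 n).2.2, h2, h3⟩
  choose D hD1 hD2 hD3 using hD
  let A' : List ℕ → T := fun l => List.rec ⟨U₀, subset_rfl, hU₀, hU₀n⟩
    (fun n s U => D s.length U n) l
  have hA' : ∀ n s, A' (n :: s) = D s.length (A' s) n := fun n s => rfl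
  let A : List ℕ → Set Z := fun l => (A' l).1
  have hanti : CantorScheme.ClosureAntitone A := fun l a => (hD1 l.length (A' l) a).1
  have hdiam : CantorScheme.VanishingDiam A := by
    intro x
    rw [← tendsto_add_atTop_iff_nat 1]
    have ht : Tendsto (fun n : ℕ => ENNReal.ofReal (1 / ((n : ℝ) + 1))) atTop (𝓝 0) := by
      have := ENNReal.tendsto_ofReal (tendsto_one_div_add_atTop_nhds_zero_nat (𝕜 := ℝ))
      rwa [ENNReal.ofReal_zero] at this
    refine tendsto_of_tendsto_of_tendsto_of_le_of_le tendsto_const_nhds ht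
      (fun n => zero_le) (fun n => ?_)
    have := (hD1 (PiNat.res x n).length (A' (PiNat.res x n)) (x n)).2.1
    rw [PiNat.res_length] at this
    simp only [PiNat.res_succ, A, hA', PiNat.res_length]
    exact this
  have hne : ∀ l, (A l).Nonempty := fun l => (A' l).2.2.2
  have huniv := CantorScheme.ClosureAntitone.map_of_vanishingDiam hdiam hanti hne
  let ψ : (ℕ → ℕ) → Z := fun α => (CantorScheme.inducedMap A).2 ⟨α, huniv ▸ mem_univ α⟩
  have hψc : Continuous ψ := hdiam.map_continuous.comp (by fun_prop)
  have hψm : ∀ α n, ψ α ∈ A (PiNat.res α n) := fun α n => CantorScheme.map_mem _ n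
  let h : (ℕ → ℕ) → Y := fun α => (g (ψ α)).2
  refine ⟨closure (range h), isClosed_closure.isCompact, ?_, ?_⟩
  · -- nowhere dense
    have main : ∀ y ∈ closure (range h), (∀ U, y ∉ CC U) → ∀ j : ℕ,
        ∃ s : List ℕ, s.length = j ∧ y ∈ closure (h '' {α | PiNat.res α j = s}) := by
      intro y hy hyC j
      induction j with
      | zero =>
        refine ⟨[], rfl, ?_⟩
        simpa using hy
      | succ j ih =>
        obtain ⟨s, hs, hys⟩ := ih
        by_contra hcon
        push Not at hcon
        apply hyC (A' s)
        have hclose : ∀ N : ℕ, ∃ c ∈ CC (A' s), dist y c < 2 / ((N : ℝ) + 1) := by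
          intro N
          have hsub : h '' {α | PiNat.res α j = s} ⊆
              (⋃ n ∈ Iio N, h '' {α | PiNat.res α (j + 1) = n :: s}) ∪
              ⋃ n ∈ Ici N, h '' {α | PiNat.res α (j + 1) = n :: s} := by
            rintro _ ⟨α, hα, rfl⟩
            have hα' : PiNat.res α (j + 1) = α j :: s := by
              rw [PiNat.res_succ, show PiNat.res α j = s from hα]
            rcases lt_or_ge (α j) N with hlt | hge
            · exact Or.inl (mem_biUnion (show α j ∈ Iio N from hlt) ⟨α, hα', rfl⟩)
            · exact Or.inr (mem_biUnion (show α j ∈ Ici N from hge) ⟨α, hα', rfl⟩)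
          have hy2 := closure_mono hsub hys
          rw [closure_union, (finite_Iio N).closure_biUnion] at hy2
          rcases hy2 with hy2 | hy2
          · obtain ⟨n, -, hn⟩ := mem_iUnion₂.1 hy2
            exact absurd hn (hcon (n :: s) (by simp [hs]))
          · obtain ⟨w, hw, hd⟩ := Metric.mem_closure_iff.1 hy2 (1 / ((N : ℝ) + 1)) (by positivity)
            obtain ⟨n, hn, α, hα, rfl⟩ := mem_iUnion₂.1 hw
            have hm := hψm α (j + 1)
            rw [show PiNat.res α (j + 1) = n :: s from hα] at hm
            obtain ⟨c, hc, hcd⟩ := hD3 s.length (A' s) n (ψ α) hm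
            refine ⟨c, hc, ?_⟩
            have hle : 1 / ((n : ℝ) + 1) ≤ 1 / ((N : ℝ) + 1) := by
              apply one_div_le_one_div_of_le (by positivity)
              have : (N : ℝ) ≤ n := by exact_mod_cast hn
              linarith
            have htri := dist_triangle y (h α) c
            have : (2 : ℝ) / ((N : ℝ) + 1) = 1 / ((N : ℝ) + 1) + 1 / ((N : ℝ) + 1) := by ring
            have hcd' : dist (h α) c < 1 / ((n : ℝ) + 1) := hcd
            linarith
        rw [← (hCc (A' s)).closure_eq, Metric.mem_closure_iff]
        intro ε hε
        obtain ⟨N, hN⟩ := exists_nat_one_div_lt (show 0 < ε / 2 by linarith)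
        obtain ⟨c, hc, hd⟩ := hclose N
        refine ⟨c, hc, hd.trans ?_⟩
        have : (2 : ℝ) / ((N : ℝ) + 1) = 2 * (1 / ((N : ℝ) + 1)) := by ring
        linarith
    have havoid : ∀ m, q m ∉ closure (range h) := by
      intro m hm
      obtain ⟨s, hs, hcl⟩ := main (q m) hm (fun U => hCq U m) (m + 1)
      match s, hs with
      | n :: s, hs =>
        have hs' : s.length = m := by simpa using hs
        have := (hD1 m (A' s) n).2.2
        apply this
        refine closure_mono ?_ hcl
        rintro _ ⟨α, hα, rfl⟩
        have hm := hψm α (m + 1)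
        rw [show PiNat.res α (m + 1) = n :: s from hα] at hm
        refine ⟨ψ α, ?_, rfl⟩
        rw [← hs']
        exact hm
    rw [isClosed_closure.isNowhereDense_iff, interior_eq_empty_iff_dense_compl]
    refine hqd.mono ?_
    rintro _ ⟨m, rfl⟩
    exact havoid m
  · -- positive
    intro S hS hsub
    obtain ⟨K, hKc, hKI, hSK⟩ := hI.2.1 S hS
    have hcov : ⋃ n, (fun α => (g (ψ α)).1) ⁻¹' (K n) = univ := by
      rw [eq_univ_iff_forall]
      intro α
      rw [← preimage_iUnion]
      exact hSK (hsub ⟨ψ α, subset_closure ⟨α, rfl⟩, rfl⟩)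
    have hcont : Continuous (fun α => (g (ψ α)).1) := continuous_fst.comp (hg.comp hψc)
    obtain ⟨n, α, hα⟩ := nonempty_interior_of_iUnion_of_closed
      (fun n => (hKc n).isClosed.preimage hcont) hcov
    obtain ⟨_, ⟨x, j, rfl⟩, hαj, hint⟩ :=
      (PiNat.isTopologicalBasis_cylinders (fun _ : ℕ => ℕ)).exists_subset_of_mem_open hα
        isOpen_interior
    apply hCI (A' (PiNat.res x j))
    refine hI.1.2.1 _ hKI _ (PP_compact g _ (hCc _)).isClosed.measurableSet ?_
    refine Subset.trans ?_ (subset_iUnion K n)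
    intro p hp
    rw [← (hKc n).isClosed.closure_eq, Metric.mem_closure_iff]
    intro ε hε
    obtain ⟨k, hk⟩ := hD2 (PiNat.res x j).length (A' (PiNat.res x j)) p hp ε hε
    obtain ⟨β, hβ⟩ := res_ext [] x j k
    have hm := hψm β (j + 1)
    rw [hβ] at hm
    refine ⟨(g (ψ β)).1, ?_, ?_⟩
    · have : β ∈ PiNat.cylinder x j := by
        rw [PiNat.cylinder_eq_res]
        rw [PiNat.res_succ] at hβ
        exact (List.cons.inj hβ).2
      have hmem := interior_subset (hint this)
      exact hmem
    · rw [dist_comm]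
      exact hk _ hm

end core

theorem core2 {X Y Z : Type*}
    [MetricSpace X] [CompactSpace X] [MeasurableSpace X] [BorelSpace X]
    [MetricSpace Y] [CompactSpace Y] [MeasurableSpace Y] [BorelSpace Y]
    [MeasurableSpace Z] [StandardBorelSpace Z] [Nonempty X] [Nonempty Y]
    (hY : ∀ y : Y, ¬ IsOpen ({y} : Set Y))
    (I : Set (Set X)) (hI : Calibrated I) (hemp : ∅ ∈ I) (g : Z → X × Y) (hg : Measurable g)
    (hpos : ∀ S ∈ I, ¬ (range (fun z => (g z).1) ⊆ S)) :
    ∃ C : Set Y, IsCompact C ∧ IsNowhereDense C ∧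
      ∀ S ∈ I, ¬ ((fun z => (g z).1) '' ((fun z => (g z).2) ⁻¹' C) ⊆ S) := by
  obtain ⟨t, hbor, hpol⟩ := StandardBorelSpace.polish (α := Z)
  obtain ⟨t', -, hgc, hpol'⟩ := hg.exists_continuous
  clear hbor hpol t
  letI := t'
  let φ : Z → X := fun z => (g z).1
  let N : Set Z := ⋃₀ {U ∈ countableBasis Z | ∃ S ∈ I, φ '' U ⊆ S}
  have hNo : IsOpen N := isOpen_sUnion (fun U hU => isOpen_of_mem_countableBasis hU.1)
  have hNI : ∃ S ∈ I, φ '' N ⊆ S := by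
    have hcnt : {U ∈ countableBasis Z | ∃ S ∈ I, φ '' U ⊆ S}.Countable :=
      (countable_countableBasis Z).mono (fun U hU => hU.1)
    rcases Set.eq_empty_or_nonempty {U ∈ countableBasis Z | ∃ S ∈ I, φ '' U ⊆ S} with he | hn
    · refine ⟨∅, hemp, ?_⟩
      simp only [N]
      rw [he, sUnion_empty, image_empty]
    · obtain ⟨u, hu⟩ := hcnt.exists_eq_range hn
      have : ∀ n, ∃ S ∈ I, φ '' (u n) ⊆ S := fun n =>
        (show u n ∈ {U ∈ countableBasis Z | ∃ S ∈ I, φ '' U ⊆ S} from hu ▸ mem_range_self n).2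
      choose S hS hS' using this
      refine ⟨⋃ n, S n, hI.1.2.2 S hS, ?_⟩
      simp only [N, hu, sUnion_range, image_iUnion]
      exact iUnion_mono hS'
  obtain ⟨S₀, hS₀, hNS⟩ := hNI
  have hunion : ∀ S ∈ I, ∀ S' ∈ I, S ∪ S' ∈ I := by
    intro S hS S' hS'
    have := hI.1.2.2 (fun n => if n = 0 then S else S') (fun n => by split_ifs <;> assumption)
    refine hI.1.2.1 _ this _ ((hI.1.1 _ hS).union (hI.1.1 _ hS')) ?_
    rintro x (hx | hx)
    · exact mem_iUnion.2 ⟨0, by simpa using hx⟩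
    · exact mem_iUnion.2 ⟨1, by simpa using hx⟩
  have hcl : IsClosed Nᶜ := hNo.isClosed_compl
  haveI : PolishSpace (Nᶜ : Set Z) := hcl.polishSpace
  have hne : Nonempty (Nᶜ : Set Z) := by
    by_contra h
    rw [nonempty_coe_sort, not_nonempty_iff_eq_empty, compl_empty_iff] at h
    refine hpos S₀ hS₀ ?_
    rw [h, image_univ] at hNS
    exact hNS
  letI := upgradeIsCompletelyMetrizable (Nᶜ : Set Z)
  obtain ⟨C, hCc, hCn, hC⟩ := core (Z := (Nᶜ : Set Z)) hY I hI hemp (fun z => g z.1)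
    (hgc.comp continuous_subtype_val) (by
      intro U hU hUn S hS hsub
      obtain ⟨V, hV, rfl⟩ := isOpen_induced_iff.1 hU
      obtain ⟨z, hz⟩ := hUn
      obtain ⟨W, hW, hzW, hWV⟩ := (isBasis_countableBasis Z).exists_subset_of_mem_open
        (show z.1 ∈ V from hz) hV
      refine z.2 (mem_sUnion.2 ⟨W, ⟨hW, S₀ ∪ S, hunion _ hS₀ _ hS, ?_⟩, hzW⟩)
      rintro _ ⟨w, hw, rfl⟩
      by_cases hwN : w ∈ N
      · exact Or.inl (hNS ⟨w, hwN, rfl⟩)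
      · exact Or.inr (hsub ⟨⟨w, hwN⟩, hWV hw, rfl⟩))
  refine ⟨C, hCc, hCn, fun S hS hsub => hC S hS ?_⟩
  rintro _ ⟨z, hz, rfl⟩
  exact hsub ⟨z.1, hz, rfl⟩

/-- Theorem 1.1(i): if `I` is a calibrated σ-ideal on a compactum `X` without isolated
points containing all singletons, `B ∉ I` is Borel and `f : B → Y` is a Borel map into a
compactum `Y` without isolated points, then there is a compact nowhere dense `C ⊆ Y`
with `f⁻¹(C) ∉ I`. -/
theorem statement0 {X Y : Type*}
    [MetricSpace X] [CompactSpace X] [Nonempty X] [MeasurableSpace X] [BorelSpace X]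
    [MetricSpace Y] [CompactSpace Y] [Nonempty Y] [MeasurableSpace Y] [BorelSpace Y]
    (hX : ∀ x : X, ¬ IsOpen ({x} : Set X))
    (hY : ∀ y : Y, ¬ IsOpen ({y} : Set Y))
    (I : Set (Set X)) (hI : Calibrated I) (hsing : ∀ x : X, {x} ∈ I)
    (B : Set X) (hB : MeasurableSet B) (hBI : B ∉ I)
    (f : X → Y) (hf : Measurable fun x : B => f x.1) :
    ∃ C : Set Y, IsCompact C ∧ IsNowhereDense C ∧ {x ∈ B | f x ∈ C} ∉ I := by
  have hemp : ∅ ∈ I := by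
    obtain ⟨x⟩ := ‹Nonempty X›
    exact hI.1.2.1 _ (hsing x) ∅ MeasurableSet.empty (empty_subset _)
  haveI := hB.standardBorel
  obtain ⟨C, hCc, hCn, hC⟩ := core2 (Z := B) hY I hI hemp (fun x => (x.1, f x.1))
    (measurable_subtype_coe.prodMk hf) (by
      intro S hS hsub
      refine hBI (hI.1.2.1 S hS B hB ?_)
      intro x hx
      exact hsub ⟨⟨x, hx⟩, rfl⟩)
  refine ⟨C, hCc, hCn, fun h => hC _ h ?_⟩
  rintro _ ⟨z, hz, rfl⟩
  exact ⟨z.2, hz⟩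
end

section
/- Let I be a calibrated σ-ideal on a compactum X without isolated points such that I contains all singletons, let B ⊆ X be a Borel set with B ∉ I, and let f : B → Y be a Borel-measurable map into a compactum Y without isolated points. If Y is countable-dimensional, then there exists a zero-dimensional (equivalently, totally disconnected) compact set C ⊆ Y such that f⁻¹(C) ∉ I. -/
open MeasureTheory Topology Filter Set

/-- A subset `Z` of a space is zero-dimensional: the subspace topology on `Z` has a basis
of sets clopen in `Z`. -/
def ZeroDimSubset {Y : Type*} [TopologicalSpace Y] (Z : Set Y) : Prop :=
  ∀ z : Z, ∀ U : Set Z, IsOpen U → z ∈ U → ∃ V : Set Z, IsClopen V ∧ z ∈ V ∧ V ⊆ U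

/-- A space is countable-dimensional if it is the union of countably many
zero-dimensional subsets. -/
def CountableDimensional (Y : Type*) [TopologicalSpace Y] : Prop :=
  ∃ Z : ℕ → Set Y, (∀ n, ZeroDimSubset (Z n)) ∧ (⋃ n, Z n) = Set.univ


theorem zd_nbhd {Y : Type*} [MetricSpace Y] [CompactSpace Y] {Z : Set Y} (hZ : ZeroDimSubset Z)
    {z : Y} (hz : z ∈ Z) {ε : ℝ} (hε : 0 < ε) :
    ∃ V : Set Y, IsOpen V ∧ z ∈ V ∧ V ⊆ Metric.ball z ε ∧ Disjoint (frontier V) Z := by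
  obtain ⟨T, hT, hzT, hTb⟩ := hZ ⟨z, hz⟩ (Subtype.val ⁻¹' Metric.ball z ε)
    (Metric.isOpen_ball.preimage continuous_subtype_val) (by simpa using hε)
  have key : ∀ A : Set Z, IsClopen A → Disjoint (closure (Subtype.val '' A : Set Y))
      (Subtype.val '' Aᶜ) := by
    intro A hA
    rw [Set.disjoint_left]
    rintro _ hx ⟨x, hxA, rfl⟩
    apply hxA
    rw [← hA.isClosed.closure_eq, closure_subtype]
    exact hx
  have h1 := key T hT
  have h2 := key Tᶜ hT.compl
  rw [compl_compl] at h2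
  have h3 := CompletelyNormalSpace.completely_normal h1 h2.symm
  rw [← separatedNhds_iff_disjoint] at h3
  obtain ⟨U, W, hU, hW, hTU, hTW, hd⟩ := h3
  refine ⟨U ∩ Metric.ball z ε, hU.inter Metric.isOpen_ball,
    ⟨hTU ⟨⟨z, hz⟩, hzT, rfl⟩, by simpa using hε⟩, inter_subset_right, ?_⟩
  rw [Set.disjoint_left]
  intro y hy hyZ
  by_cases hyT : (⟨y, hyZ⟩ : Z) ∈ T
  · have : y ∈ U ∩ Metric.ball z ε := ⟨hTU ⟨_, hyT, rfl⟩, hTb hyT⟩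
    rw [(hU.inter Metric.isOpen_ball).frontier_eq] at hy
    exact hy.2 this
  · have hyW : y ∈ W := hTW ⟨_, hyT, rfl⟩
    have hyc : y ∈ closure (U ∩ Metric.ball z ε) := frontier_subset_closure hy
    obtain ⟨w, hw1, hw2⟩ := mem_closure_iff.1 hyc W hW hyW
    exact Set.disjoint_left.1 hd hw2.1 hw1

theorem zd_family {Y : Type*} [MetricSpace Y] [CompactSpace Y] {Z : Set Y}
    (hZ : ZeroDimSubset Z) {ε : ℝ} (hε : 0 < ε) :
    ∃ 𝒯 : Set (Set Y), 𝒯.Countable ∧ (∀ T ∈ 𝒯, IsClosed T ∧ Disjoint T Z) ∧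
      ∀ E : Set Y, IsPreconnected E → (∀ T ∈ 𝒯, Disjoint T E) →
        ∀ x ∈ E, ∀ y ∈ E, dist x y ≤ 2 * ε := by
  choose! V hVo hzV hVb hVf using fun z (hz : z ∈ Z) => zd_nbhd hZ hz hε
  obtain ⟨c, hcZ, hc, hcov⟩ := TopologicalSpace.countable_cover_nhdsWithin
    (f := V) (s := Z) fun z hz => mem_nhdsWithin_of_mem_nhds ((hVo z hz).mem_nhds (hzV z hz))
  refine ⟨insert (⋃ z ∈ c, V z)ᶜ ((fun z => frontier (V z)) '' c), (hc.image _).insert _, ?_, ?_⟩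
  · rintro T (rfl | ⟨z, hz, rfl⟩)
    · exact ⟨(isOpen_biUnion fun z hz => hVo z (hcZ hz)).isClosed_compl,
        disjoint_compl_left_iff_subset.2 hcov⟩
    · exact ⟨isClosed_frontier, hVf z (hcZ hz)⟩
  · intro E hE hT x hx y hy
    have h1 := hT _ (mem_insert _ _)
    rw [disjoint_compl_left_iff_subset] at h1
    obtain ⟨z, hz, hxz⟩ := mem_iUnion₂.1 (h1 hx)
    have h2 := hT _ (mem_insert_of_mem _ ⟨z, hz, rfl⟩)
    have h3 : E ⊆ V z := by
      apply hE.subset_of_closure_inter_subset (hVo z (hcZ hz)) ⟨x, hx, hxz⟩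
      rintro w ⟨hw, hwE⟩
      by_contra hwV
      refine Set.disjoint_left.1 h2 ?_ hwE
      show w ∈ frontier (V z)
      rw [(hVo z (hcZ hz)).frontier_eq]
      exact ⟨hw, hwV⟩
    have hxb := hVb z (hcZ hz) (h3 hx)
    have hyb := hVb z (hcZ hz) (h3 hy)
    rw [Metric.mem_ball] at hxb hyb
    have := dist_triangle_right x y z
    linarith

theorem zd_seq {Y : Type*} [MetricSpace Y] [CompactSpace Y] {Z : Set Y}
    (hZ : ZeroDimSubset Z) :
    ∃ T : ℕ → Set Y, (∀ i, IsClosed (T i) ∧ Disjoint (T i) Z) ∧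
      ∀ M : Set Y, (∀ i, Disjoint (T i) M) → IsTotallyDisconnected M := by
  choose 𝒯 h1 h2 h3 using fun k : ℕ => zd_family hZ (ε := (1 / 2) ^ k) (by positivity)
  have hc : (insert ∅ (⋃ k, 𝒯 k)).Countable := (countable_iUnion h1).insert _
  obtain ⟨T, hT⟩ := hc.exists_eq_range (insert_nonempty _ _)
  refine ⟨T, ?_, ?_⟩
  · intro i
    have : T i ∈ insert ∅ (⋃ k, 𝒯 k) := hT ▸ mem_range_self i
    rcases this with h | h
    · rw [h]; exact ⟨isClosed_empty, by simp⟩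
    · obtain ⟨k, hk⟩ := mem_iUnion.1 h
      exact h2 k _ hk
  · intro M hM E hEM hE x hx y hy
    have key : ∀ k : ℕ, dist x y ≤ 2 * (1 / 2) ^ k := by
      intro k
      refine h3 k E hE ?_ x hx y hy
      intro S hS
      have : S ∈ range T := hT ▸ mem_insert_of_mem _ (mem_iUnion.2 ⟨k, hS⟩)
      obtain ⟨i, rfl⟩ := this
      exact (hM i).mono_right hEM
    have hl : Tendsto (fun k : ℕ => (2 : ℝ) * (1 / 2) ^ k) atTop (𝓝 (2 * 0)) :=
      (tendsto_pow_atTop_nhds_zero_of_lt_one (by norm_num) (by norm_num)).const_mul 2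
    have := ge_of_tendsto' hl key
    rw [mul_zero] at this
    exact dist_le_zero.1 this

/-- Image in `X` of the part of `Γ` lying above `F`. -/
def projPart {X Y : Type*} (Γ : Set (X × Y)) (F : Set Y) : Set X :=
  Prod.fst '' (Γ ∩ Prod.snd ⁻¹' F)

theorem empty_mem_I {X : Type*} [MetricSpace X] [Nonempty X] [MeasurableSpace X]
    {I : Set (Set X)} (hI : SigmaIdeal I) (hsing : ∀ x : X, {x} ∈ I) : (∅ : Set X) ∈ I :=
  hI.2.1 _ (hsing (Classical.arbitrary X)) _ MeasurableSet.empty (empty_subset _)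

theorem exists_L {X Y : Type*}
    [MetricSpace X] [CompactSpace X] [Nonempty X] [MeasurableSpace X]
    [MetricSpace Y] [CompactSpace Y]
    (hYdim : CountableDimensional Y)
    {I : Set (Set X)} (hI : Calibrated I) (hsing : ∀ x : X, {x} ∈ I)
    (Γ : Set (X × Y)) (hΓ : IsCompact Γ) (hΓI : Prod.fst '' Γ ∉ I) :
    ∃ (L : Set X) (F : Set Y), IsCompact L ∧ L ∉ I ∧ IsClosed F ∧ L ⊆ projPart Γ F ∧
      IsTotallyDisconnected (Prod.snd '' (Γ ∩ L ×ˢ F)) := by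
  obtain ⟨Z, hZ, hZu⟩ := hYdim
  by_contra hcon
  push Not at hcon
  have hcomp : ∀ F : Set Y, IsClosed F → IsCompact (projPart Γ F) := fun F hF =>
    (hΓ.inter_right (hF.preimage continuous_snd)).image continuous_fst
  have step : ∀ n : ℕ, ∀ F : {F : Set Y // IsClosed F ∧ projPart Γ F ∉ I},
      ∃ F' : {F : Set Y // IsClosed F ∧ projPart Γ F ∉ I}, F'.1 ⊆ F.1 ∧ Disjoint F'.1 (Z n) := by
    rintro n ⟨F, hF, hFI⟩
    obtain ⟨T, hT, hTM⟩ := zd_seq (hZ n)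
    by_contra hno
    have hall : ∀ i, projPart Γ (F ∩ T i) ∈ I := by
      intro i
      by_contra hi
      exact hno ⟨⟨F ∩ T i, hF.inter (hT i).1, hi⟩, inter_subset_left,
        (hT i).2.mono_left inter_subset_right⟩
    obtain ⟨L, hL, hLs, hLI⟩ := hI.2.2 _ (hcomp F hF) hFI (fun i => projPart Γ (F ∩ T i))
      fun i => ⟨hcomp _ (hF.inter (hT i).1), hall i⟩
    refine hcon L F hL hLI hF (hLs.trans sdiff_subset) (hTM _ ?_)
    intro i
    rw [Set.disjoint_left]
    rintro _ hyT ⟨⟨x, y⟩, ⟨hxyΓ, hxL, hyF⟩, rfl⟩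
    exact (hLs hxL).2 (mem_iUnion.2 ⟨i, (x, y), ⟨hxyΓ, hyF, hyT⟩, rfl⟩)
  choose nx hnx1 hnx2 using step
  let Fs : ℕ → {F : Set Y // IsClosed F ∧ projPart Γ F ∉ I} := fun n =>
    Nat.rec ⟨univ, isClosed_univ, by simpa [projPart] using hΓI⟩ (fun n F => nx n F) n
  have hFs : ∀ n, Fs (n + 1) = nx n (Fs n) := fun n => rfl
  obtain ⟨y, hy⟩ := IsCompact.nonempty_iInter_of_sequence_nonempty_isCompact_isClosed
    (fun n => (Fs n).1) (fun n => by rw [hFs]; exact hnx1 _ _)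
    (fun n => by
      rw [Set.nonempty_iff_ne_empty]
      intro h
      apply (Fs n).2.2
      rw [h]
      simpa [projPart] using empty_mem_I hI.1 hsing)
    (Fs 0).2.1.isCompact (fun n => (Fs n).2.1)
  have hyZ : y ∈ ⋃ n, Z n := hZu ▸ mem_univ y
  obtain ⟨n, hn⟩ := mem_iUnion.1 hyZ
  have := mem_iInter.1 hy (n + 1)
  simp only [hFs] at this
  exact Set.disjoint_left.1 (hnx2 n (Fs n)) this hn

/-- `A` is contained in a member of `I`. -/
def SmallSet {X : Type*} (I : Set (Set X)) (A : Set X) : Prop := ∃ J ∈ I, A ⊆ J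

theorem SmallSet.mono {X : Type*} {I : Set (Set X)} {A A' : Set X} (h : SmallSet I A')
    (hs : A ⊆ A') : SmallSet I A := by
  obtain ⟨J, hJ, h⟩ := h
  exact ⟨J, hJ, hs.trans h⟩

theorem smallSet_iUnion {X : Type*} [MetricSpace X] [MeasurableSpace X]
    {I : Set (Set X)} (hI : SigmaIdeal I) {A : ℕ → Set X} (h : ∀ n, SmallSet I (A n)) :
    SmallSet I (⋃ n, A n) := by
  choose J hJ hs using h
  exact ⟨⋃ n, J n, hI.2.2 J hJ, iUnion_mono hs⟩

theorem smallSet_union {X : Type*} [MetricSpace X] [MeasurableSpace X]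
    {I : Set (Set X)} (hI : SigmaIdeal I) {A A' : Set X} (h : SmallSet I A) (h' : SmallSet I A') :
    SmallSet I (A ∪ A') := by
  have := smallSet_iUnion hI (A := fun n => if n = 0 then A else A')
    (fun n => by by_cases hn : n = 0 <;> simp [hn, h, h'])
  refine this.mono ?_
  rintro x (hx | hx)
  · exact mem_iUnion.2 ⟨0, by simpa using hx⟩
  · exact mem_iUnion.2 ⟨1, by simpa using hx⟩

/-- Points all of whose neighbourhoods have non-small image. -/
def posPts {X P : Type*} [TopologicalSpace P] (I : Set (Set X)) (g : P → X) : Set P :=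
  {p | ∀ O : Set P, IsOpen O → p ∈ O → ¬ SmallSet I (g '' O)}

theorem small_compl_posPts {X P : Type*} [MetricSpace X] [Nonempty X] [MeasurableSpace X]
    [TopologicalSpace P] [SecondCountableTopology P]
    {I : Set (Set X)} (hI : SigmaIdeal I) (hsing : ∀ x : X, {x} ∈ I) (g : P → X) :
    SmallSet I (g '' (posPts I g)ᶜ) := by
  have : ∀ p ∈ (posPts I g)ᶜ, ∃ O : Set P, IsOpen O ∧ p ∈ O ∧ SmallSet I (g '' O) := by
    intro p hp
    simp only [posPts, mem_compl_iff, mem_ofPred_eq] at hp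
    push Not at hp
    exact hp
  choose! O hO hpO hs using this
  obtain ⟨c, hcs, hc, hcov⟩ := TopologicalSpace.countable_cover_nhdsWithin
    (f := O) (s := (posPts I g)ᶜ)
    fun z hz => mem_nhdsWithin_of_mem_nhds ((hO z hz).mem_nhds (hpO z hz))
  rcases c.eq_empty_or_nonempty with rfl | hne
  · refine ⟨∅, empty_mem_I hI hsing, ?_⟩
    simp only [mem_empty_iff_false, iUnion_of_empty, iUnion_empty, subset_empty_iff] at hcov
    rw [hcov]; simp
  · obtain ⟨e, rfl⟩ := hc.exists_eq_range hne
    refine (smallSet_iUnion hI (A := fun n => g '' O (e n))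
      (fun n => hs _ (hcs (mem_range_self n)))).mono ?_
    rintro _ ⟨p, hp, rfl⟩
    obtain ⟨_, ⟨n, rfl⟩, hn⟩ := mem_iUnion₂.1 (hcov hp)
    exact mem_iUnion.2 ⟨n, p, hn, rfl⟩

theorem exists_pos_pt {X P : Type*} [MetricSpace X] [Nonempty X] [MeasurableSpace X]
    [TopologicalSpace P] [SecondCountableTopology P]
    {I : Set (Set X)} (hI : SigmaIdeal I) (hsing : ∀ x : X, {x} ∈ I) (g : P → X)
    (O N : Set P) (hO : ¬ SmallSet I (g '' O)) (hN : SmallSet I (g '' N)) :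
    ∃ p ∈ O ∩ posPts I g, p ∉ N := by
  by_contra hcon
  push Not at hcon
  apply hO
  refine (smallSet_union hI hN (small_compl_posPts hI hsing g)).mono ?_
  rintro _ ⟨p, hp, rfl⟩
  by_cases h : p ∈ posPts I g
  · exact Or.inl ⟨p, hcon p ⟨hp, h⟩, rfl⟩
  · exact Or.inr ⟨p, h, rfl⟩

theorem step_lemma {X Y P : Type*}
    [MetricSpace X] [CompactSpace X] [Nonempty X] [MeasurableSpace X] [BorelSpace X]
    [MetricSpace Y] [CompactSpace Y]
    [MetricSpace P] [SecondCountableTopology P]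
    (hYdim : CountableDimensional Y)
    {I : Set (Set X)} (hI : Calibrated I) (hsing : ∀ x : X, {x} ∈ I)
    (g : P → X) (h : P → Y) (hg : Continuous g) (hh : Continuous h)
    (hno : ∀ C : Set Y, IsCompact C → IsTotallyDisconnected C → SmallSet I (g '' (h ⁻¹' C)))
    (O : Set P) (hO : IsOpen O) (hOI : ¬ SmallSet I (g '' O)) (ε : ℝ) (hε : 0 < ε) :
    ∃ (L : Set X) (M : Set Y) (δ : ℕ → ℝ) (c : ℕ → Set P),
      L ∉ I ∧ IsCompact L ∧ IsCompact M ∧ M.Nonempty ∧ IsTotallyDisconnected M ∧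
      (∀ n, 0 < δ n ∧ δ (n + 1) ≤ δ n ∧ δ n ≤ 1 / ((n : ℝ) + 1)) ∧
      (∀ n, IsOpen (c n) ∧ ¬ SmallSet I (g '' c n) ∧ closure (c n) ⊆ O ∧
        (∀ p ∈ c n, ∀ q ∈ c n, dist p q ≤ ε) ∧ (∀ p ∈ c n, ∀ q ∈ c n, dist (h p) (h q) ≤ ε) ∧
        (∀ p ∈ c n, δ (n + 1) ≤ Metric.infDist (h p) M ∧ Metric.infDist (h p) M ≤ δ n / 2)) ∧
      (∀ x ∈ L, ∀ η > 0, ∃ n, ∀ p ∈ c n, dist (g p) x < η) := by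
  set Γ : Set (X × Y) := closure ((fun p => (g p, h p)) '' (O ∩ posPts I g)) with hΓdef
  have hΓ : IsCompact Γ := isClosed_closure.isCompact
  have hΓI : Prod.fst '' Γ ∉ I := by
    intro hmem
    obtain ⟨p, hp, hpN⟩ := exists_pos_pt hI.1 hsing g O (g ⁻¹' (Prod.fst '' Γ)) hOI
      ⟨_, hmem, image_preimage_subset _ _⟩
    exact hpN ⟨(g p, h p), subset_closure ⟨p, hp, rfl⟩, rfl⟩
  obtain ⟨L, F, hL, hLI, hF, hLF, hTD⟩ := exists_L hYdim hI hsing Γ hΓ hΓI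
  set Λ := Γ ∩ L ×ˢ F with hΛdef
  set M := Prod.snd '' Λ with hMdef
  have hΛ : IsCompact Λ := hΓ.inter_right (hL.isClosed.prod hF)
  have hM : IsCompact M := hΛ.image continuous_snd
  have hLΛ : ∀ x ∈ L, ∃ y, (x, y) ∈ Λ := by
    intro x hx
    obtain ⟨⟨x', y⟩, ⟨h1, h2⟩, rfl⟩ := hLF hx
    exact ⟨y, h1, hx, h2⟩
  have hLne : L.Nonempty := by
    rw [nonempty_iff_ne_empty]
    rintro rfl
    exact hLI (empty_mem_I hI.1 hsing)
  obtain ⟨x₀, hx₀⟩ := hLne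
  obtain ⟨y₀, hy₀⟩ := hLΛ x₀ hx₀
  have hMne : M.Nonempty := ⟨y₀, _, hy₀, rfl⟩
  have : Nonempty Λ := ⟨⟨_, hy₀⟩⟩
  let ds : ℕ → Λ := TopologicalSpace.denseSeq Λ
  let lam : ℕ → X × Y := fun n => (ds (Nat.unpair n).1).1
  have hlam : ∀ n, lam n ∈ Λ := fun n => (ds (Nat.unpair n).1).2
  -- one choice
  have one : ∀ (n : ℕ) (d : {d : ℝ // 0 < d}), ∃ (c : Set P) (d' : {d : ℝ // 0 < d}),
      IsOpen c ∧ ¬ SmallSet I (g '' c) ∧ closure c ⊆ O ∧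
      (∀ p ∈ c, ∀ q ∈ c, dist p q ≤ ε) ∧ (∀ p ∈ c, ∀ q ∈ c, dist (h p) (h q) ≤ ε) ∧
      (∀ p ∈ c, d'.1 ≤ Metric.infDist (h p) M ∧ Metric.infDist (h p) M ≤ d.1 / 2) ∧
      d'.1 ≤ d.1 ∧ d'.1 ≤ 1 / ((n : ℝ) + 2) ∧
      (∀ p ∈ c, dist (g p) (lam n).1 ≤ d.1) := by
    rintro n ⟨d, hd⟩
    have hlΓ : lam n ∈ Γ := (hlam n).1
    obtain ⟨_, ⟨p, hp, rfl⟩, hpd⟩ := Metric.mem_closure_iff.1 hlΓ (d / 4) (by positivity)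
    -- neighbourhood of p
    let W : Set P := O ∩ {q | dist (g q) (lam n).1 < d / 4} ∩ {q | dist (h q) (lam n).2 < d / 4}
    have hWo : IsOpen W := (hO.inter (isOpen_lt (hg.dist continuous_const) continuous_const)).inter
      (isOpen_lt (hh.dist continuous_const) continuous_const)
    have hpW : p ∈ W := by
      rw [dist_comm, Prod.dist_eq, max_lt_iff] at hpd
      exact ⟨⟨hp.1, hpd.1⟩, hpd.2⟩
    obtain ⟨q, ⟨hqW, hqP⟩, hqM⟩ := exists_pos_pt hI.1 hsing g W (h ⁻¹' M) (hp.2 W hWo hpW)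
      (hno M hM hTD)
    have hqpos : 0 < Metric.infDist (h q) M :=
      (hM.isClosed.notMem_iff_infDist_pos hMne).1 hqM
    set r := Metric.infDist (h q) M with hr
    let W' : Set P := W ∩ {p | r / 2 < Metric.infDist (h p) M} ∩ {p | dist (h p) (h q) < ε / 2}
      ∩ Metric.ball q (ε / 2)
    have hW'o : IsOpen W' := ((hWo.inter (isOpen_lt continuous_const
      ((Metric.continuous_infDist_pt M).comp hh))).inter
      (isOpen_lt (hh.dist continuous_const) continuous_const)).inter Metric.isOpen_ball
    have hqW' : q ∈ W' := ⟨⟨⟨hqW, by show r / 2 < r; linarith⟩, by simpa using hε⟩, by simpa using hε⟩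
    obtain ⟨s, hs, hsW⟩ := Metric.isOpen_iff.1 hW'o q hqW'
    have hsub : Metric.ball q (s / 2) ⊆ W' := (Metric.ball_subset_ball (by linarith)).trans hsW
    refine ⟨Metric.ball q (s / 2), ⟨min (r / 2) (min d (1 / ((n : ℝ) + 2))), by positivity⟩,
      Metric.isOpen_ball, hqP _ Metric.isOpen_ball (by simpa using hs), ?_, ?_, ?_, ?_, ?_, ?_, ?_⟩
    · refine (Metric.closure_ball_subset_closedBall).trans
        ((Metric.closedBall_subset_ball (by linarith)).trans (hsW.trans ?_))
      intro p hp
      exact hp.1.1.1.1.1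
    · intro a ha b hb
      have h1 := (hsub ha).2
      have h2 := (hsub hb).2
      rw [Metric.mem_ball] at h1 h2
      have := dist_triangle_right a b q
      linarith
    · intro a ha b hb
      have h1 : dist (h a) (h q) < ε / 2 := (hsub ha).1.2
      have h2 : dist (h b) (h q) < ε / 2 := (hsub hb).1.2
      have := dist_triangle_right (h a) (h b) (h q)
      linarith
    · intro a ha
      have h1 : r / 2 < Metric.infDist (h a) M := (hsub ha).1.1.2
      have h2 : dist (h a) (lam n).2 < d / 4 := (hsub ha).1.1.1.2
      have h3 : Metric.infDist (h a) M ≤ dist (h a) (lam n).2 :=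
        Metric.infDist_le_dist_of_mem ⟨_, hlam n, rfl⟩
      exact ⟨(min_le_left _ _).trans h1.le, by show _ ≤ d / 2; linarith⟩
    · exact (min_le_right _ _).trans (min_le_left _ _)
    · exact (min_le_right _ _).trans (min_le_right _ _)
    · intro a ha
      have h1 : dist (g a) (lam n).1 < d / 4 := (hsub ha).1.1.1.1.2
      show _ ≤ d
      linarith
  choose c d' h1 h2 h3 h4 h5 h6 h7 h8 h9 using one
  let δ : ℕ → {d : ℝ // 0 < d} := fun n => Nat.rec ⟨1, one_pos⟩ (fun n d => d' n d) n
  have hδ : ∀ n, δ (n + 1) = d' n (δ n) := fun n => rfl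
  have hδle : ∀ n, (δ n).1 ≤ 1 / ((n : ℝ) + 1) := by
    intro n
    cases n with
    | zero => show (1 : ℝ) ≤ _; simp
    | succ n =>
      rw [hδ]
      refine (h8 n _).trans (le_of_eq ?_)
      push_cast
      ring
  refine ⟨L, M, fun n => (δ n).1, fun n => c n (δ n), hLI, hL, hM, hMne, hTD, ?_, ?_, ?_⟩
  · intro n
    refine ⟨(δ n).2, ?_, hδle n⟩
    exact h7 _ _
  · intro n
    refine ⟨h1 _ _, h2 _ _, h3 _ _, h4 _ _, h5 _ _, ?_⟩
    exact h6 _ _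
  · intro x hx η hη
    obtain ⟨y, hy⟩ := hLΛ x hx
    obtain ⟨k, hk⟩ := (TopologicalSpace.denseRange_denseSeq Λ).exists_dist_lt ⟨(x, y), hy⟩
      (half_pos hη)
    obtain ⟨j, hj⟩ := exists_nat_one_div_lt (half_pos hη)
    refine ⟨Nat.pair k j, fun p hp => ?_⟩
    have e1 := h9 _ _ p hp
    have e2 := hδle (Nat.pair k j)
    have e3 : 1 / (((Nat.pair k j : ℕ) : ℝ) + 1) ≤ 1 / ((j : ℝ) + 1) := by
      have : (j : ℝ) ≤ (Nat.pair k j : ℕ) := by exact_mod_cast Nat.right_le_pair k j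
      gcongr
    have e4 : dist x (lam (Nat.pair k j)).1 < η / 2 := by
      have : lam (Nat.pair k j) = (ds k).1 := by simp [lam]
      rw [this]
      refine lt_of_le_of_lt ?_ hk
      rw [Subtype.dist_eq, Prod.dist_eq]
      exact le_max_left _ _
    have := dist_triangle_right (g p) x (lam (Nat.pair k j)).1
    linarith

theorem td_scheme {Y : Type*} [MetricSpace Y] (H M : List ℕ → Set Y) (δ : List ℕ → ℕ → ℝ)
    (hM : ∀ s, IsCompact (M s)) (hMne : ∀ s, (M s).Nonempty)
    (hMtd : ∀ s, IsTotallyDisconnected (M s))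
    (hδ : ∀ s n, 0 < δ s n ∧ δ s (n + 1) ≤ δ s n ∧ δ s n ≤ 1 / ((n : ℝ) + 1))
    (hHs : ∀ s, H s ⊆ ⋃ n, H (n :: s))
    (hH : ∀ s n, ∀ y ∈ H (n :: s), δ s (n + 1) ≤ Metric.infDist y (M s) ∧
      Metric.infDist y (M s) ≤ δ s n / 2)
    (hd : ∀ s n, ∀ x ∈ H (n :: s), ∀ y ∈ H (n :: s), dist x y ≤ (1 / 2) ^ s.length) :
    IsTotallyDisconnected (closure (H [])) := by
  have hHc : ∀ s n, ∀ y ∈ closure (H (n :: s)), δ s (n + 1) ≤ Metric.infDist y (M s) ∧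
      Metric.infDist y (M s) ≤ δ s n / 2 := by
    intro s n
    have : IsClosed {y | δ s (n + 1) ≤ Metric.infDist y (M s) ∧
      Metric.infDist y (M s) ≤ δ s n / 2} :=
      (isClosed_le continuous_const (Metric.continuous_infDist_pt _)).inter
        (isClosed_le (Metric.continuous_infDist_pt _) continuous_const)
    exact closure_minimal (fun y hy => hH s n y hy) this
  have hdc : ∀ s n, ∀ x ∈ closure (H (n :: s)), ∀ y ∈ closure (H (n :: s)),
      dist x y ≤ (1 / 2) ^ s.length := by
    intro s n x hx y hy
    have hb : Bornology.IsBounded (H (n :: s)) :=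
      Metric.isBounded_iff.2 ⟨_, fun x hx y hy => hd s n x hx y hy⟩
    refine (Metric.dist_le_diam_of_mem hb.closure hx hy).trans ?_
    rw [Metric.diam_closure]
    exact Metric.diam_le_of_forall_dist_le (by positivity) (hd s n)
  have hδanti : ∀ s, Antitone (δ s) := fun s => antitone_nat_of_succ_le fun n => (hδ s n).2.1
  have hδlt : ∀ s n m, n < m → ∀ y ∈ closure (H (n :: s)), y ∉ closure (H (m :: s)) := by
    intro s n m hnm y hy hy'
    have h1 := (hHc s n y hy).1
    have h2 := (hHc s m y hy').2
    have h3 := hδanti s (show n + 1 ≤ m from hnm)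
    have h4 := (hδ s m).1
    linarith
  have hdisj : ∀ s n m, n ≠ m → ∀ y ∈ closure (H (n :: s)), y ∉ closure (H (m :: s)) := by
    intro s n m hnm y hy hy'
    rcases lt_or_gt_of_ne hnm with h | h
    · exact hδlt s n m h y hy hy'
    · exact hδlt s m n h y hy' hy
  have hdisjM : ∀ s n, ∀ y ∈ closure (H (n :: s)), y ∉ M s := by
    intro s n y hy hyM
    have h1 := (hHc s n y hy).1
    rw [Metric.infDist_zero_of_mem hyM] at h1
    have := (hδ s (n + 1)).1
    linarith
  have key : ∀ s, ∀ N : Set ℕ, ∀ y ∈ closure (⋃ n ∈ N, H (n :: s)), y ∉ M s →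
      ∃ n ∈ N, y ∈ closure (H (n :: s)) := by
    intro s N y hy hyM
    have hpos := ((hM s).isClosed.notMem_iff_infDist_pos (hMne s)).1 hyM
    obtain ⟨k, hk⟩ := exists_nat_one_div_lt hpos
    have hsub : (⋃ n ∈ N, H (n :: s)) ⊆ (⋃ n ∈ N ∩ Iio k, H (n :: s)) ∪
        {y | Metric.infDist y (M s) ≤ 1 / ((k : ℝ) + 1)} := by
      intro z hz
      obtain ⟨n, hn, hzn⟩ := mem_iUnion₂.1 hz
      rcases lt_or_ge n k with h | h
      · exact Or.inl (mem_iUnion₂.2 ⟨n, ⟨hn, h⟩, hzn⟩)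
      · right
        have h1 := (hH s n z hzn).2
        have h2 := hδanti s h
        have h3 := (hδ s k).2.2
        have h4 := (hδ s n).1
        show Metric.infDist z (M s) ≤ _
        linarith
    have hy2 := closure_mono hsub hy
    rw [closure_union, ((finite_Iio k).inter_of_right N).closure_biUnion,
      (isClosed_le (Metric.continuous_infDist_pt _) continuous_const).closure_eq] at hy2
    rcases hy2 with hy2 | hy2
    · obtain ⟨n, hn, hyn⟩ := mem_iUnion₂.1 hy2
      exact ⟨n, hn.1, hyn⟩
    · exact absurd hy2 (not_le.2 hk)
  intro E hE hEc
  by_contra hEs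
  have main : ∀ s, E ⊆ closure (H s) → ∃ n, E ⊆ closure (H (n :: s)) := by
    intro s hEs'
    by_cases hex : ∃ n, (E ∩ closure (H (n :: s))).Nonempty
    · obtain ⟨n, hn⟩ := hex
      refine ⟨n, ?_⟩
      by_contra hnot
      obtain ⟨y, hyE, hyn⟩ := not_subset.1 hnot
      have hcov : E ⊆ closure (H (n :: s)) ∪ (M s ∪ closure (⋃ m ∈ ({n}ᶜ : Set ℕ), H (m :: s))) := by
        intro z hz
        have h1 : z ∈ closure (H (n :: s) ∪ ⋃ m ∈ ({n}ᶜ : Set ℕ), H (m :: s)) := by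
          refine closure_mono ?_ (hEs' hz)
          intro w hw
          obtain ⟨m, hm⟩ := mem_iUnion.1 (hHs s hw)
          by_cases hmn : m = n
          · left; rwa [← hmn]
          · right; exact mem_iUnion₂.2 ⟨m, hmn, hm⟩
        rw [closure_union] at h1
        rcases h1 with h1 | h1
        · exact Or.inl h1
        · exact Or.inr (Or.inr h1)
      obtain ⟨z, hzE, hz1, hz2⟩ := isPreconnected_closed_iff.1 hEc _ _ isClosed_closure
        ((hM s).isClosed.union isClosed_closure) hcov hn
        ⟨y, hyE, (hcov hyE).resolve_left hyn⟩
      have hzM := hdisjM s n z hz1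
      obtain ⟨m, hm, hzm⟩ := key s _ z (hz2.resolve_left hzM) hzM
      exact hdisj s m n hm z hzm hz1
    · exfalso
      apply hEs
      refine hMtd s E ?_ hEc
      intro y hy
      by_contra hyM
      have : y ∈ closure (⋃ n ∈ (univ : Set ℕ), H (n :: s)) := by
        refine closure_mono ?_ (hEs' hy)
        simpa using hHs s
      obtain ⟨n, -, hn⟩ := key s univ y this hyM
      exact hex ⟨n, y, hy, hn⟩
  have all : ∀ k : ℕ, ∃ s : List ℕ, s.length = k ∧ E ⊆ closure (H s) := by
    intro k
    induction k with
    | zero => exact ⟨[], rfl, hE⟩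
    | succ k ih =>
      obtain ⟨s, hs, hsE⟩ := ih
      obtain ⟨n, hn⟩ := main s hsE
      exact ⟨n :: s, by simp [hs], hn⟩
  apply hEs
  intro x hx y hy
  have hk : ∀ k : ℕ, dist x y ≤ (1 / 2) ^ k := by
    intro k
    obtain ⟨s, hs, hsE⟩ := all k
    obtain ⟨n, hn⟩ := main s hsE
    rw [← hs]
    exact hdc s n x (hn hx) y (hn hy)
  have hl : Tendsto (fun k : ℕ => (1 / 2 : ℝ) ^ k) atTop (𝓝 0) :=
    tendsto_pow_atTop_nhds_zero_of_lt_one (by norm_num) (by norm_num)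
  exact dist_le_zero.1 (ge_of_tendsto' hl hk)

theorem exists_res (s : List ℕ) : ∃ b : ℕ → ℕ, PiNat.res b s.length = s := by
  induction s with
  | nil => exact ⟨fun _ => 0, rfl⟩
  | cons n s ih =>
    obtain ⟨b, hb⟩ := ih
    refine ⟨fun i => if i < s.length then b i else n, ?_⟩
    simp only [List.length_cons, PiNat.res_succ, lt_irrefl, if_false]
    congr 1
    rw [← hb]
    simp only [PiNat.res_length]
    rw [PiNat.res_eq_res]
    intro m hm
    simp [hm]

theorem main_aux {X Y P : Type*}
    [MetricSpace X] [CompactSpace X] [Nonempty X] [MeasurableSpace X] [BorelSpace X]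
    [MetricSpace Y] [CompactSpace Y]
    [MetricSpace P] [CompleteSpace P] [SecondCountableTopology P]
    (hYdim : CountableDimensional Y)
    {I : Set (Set X)} (hI : Calibrated I) (hsing : ∀ x : X, {x} ∈ I)
    (g : P → X) (h : P → Y) (hg : Continuous g) (hh : Continuous h)
    (hpos : ¬ SmallSet I (range g)) :
    ∃ C : Set Y, IsCompact C ∧ IsTotallyDisconnected C ∧ ¬ SmallSet I (g '' (h ⁻¹' C)) := by
  by_contra hcon
  push Not at hcon
  have step : ∀ (k : ℕ) (O : {O : Set P // IsOpen O ∧ ¬ SmallSet I (g '' O)}),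
      ∃ (L : Set X) (M : Set Y) (δ : ℕ → ℝ)
        (c : ℕ → {O : Set P // IsOpen O ∧ ¬ SmallSet I (g '' O)}),
      L ∉ I ∧ IsCompact L ∧ IsCompact M ∧ M.Nonempty ∧ IsTotallyDisconnected M ∧
      (∀ n, 0 < δ n ∧ δ (n + 1) ≤ δ n ∧ δ n ≤ 1 / ((n : ℝ) + 1)) ∧
      (∀ n, closure (c n).1 ⊆ O.1 ∧
        (∀ p ∈ (c n).1, ∀ q ∈ (c n).1, dist p q ≤ (1 / 2) ^ k) ∧
        (∀ p ∈ (c n).1, ∀ q ∈ (c n).1, dist (h p) (h q) ≤ (1 / 2) ^ k) ∧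
        (∀ p ∈ (c n).1, δ (n + 1) ≤ Metric.infDist (h p) M ∧ Metric.infDist (h p) M ≤ δ n / 2)) ∧
      (∀ x ∈ L, ∀ η > 0, ∃ n, ∀ p ∈ (c n).1, dist (g p) x < η) := by
    rintro k ⟨O, hO, hOI⟩
    obtain ⟨L, M, δ, c, h1, h2, h3, h4, h5, h6, h7, h8⟩ := step_lemma hYdim hI hsing g h hg hh
      hcon O hO hOI ((1 / 2) ^ k) (by positivity)
    exact ⟨L, M, δ, fun n => ⟨c n, (h7 n).1, (h7 n).2.1⟩, h1, h2, h3, h4, h5, h6,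
      fun n => (h7 n).2.2, h8⟩
  choose L M δ c h1 h2 h3 h4 h5 h6 h7 h8 using step
  let A : List ℕ → {O : Set P // IsOpen O ∧ ¬ SmallSet I (g '' O)} := fun s =>
    List.rec ⟨univ, isOpen_univ, by simpa using hpos⟩ (fun n t a => c t.length a n) s
  have hA : ∀ n s, A (n :: s) = c s.length (A s) n := fun n s => rfl
  let A' : List ℕ → Set P := fun s => (A s).1
  have hne : ∀ s, (A' s).Nonempty := by
    intro s
    rw [nonempty_iff_ne_empty]
    intro he
    apply (A s).2.2
    have he' : (A s).1 = ∅ := he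
    rw [he', image_empty]
    exact ⟨∅, empty_mem_I hI.1 hsing, subset_rfl⟩
  have hanti : CantorScheme.ClosureAntitone A' := by
    intro s n
    exact (h7 s.length (A s) n).1
  have hvan : CantorScheme.VanishingDiam A' := by
    intro x
    rw [← tendsto_add_atTop_iff_nat 1]
    have hb : ∀ n : ℕ, Metric.ediam (A' (PiNat.res x (n + 1))) ≤ ENNReal.ofReal ((1 / 2) ^ n) := by
      intro n
      apply Metric.ediam_le
      intro p hp q hq
      rw [edist_dist]
      apply ENNReal.ofReal_le_ofReal
      have := (h7 (PiNat.res x n).length (A (PiNat.res x n)) (x n)).2.1 p hp q hq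
      rwa [PiNat.res_length] at this
    refine tendsto_of_tendsto_of_tendsto_of_le_of_le tendsto_const_nhds ?_ (fun _ => zero_le) hb
    rw [← ENNReal.ofReal_zero]
    exact ENNReal.tendsto_ofReal
      (tendsto_pow_atTop_nhds_zero_of_lt_one (by norm_num) (by norm_num))
  have huniv := hanti.map_of_vanishingDiam hvan hne
  have hcont := hvan.map_continuous
  let φ : (ℕ → ℕ) → P := fun b => (CantorScheme.inducedMap A').2 ⟨b, huniv ▸ mem_univ b⟩
  have hφ : Continuous φ := hcont.comp (continuous_id.subtype_mk _)
  have hφmem : ∀ b n, φ b ∈ A' (PiNat.res b n) := fun b n =>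
    CantorScheme.map_mem (A := A') ⟨b, huniv ▸ mem_univ b⟩ n
  let H : List ℕ → Set Y := fun s => {y | ∃ b, PiNat.res b s.length = s ∧ h (φ b) = y}
  have hHA : ∀ s, ∀ y ∈ H s, ∃ p ∈ A' s, h p = y := by
    rintro s y ⟨b, hb, rfl⟩
    exact ⟨φ b, by have := hφmem b s.length; rwa [hb] at this, rfl⟩
  have htd : IsTotallyDisconnected (closure (H [])) := by
    refine td_scheme H (fun s => M s.length (A s)) (fun s => δ s.length (A s))
      (fun s => h3 _ _) (fun s => h4 _ _) (fun s => h5 _ _) (fun s => h6 _ _) ?_ ?_ ?_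
    · rintro s y ⟨b, hb, rfl⟩
      exact mem_iUnion.2 ⟨b s.length, b, by simp [hb], rfl⟩
    · intro s n y hy
      obtain ⟨p, hp, rfl⟩ := hHA _ y hy
      exact (h7 s.length (A s) n).2.2.2 p hp
    · intro s n x hx y hy
      obtain ⟨p, hp, rfl⟩ := hHA _ x hx
      obtain ⟨q, hq, rfl⟩ := hHA _ y hy
      exact (h7 s.length (A s) n).2.2.1 p hp q hq
  obtain ⟨J, hJ, hJs⟩ := hcon _ isClosed_closure.isCompact htd
  obtain ⟨S, hS, hSI, hJS⟩ := hI.2.1 J hJ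
  have hcl : ∀ n, IsClosed ((fun b => g (φ b)) ⁻¹' S n) := fun n =>
    (hS n).isClosed.preimage (hg.comp hφ)
  obtain ⟨n, b₀, hb₀⟩ := nonempty_interior_of_iUnion_of_closed hcl (by
    rw [eq_univ_iff_forall]
    intro b
    have : g (φ b) ∈ ⋃ n, S n := hJS (hJs ⟨φ b, subset_closure ⟨b, rfl, rfl⟩, rfl⟩)
    obtain ⟨n, hn⟩ := mem_iUnion.1 this
    exact mem_iUnion.2 ⟨n, hn⟩)
  obtain ⟨_, ⟨b₁, k, rfl⟩, hb₁, hsub⟩ :=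
    (PiNat.isTopologicalBasis_cylinders (fun _ : ℕ => ℕ)).exists_subset_of_mem_open hb₀
      isOpen_interior
  rw [PiNat.cylinder_eq_res] at hsub
  set s := PiNat.res b₁ k with hs
  have hslen : s.length = k := PiNat.res_length _ _
  apply h1 s.length (A s)
  refine hI.1.2.1 _ hSI _ (h2 s.length (A s)).measurableSet ?_
  refine Subset.trans ?_ (subset_iUnion S n)
  intro x hx
  rw [← (hS n).isClosed.closure_eq, Metric.mem_closure_iff]
  intro η hη
  obtain ⟨m, hm⟩ := h8 s.length (A s) x hx η hη
  obtain ⟨b, hb⟩ := exists_res (m :: s)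
  have hbs : PiNat.res b k = s := by
    rw [List.length_cons, PiNat.res_succ, List.cons.injEq, hslen] at hb
    exact hb.2
  have hbA := hφmem b (m :: s).length
  rw [hb] at hbA
  have hbS : b ∈ (fun b => g (φ b)) ⁻¹' S n := interior_subset (hsub hbs)
  refine ⟨g (φ b), hbS, ?_⟩
  rw [dist_comm]
  exact hm _ hbA

/-- Theorem 1.1(ii): with `Y` countable-dimensional, there is a zero-dimensional
(equivalently, totally disconnected) compact `C ⊆ Y` with `f⁻¹(C) ∉ I`. -/
theorem statement1 {X Y : Type*}
    [MetricSpace X] [CompactSpace X] [Nonempty X] [MeasurableSpace X] [BorelSpace X]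
    [MetricSpace Y] [CompactSpace Y] [Nonempty Y] [MeasurableSpace Y] [BorelSpace Y]
    (hX : ∀ x : X, ¬ IsOpen ({x} : Set X))
    (hY : ∀ y : Y, ¬ IsOpen ({y} : Set Y))
    (hYdim : CountableDimensional Y)
    (I : Set (Set X)) (hI : Calibrated I) (hsing : ∀ x : X, {x} ∈ I)
    (B : Set X) (hB : MeasurableSet B) (hBI : B ∉ I)
    (f : X → Y) (hf : Measurable fun x : B => f x.1) :
    ∃ C : Set Y, IsCompact C ∧ IsTotallyDisconnected C ∧ {x ∈ B | f x ∈ C} ∉ I := by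
  by_contra hcon
  push Not at hcon
  have : StandardBorelSpace B := hB.standardBorel
  let F : B → X × Y := fun x => (x.1, f x.1)
  have hF : Measurable F := measurable_subtype_coe.prodMk hf
  have han : AnalyticSet (F '' univ) := MeasurableSet.univ.analyticSet_image hF
  obtain ⟨P, _, hP, φ, hφ, hr⟩ := analyticSet_iff_exists_polishSpace_range.1 han
  letI := TopologicalSpace.upgradeIsCompletelyMetrizable P
  have hmem : ∀ p, (φ p).1 ∈ B ∧ f (φ p).1 = (φ p).2 := by
    intro p
    have : φ p ∈ F '' univ := hr ▸ mem_range_self p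
    obtain ⟨x, -, hx⟩ := this
    rw [← hx]
    exact ⟨x.2, rfl⟩
  obtain ⟨C, hC, hCtd, hCI⟩ := main_aux hYdim hI hsing (fun p => (φ p).1) (fun p => (φ p).2)
    (continuous_fst.comp hφ) (continuous_snd.comp hφ) (by
      rintro ⟨J, hJ, hJs⟩
      apply hBI
      refine hI.1.2.1 J hJ B hB ?_
      intro x hx
      have : F ⟨x, hx⟩ ∈ range φ := hr ▸ mem_image_of_mem F (mem_univ _)
      obtain ⟨p, hp⟩ := this
      have := hJs ⟨p, rfl⟩
      simp only [hp] at this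
      exact this)
  apply hCI
  refine ⟨_, hcon C hC hCtd, ?_⟩
  rintro _ ⟨p, hp, rfl⟩
  refine ⟨(hmem p).1, ?_⟩
  show f (φ p).1 ∈ C
  rw [(hmem p).2]
  exact hp
end

section
/- Let I be a calibrated σ-ideal on a compactum X without isolated points such that I contains all singletons, let B ⊆ X be a Borel set with B ∉ I, and let f : B → Y be a Borel-measurable map into a compactum Y without isolated points. Then for every σ-finite nonatomic Borel measure μ on Y there exists a compact set C ⊆ Y with μ(C) < ∞ such that f⁻¹(C) ∉ I. -/
open MeasureTheory Topology Filter Set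

lemma SI_empty {X : Type*} [TopologicalSpace X] [MeasurableSpace X] {I : Set (Set X)}
    (h : SigmaIdeal I) {A : Set X} (hA : A ∈ I) : ∅ ∈ I :=
  h.2.1 A hA ∅ MeasurableSet.empty (empty_subset _)

lemma SI_iUnion {X : Type*} [TopologicalSpace X] [MeasurableSpace X] {I : Set (Set X)}
    (h : SigmaIdeal I) (h0 : ∅ ∈ I) {ι : Type*} [Countable ι] (A : ι → Set X)
    (hA : ∀ i, A i ∈ I) : (⋃ i, A i) ∈ I := by
  rcases isEmpty_or_nonempty ι with hι | hι
  · simpa using h0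
  · obtain ⟨e, he⟩ := exists_surjective_nat ι
    rw [← he.iUnion_comp]
    exact h.2.2 _ fun n => hA _

lemma small_nhd {Y : Type*} [MetricSpace Y] [MeasurableSpace Y] [BorelSpace Y]
    (ν : Measure Y) [IsFiniteMeasure ν] (y : Y) (hy : ν {y} = 0) {ε : ENNReal} (hε : 0 < ε) :
    ∃ r > 0, ν (Metric.closedBall y r) < ε := by
  obtain ⟨U, hU, hUo, hlt⟩ := Set.exists_isOpen_lt_of_lt (μ := ν) {y} ε (by rwa [hy])
  obtain ⟨r, hr, hrU⟩ := Metric.nhds_basis_closedBall.mem_iff.1 (hUo.mem_nhds (hU rfl))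
  exact ⟨r, hr, (measure_mono hrU).trans_lt hlt⟩

/-- Up to a null set, `Y` is a countable union of compacts of small measure. -/
lemma small_cover {Y : Type*} [MetricSpace Y] [CompactSpace Y] [MeasurableSpace Y] [BorelSpace Y]
    (μ : Measure Y) [SigmaFinite μ] (hμna : ∀ y : Y, μ {y} = 0) {ε : ENNReal} (hε : 0 < ε) :
    ∃ F : ℕ → Set Y, (∀ n, IsCompact (F n) ∧ μ (F n) ≤ ε) ∧ μ (⋃ n, F n)ᶜ = 0 := by
  have h1 : ∀ n : ℕ, ∀ y : Y, ∃ r > 0,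
      (μ.restrict (spanningSets μ n)) (Metric.closedBall y r) < ε := by
    intro n y
    have : IsFiniteMeasure (μ.restrict (spanningSets μ n)) :=
      isFiniteMeasure_restrict.2 (measure_spanningSets_lt_top μ n).ne
    exact small_nhd _ y (le_antisymm ((Measure.restrict_apply_le _ _).trans (hμna y).le) zero_le) hε
  choose r hr0 hr using h1
  have h2 : ∀ n, ∃ s : Set Y, s.Countable ∧ ⋃ y ∈ s, Metric.closedBall y (r n y) = univ :=
    fun n => TopologicalSpace.countable_cover_nhds fun y => Metric.closedBall_mem_nhds y (hr0 n y)
  choose s hs hcov using h2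
  have : ∀ n, Countable (s n) := fun n => (hs n).to_subtype
  let A : (Σ n, s n) → Set Y := fun i =>
    Metric.closedBall i.2.1 (r i.1 i.2.1) ∩ spanningSets μ i.1
  have hAm : ∀ i, MeasurableSet (A i) := fun i =>
    Metric.isClosed_closedBall.measurableSet.inter (measurableSet_spanningSets μ _)
  have hAμ : ∀ i, μ (A i) < ε := fun i => by
    have := hr i.1 i.2.1
    rwa [Measure.restrict_apply Metric.isClosed_closedBall.measurableSet] at this
  have hAfin : ∀ i, μ (A i) < ⊤ := fun i => lt_of_lt_of_le (hAμ i) le_top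
  have hAcov : ⋃ i, A i = univ := by
    refine eq_univ_of_forall fun y => ?_
    have hy := mem_spanningSetsIndex μ y
    have hy2 : y ∈ ⋃ x ∈ s (spanningSetsIndex μ y), Metric.closedBall x (r (spanningSetsIndex μ y) x) := by
      rw [hcov]; trivial
    simp only [mem_iUnion] at hy2 ⊢
    obtain ⟨x, hx, hyx⟩ := hy2
    exact ⟨⟨_, ⟨x, hx⟩⟩, hyx, hy⟩
  have h3 : ∀ i, ∀ j : ℕ, ∃ K ⊆ A i, IsCompact K ∧ μ (A i \ K) < (j + 1 : ENNReal)⁻¹ := by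
    intro i j
    have : IsFiniteMeasure (μ.restrict (A i)) := isFiniteMeasure_restrict.2 (hAfin i).ne
    obtain ⟨K, hK, hKc, hlt⟩ := (hAm i).exists_isCompact_sdiff_lt (μ := μ.restrict (A i))
      (measure_ne_top _ _) (ε := (j + 1 : ENNReal)⁻¹) (by simp)
    refine ⟨K, hK, hKc, ?_⟩
    rwa [Measure.restrict_apply ((hAm i).diff hKc.measurableSet),
      inter_eq_left.2 sdiff_subset] at hlt
  choose K hKA hKc hK using h3
  have key : μ (⋃ i : (Σ n, s n) × ℕ, K i.1 i.2)ᶜ = 0 := by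
    have hsub : (⋃ i : (Σ n, s n) × ℕ, K i.1 i.2)ᶜ ⊆ ⋃ i, (A i \ ⋃ j, K i j) := by
      intro y hy
      have : y ∈ ⋃ i, A i := by rw [hAcov]; trivial
      obtain ⟨i, hi⟩ := mem_iUnion.1 this
      refine mem_iUnion.2 ⟨i, hi, fun h => hy ?_⟩
      obtain ⟨j, hj⟩ := mem_iUnion.1 h
      exact mem_iUnion.2 ⟨(i, j), hj⟩
    refine measure_mono_null hsub (measure_iUnion_null fun i => ?_)
    have hle : ∀ j : ℕ, μ (A i \ ⋃ j, K i j) ≤ (j + 1 : ENNReal)⁻¹ := fun j =>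
      (measure_mono (sdiff_subset_sdiff_right (subset_iUnion _ j))).trans (hK i j).le
    by_contra hne
    obtain ⟨n, hn⟩ := ENNReal.exists_inv_nat_lt hne
    have := (hle n).trans (ENNReal.inv_le_inv.2 (by simp : (n : ENNReal) ≤ n + 1))
    exact absurd (this.trans_lt hn) (lt_irrefl _)
  rcases isEmpty_or_nonempty ((Σ n, s n) × ℕ) with he | he
  · exact ⟨fun _ => ∅, fun n => ⟨isCompact_empty, by simp⟩, by simpa using key⟩
  · obtain ⟨e, he⟩ := exists_surjective_nat ((Σ n, s n) × ℕ)
    refine ⟨fun n => K (e n).1 (e n).2, fun n => ⟨hKc _ _, ?_⟩, ?_⟩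
    · exact (measure_mono (hKA _ _)).trans (hAμ _).le
    · rwa [he.iUnion_comp (fun i : (Σ n, s n) × ℕ => K i.1 i.2)]

lemma key_step {X Y : Type*}
    [MetricSpace X] [CompactSpace X] [MeasurableSpace X] [BorelSpace X]
    [MetricSpace Y] [CompactSpace Y] [MeasurableSpace Y] [BorelSpace Y]
    {I : Set (Set X)} (hI : Calibrated I)
    (μ : Measure Y) [SigmaFinite μ] (hμna : ∀ y : Y, μ {y} = 0) {ε : ENNReal} (hε : 0 < ε)
    (M : Set (X × Y)) (hM : IsCompact M) (hMI : Prod.fst '' M ∉ I) :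
    ∃ L ⊆ M, IsCompact L ∧ Prod.fst '' L ∉ I ∧ μ (Prod.snd '' L) ≤ ε := by
  obtain ⟨F, hF, hF0⟩ := small_cover μ hμna hε
  have hc : ∀ n, IsCompact (M ∩ Prod.snd ⁻¹' (F n)) := fun n =>
    hM.inter_right ((hF n).1.isClosed.preimage continuous_snd)
  by_cases h : ∃ n, Prod.fst '' (M ∩ Prod.snd ⁻¹' (F n)) ∉ I
  · obtain ⟨n, hn⟩ := h
    refine ⟨_, inter_subset_left, hc n, hn, (measure_mono ?_).trans (hF n).2⟩
    rintro _ ⟨z, hz, rfl⟩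
    exact hz.2
  · push Not at h
    obtain ⟨L, hL, hLsub, hLI⟩ := hI.2.2 _ (hM.image continuous_fst) hMI
      (fun n => Prod.fst '' (M ∩ Prod.snd ⁻¹' (F n)))
      (fun n => ⟨(hc n).image continuous_fst, h n⟩)
    have hLe : Prod.fst '' (M ∩ Prod.fst ⁻¹' L) = L := by
      ext x
      constructor
      · rintro ⟨z, hz, rfl⟩; exact hz.2
      · intro hx
        obtain ⟨z, hz, rfl⟩ := (hLsub hx).1
        exact ⟨z, ⟨hz, hx⟩, rfl⟩
    refine ⟨M ∩ Prod.fst ⁻¹' L, inter_subset_left,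
      hM.inter_right (hL.isClosed.preimage continuous_fst), by rwa [hLe], ?_⟩
    have : μ (Prod.snd '' (M ∩ Prod.fst ⁻¹' L)) = 0 := by
      refine measure_mono_null ?_ hF0
      rintro _ ⟨z, hz, rfl⟩ hzF
      obtain ⟨n, hn⟩ := mem_iUnion.1 hzF
      exact (hLsub hz.2).2 (mem_iUnion.2 ⟨n, z, ⟨hz.1, hn⟩, rfl⟩)
    simp [this]

lemma cyl_nhd (z : ℕ → ℕ) (U : Set (ℕ → ℕ)) (hU : U ∈ 𝓝 z) (n : ℕ) :
    ∃ m > n, PiNat.cylinder (E := fun _ => ℕ) z m ⊆ U := by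
  obtain ⟨_, ⟨x, k, rfl⟩, hz, hsub⟩ :=
    (PiNat.isTopologicalBasis_cylinders (fun _ : ℕ => ℕ)).mem_nhds_iff.1 hU
  rw [← PiNat.mem_cylinder_iff_eq.1 hz] at hsub
  exact ⟨max k (n + 1), by omega, (PiNat.cylinder_anti z (le_max_left _ _)).trans hsub⟩

lemma node_step {X Y : Type*}
    [MetricSpace X] [CompactSpace X] [MeasurableSpace X] [BorelSpace X]
    [MetricSpace Y] [CompactSpace Y] [MeasurableSpace Y] [BorelSpace Y]
    {I : Set (Set X)} (hI : Calibrated I) (h0 : ∅ ∈ I)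
    (μ : Measure Y) [SigmaFinite μ] (hμna : ∀ y : Y, μ {y} = 0)
    (ν : Measure Y) [IsFiniteMeasure ν] (hνna : ∀ y : Y, ν {y} = 0)
    (g : (ℕ → ℕ) → X × Y) (hg : Continuous g) (Z : Set (ℕ → ℕ))
    (hZ : ∀ z ∈ Z, ∀ n, ∀ S ∈ I,
      ¬ ((fun w => (g w).1) '' (PiNat.cylinder (E := fun _ => ℕ) z n ∩ Z) ⊆ S))
    (c : Z × ℕ) {ε : ENNReal} (hε : 0 < ε) (δ : ℕ → ENNReal) (hδ : ∀ k, 0 < δ k) :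
    ∃ (L : Set (X × Y)) (ch : ℕ → Z × ℕ), IsCompact L ∧ Prod.fst '' L ∉ I ∧
      μ (Prod.snd '' L) ≤ ε ∧
      (∀ k, c.2 < (ch k).2 ∧ PiNat.cylinder (E := fun _ => ℕ) (ch k).1.1 (ch k).2 ⊆
          PiNat.cylinder (E := fun _ => ℕ) c.1.1 c.2 ∧
        ν (closure ((fun w => (g w).2) ''
          (PiNat.cylinder (E := fun _ => ℕ) (ch k).1.1 (ch k).2))) ≤ δ k ∧
        ∃ e ∈ L, ∀ w ∈ PiNat.cylinder (E := fun _ => ℕ) (ch k).1.1 (ch k).2,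
          dist (g w) e < 1 / ((k : ℝ) + 1)) ∧
      (∀ e ∈ L, ∀ r > 0, ∃ k, ∀ w ∈ PiNat.cylinder (E := fun _ => ℕ) (ch k).1.1 (ch k).2,
          dist (g w) e < r) := by
  obtain ⟨⟨z, hz⟩, n⟩ := c
  set D := PiNat.cylinder (E := fun _ => ℕ) z n ∩ Z with hD
  have hMc : IsCompact (closure (g '' D)) := isClosed_closure.isCompact
  have hMI : Prod.fst '' closure (g '' D) ∉ I := by
    intro h
    refine hZ z hz n _ h ?_
    rintro _ ⟨w, hw, rfl⟩
    exact ⟨g w, subset_closure ⟨w, hw, rfl⟩, rfl⟩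
  obtain ⟨L, hLM, hLc, hLI, hLμ⟩ := key_step hI μ hμna hε _ hMc hMI
  have hLne : L.Nonempty := by
    rw [nonempty_iff_ne_empty]
    rintro rfl
    simp [h0] at hLI
  have : Nonempty L := hLne.to_subtype
  obtain ⟨d, hd⟩ := TopologicalSpace.exists_dense_seq L
  have hex : ∀ k : ℕ, ∃ c' : Z × ℕ, n < c'.2 ∧
      PiNat.cylinder (E := fun _ => ℕ) c'.1.1 c'.2 ⊆ PiNat.cylinder (E := fun _ => ℕ) z n ∧
      ν (closure ((fun w => (g w).2) ''
          (PiNat.cylinder (E := fun _ => ℕ) c'.1.1 c'.2))) ≤ δ k ∧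
      ∀ w ∈ PiNat.cylinder (E := fun _ => ℕ) c'.1.1 c'.2,
          dist (g w) (d (Nat.unpair k).1).1 < 1 / ((k : ℝ) + 1) := by
    intro k
    have hk : (0 : ℝ) < 1 / ((k : ℝ) + 1) := by positivity
    obtain ⟨_, ⟨z', hz', rfl⟩, hdist⟩ :=
      Metric.mem_closure_iff.1 (hLM (d (Nat.unpair k).1).2) _ hk
    obtain ⟨r, hr0, hr⟩ := small_nhd ν (g z').2 (hνna _) (hδ k)
    have hU : (fun w => (g w).2) ⁻¹' Metric.closedBall (g z').2 r ∩
        (PiNat.cylinder (E := fun _ => ℕ) z n ∩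
          g ⁻¹' Metric.ball (d (Nat.unpair k).1).1 (1 / ((k : ℝ) + 1))) ∈ 𝓝 z' := by
      refine inter_mem ?_ (inter_mem ?_ ?_)
      · exact (hg.snd.continuousAt) (Metric.closedBall_mem_nhds _ hr0)
      · exact (PiNat.isOpen_cylinder (fun _ => ℕ) z n).mem_nhds hz'.1
      · refine hg.continuousAt (Metric.isOpen_ball.mem_nhds ?_)
        rw [Metric.mem_ball, dist_comm]
        exact hdist
    obtain ⟨m, hm, hsub⟩ := cyl_nhd z' _ hU n
    refine ⟨(⟨z', hz'.2⟩, m), hm, fun w hw => (hsub hw).2.1, ?_, fun w hw => (hsub hw).2.2⟩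
    refine (measure_mono ?_).trans hr.le
    refine closure_minimal ?_ Metric.isClosed_closedBall
    rintro _ ⟨w, hw, rfl⟩
    exact (hsub hw).1
  choose ch h1 h2 h3 h4 using hex
  refine ⟨L, ch, hLc, hLI, hLμ, fun k => ⟨h1 k, h2 k, h3 k, _, (d _).2, h4 k⟩, ?_⟩
  intro e he r hr
  obtain ⟨i, hi⟩ := hd.exists_dist_lt (⟨e, he⟩ : L) (half_pos hr)
  obtain ⟨j, hj⟩ := exists_nat_one_div_lt (half_pos hr)
  refine ⟨Nat.pair i j, fun w hw => ?_⟩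
  have := h4 _ w hw
  rw [Nat.unpair_pair] at this
  have hle : 1 / (((Nat.pair i j : ℕ) : ℝ) + 1) ≤ 1 / ((j : ℝ) + 1) := by
    apply one_div_le_one_div_of_le (by positivity)
    have : (j : ℝ) ≤ (Nat.pair i j : ℕ) := by exact_mod_cast Nat.right_le_pair i j
    linarith
  have hi' : dist (d i).1 e < r / 2 := by rw [dist_comm]; exact hi
  have := dist_triangle (g w) (d i).1 e
  simp only at *
  linarith

lemma exists_kernel {X Y : Type*}
    [TopologicalSpace X] [MeasurableSpace X]
    {I : Set (Set X)} (hI : SigmaIdeal I) (h0 : ∅ ∈ I)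
    (g : (ℕ → ℕ) → X × Y) (hr : ∀ S ∈ I, ¬ (range (fun w => (g w).1) ⊆ S)) :
    ∃ Z : Set (ℕ → ℕ), Z.Nonempty ∧ ∀ z ∈ Z, ∀ n, ∀ S ∈ I,
      ¬ ((fun w => (g w).1) '' (PiNat.cylinder (E := fun _ => ℕ) z n ∩ Z) ⊆ S) := by
  set W : Set (Set (ℕ → ℕ)) := {U | IsOpen U ∧ ∃ S ∈ I, (fun w => (g w).1) '' U ⊆ S} with hW
  obtain ⟨T, hTc, hTW, hT⟩ := TopologicalSpace.isOpen_sUnion_countable W (fun U hU => hU.1)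
  have hsm : ∃ S ∈ I, (fun w => (g w).1) '' (⋃₀ W) ⊆ S := by
    have : ∀ t : T, ∃ S ∈ I, (fun w => (g w).1) '' t.1 ⊆ S := fun t => (hTW t.2).2
    choose S hS hsub using this
    have := hTc.to_subtype
    refine ⟨⋃ t, S t, SI_iUnion hI h0 S hS, ?_⟩
    rintro _ ⟨w, hw, rfl⟩
    rw [← hT] at hw
    obtain ⟨t, ht, hwt⟩ := hw
    exact mem_iUnion.2 ⟨⟨t, ht⟩, hsub ⟨t, ht⟩ ⟨w, hwt, rfl⟩⟩
  obtain ⟨S0, hS0, hS0sub⟩ := hsm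
  refine ⟨(⋃₀ W)ᶜ, ?_, ?_⟩
  · rw [nonempty_compl]
    intro h
    rw [h, image_univ] at hS0sub
    exact hr S0 hS0 hS0sub
  · intro z hz n S hS hsub
    refine hz ⟨PiNat.cylinder (E := fun _ => ℕ) z n,
      ⟨PiNat.isOpen_cylinder (fun _ => ℕ) z n, S ∪ S0, ?_, ?_⟩, PiNat.self_mem_cylinder z n⟩
    · rw [union_eq_iUnion]
      exact SI_iUnion hI h0 _ (by rintro (_|_) <;> assumption)
    · rintro _ ⟨w, hw, rfl⟩
      by_cases hwW : w ∈ ⋃₀ W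
      · exact Or.inr (hS0sub ⟨w, hwW, rfl⟩)
      · exact Or.inl (hsub ⟨w, ⟨hw, hwW⟩, rfl⟩)

/-- Theorem 1.1(iii): for every σ-finite nonatomic Borel measure `μ` on `Y` there is a
compact `C ⊆ Y` with `μ(C) < ∞` and `f⁻¹(C) ∉ I`. -/
theorem statement2 {X Y : Type*}
    [MetricSpace X] [CompactSpace X] [Nonempty X] [MeasurableSpace X] [BorelSpace X]
    [MetricSpace Y] [CompactSpace Y] [Nonempty Y] [MeasurableSpace Y] [BorelSpace Y]
    (hX : ∀ x : X, ¬ IsOpen ({x} : Set X))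
    (hY : ∀ y : Y, ¬ IsOpen ({y} : Set Y))
    (I : Set (Set X)) (hI : Calibrated I) (hsing : ∀ x : X, {x} ∈ I)
    (B : Set X) (hB : MeasurableSet B) (hBI : B ∉ I)
    (f : X → Y) (hf : Measurable fun x : B => f x.1)
    (μ : Measure Y) [SigmaFinite μ] (hμna : ∀ y : Y, μ {y} = 0) :
    ∃ C : Set Y, IsCompact C ∧ μ C < ⊤ ∧ {x ∈ B | f x ∈ C} ∉ I := by
  have h0 : ∅ ∈ I := SI_empty hI.1 (hsing (Classical.arbitrary X))
  -- parametrize the graph of `f`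
  obtain ⟨g, hg, hgr⟩ : ∃ g : (ℕ → ℕ) → X × Y, Continuous g ∧
      range g = range (fun x : B => (x.1, f x.1)) := by
    have : StandardBorelSpace B := hB.standardBorel
    have han : AnalyticSet ((fun x : B => (x.1, f x.1)) '' univ) :=
      MeasurableSet.univ.analyticSet_image (measurable_subtype_coe.prodMk hf)
    rw [AnalyticSet, image_univ] at han
    rcases han with h | h
    · exfalso
      rw [range_eq_empty_iff] at h
      exact hBI (by rwa [isEmpty_coe_sort.1 h])
    · exact h
  have hgB : ∀ w, (g w).1 ∈ B ∧ f (g w).1 = (g w).2 := by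
    intro w
    have : g w ∈ range (fun x : B => (x.1, f x.1)) := hgr ▸ mem_range_self w
    obtain ⟨x, hx⟩ := this
    rw [← hx]
    exact ⟨x.2, rfl⟩
  obtain ⟨Z, ⟨z0, hz0⟩, hZ⟩ := exists_kernel hI.1 h0 g (by
    intro S hS hsub
    refine hBI (hI.1.2.1 S hS B hB fun x hx => hsub ?_)
    have : (x, f x) ∈ range g := hgr ▸ ⟨⟨x, hx⟩, rfl⟩
    obtain ⟨w, hw⟩ := this
    exact ⟨w, by simp [hw]⟩)
  have hνna : ∀ y, μ.toFinite {y} = 0 := fun y => toFinite_absolutelyContinuous μ (hμna y)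
  obtain ⟨wt, hwt, hsum⟩ := ENNReal.exists_pos_sum_of_countable' (one_ne_zero (α := ENNReal)) (List ℕ)
  choose! L ch hLc hLI hLμ hch hacc using fun (c : Z × ℕ) (s : List ℕ) =>
    node_step hI h0 μ hμna μ.toFinite hνna g hg Z hZ c (hwt s) (fun k => wt (k :: s))
      (fun k => hwt _)
  let node : List ℕ → Z × ℕ := fun s =>
    List.rec (motive := fun _ => Z × ℕ) (⟨z0, hz0⟩, 0) (fun k s c => ch c s k) s
  have node_cons : ∀ k s, node (k :: s) = ch (node s) s k := fun k s => rfl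
  let cyl : List ℕ → Set (ℕ → ℕ) := fun s =>
    PiNat.cylinder (E := fun _ => ℕ) (node s).1.1 (node s).2
  let P : List ℕ → Set Y := fun s => Prod.snd '' L (node s) s
  have hPc : ∀ s, IsCompact (P s) := fun s => (hLc _ _).image continuous_snd
  have hsub : ∀ k s, cyl (k :: s) ⊆ cyl s := fun k s => (hch (node s) s k).2.1
  let E : List ℕ → Set Y := fun s => {y | ∃ σ : ℕ → List ℕ, σ 0 = s ∧
    (∀ i, ∃ k, σ (i + 1) = k :: σ i) ∧ ∃ w, (g w).2 = y ∧ ∀ i, w ∈ cyl (σ i)}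
  have hE1 : ∀ s, E s ⊆ ⋃ k, E (k :: s) := by
    rintro s y ⟨σ, hσ0, hσ, w, hw, hwc⟩
    obtain ⟨k, hk⟩ := hσ 0
    exact mem_iUnion.2 ⟨k, fun i => σ (i + 1), by simp only; rw [hk, hσ0],
      fun i => hσ (i + 1), w, hw, fun i => hwc _⟩
  have hE2 : ∀ s, E s ⊆ (fun w => (g w).2) '' cyl s := by
    rintro s y ⟨σ, hσ0, hσ, w, hw, hwc⟩
    exact ⟨w, hσ0 ▸ hwc 0, hw⟩
  have hE3 : ∀ s, closure (E s) ⊆ P s ∪ ⋃ k, closure (E (k :: s)) := by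
    intro s y hy
    by_contra hcon
    rw [mem_union, not_or] at hcon
    obtain ⟨hyP, hyE⟩ := hcon
    obtain ⟨r, hr0, hr⟩ := Metric.nhds_basis_ball.mem_iff.1
      ((hPc s).isClosed.isOpen_compl.mem_nhds hyP)
    obtain ⟨K, hK⟩ := exists_nat_one_div_lt (half_pos hr0)
    have hcl : IsClosed (⋃ k ∈ Finset.range K, closure (E (k :: s))) :=
      isClosed_biUnion_finset fun k _ => isClosed_closure
    have hyK : y ∉ ⋃ k ∈ Finset.range K, closure (E (k :: s)) := by
      intro h
      simp only [mem_iUnion] at h hyE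
      obtain ⟨k, -, hk⟩ := h
      exact hyE ⟨k, hk⟩
    obtain ⟨y', ⟨hy'1, hy'2⟩, hy'E⟩ := mem_closure_iff_nhds.1 hy _
      (inter_mem (Metric.ball_mem_nhds y (half_pos hr0)) (hcl.isOpen_compl.mem_nhds hyK))
    obtain ⟨k, hk⟩ := mem_iUnion.1 (hE1 s hy'E)
    by_cases hkK : k < K
    · exact hy'2 (mem_iUnion₂.2 ⟨k, Finset.mem_range.2 hkK, subset_closure hk⟩)
    · obtain ⟨w, hw, rfl⟩ := hE2 _ hk
      obtain ⟨e, he, hew⟩ := (hch (node s) s k).2.2.2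
      have h1 := hew w hw
      have h2 : dist (g w).2 e.2 ≤ dist (g w) e := le_max_right _ _
      have h3 : 1 / ((k : ℝ) + 1) ≤ 1 / ((K : ℝ) + 1) := by
        apply one_div_le_one_div_of_le (by positivity)
        have : (K : ℝ) ≤ k := by exact_mod_cast not_lt.1 hkK
        linarith
      have h4 : dist (g w).2 y < r / 2 := hy'1
      refine hr (?_ : e.2 ∈ Metric.ball y r) ⟨e, he, rfl⟩
      rw [Metric.mem_ball]
      have := dist_triangle_left e.2 y (g w).2
      linarith
  refine ⟨closure (E []), isClosed_closure.isCompact, ?_, ?_⟩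
  · -- measure
    have hnull : μ.toFinite (limsup (fun s => closure (E s)) cofinite) = 0 := by
      refine measure_limsup_cofinite_eq_zero ?_
      refine ne_of_lt (lt_of_le_of_lt (?_ :
        _ ≤ ∑' s : List ℕ, (wt s + if s = [] then μ.toFinite univ else 0)) ?_)
      · refine ENNReal.tsum_le_tsum fun s => ?_
        cases s with
        | nil => simpa using le_add_left (measure_mono (subset_univ _))
        | cons k s =>
          refine le_add_right ?_
          exact (measure_mono (closure_mono (hE2 _))).trans (hch (node s) s k).2.2.1
      · rw [ENNReal.tsum_add, tsum_ite_eq]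
        exact ENNReal.add_lt_top.2 ⟨hsum.trans ENNReal.one_lt_top, measure_lt_top _ _⟩
    have hcov : closure (E []) ⊆ (⋃ s, P s) ∪ limsup (fun s => closure (E s)) cofinite := by
      intro y hy
      by_cases hyP : y ∈ ⋃ s, P s
      · exact Or.inl hyP
      right
      have hlen : ∀ n : ℕ, ∃ s : List ℕ, s.length = n ∧ y ∈ closure (E s) := by
        intro n
        induction n with
        | zero => exact ⟨[], rfl, hy⟩
        | succ n ih =>
          obtain ⟨s, hs, hys⟩ := ih
          rcases hE3 s hys with h | h
          · exact absurd (mem_iUnion.2 ⟨s, h⟩) hyP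
          · obtain ⟨k, hk⟩ := mem_iUnion.1 h
            exact ⟨k :: s, by simp [hs], hk⟩
      rw [mem_limsup_iff_frequently_mem, frequently_cofinite_iff_infinite]
      intro hfin
      obtain ⟨N, hN⟩ := (hfin.image List.length).bddAbove
      obtain ⟨s, hs, hys⟩ := hlen (N + 1)
      have := hN ⟨s, hys, rfl⟩
      omega
    refine (measure_mono hcov).trans_lt ((measure_union_le _ _).trans_lt ?_)
    rw [absolutelyContinuous_toFinite μ hnull, add_zero]
    refine (measure_iUnion_le _).trans_lt ?_
    exact (ENNReal.tsum_le_tsum fun s => hLμ (node s) s).trans_lt (hsum.trans ENNReal.one_lt_top)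
  · intro hmem
    obtain ⟨S, hSc, hSI, hS⟩ := hI.2.1 _ hmem
    have hSn : ∀ n, S n ∈ I := fun n =>
      hI.1.2.1 _ hSI _ (hSc n).measurableSet (subset_iUnion _ n)
    have hav : ∀ (n : ℕ) (s : List ℕ), ∃ k, ∀ w ∈ cyl (k :: s), (g w).1 ∉ S n := by
      intro n s
      have : ¬ (Prod.fst '' L (node s) s ⊆ S n) := fun h =>
        hLI (node s) s (hI.1.2.1 _ (hSn n) _
          ((hLc _ _).image continuous_fst).measurableSet h)
      obtain ⟨_, ⟨e, he, rfl⟩, heS⟩ := not_subset.1 this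
      obtain ⟨r, hr0, hr⟩ := Metric.nhds_basis_ball.mem_iff.1
        ((hSc n).isClosed.isOpen_compl.mem_nhds heS)
      obtain ⟨k, hk⟩ := hacc (node s) s e he r hr0
      refine ⟨k, fun w hw => hr ?_⟩
      exact lt_of_le_of_lt (le_max_left _ _) (hk w hw)
    choose nx hnx using hav
    let σ : ℕ → List ℕ := fun i => Nat.rec (motive := fun _ => List ℕ) [] (fun n s => nx n s :: s) i
    have hσ : ∀ i, σ (i + 1) = nx i (σ i) :: σ i := fun i => rfl
    have hanti : Antitone fun i => cyl (σ i) :=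
      antitone_nat_of_succ_le fun i => by simp only [hσ]; exact hsub _ _
    have hlt : ∀ i, i ≤ (node (σ i)).2 := by
      intro i
      induction i with
      | zero => exact Nat.zero_le _
      | succ i ih =>
        have : (node (σ i)).2 < (node (σ (i + 1))).2 := (hch (node (σ i)) (σ i) _).1
        omega
    let w : ℕ → ℕ := fun m => (node (σ (m + 1))).1.1 m
    have hwc : ∀ i, w ∈ cyl (σ i) := by
      intro i m hm
      have hself : ∀ j, (node (σ j)).1.1 ∈ cyl (σ j) := fun j => PiNat.self_mem_cylinder _ _
      rcases le_total i (m + 1) with h | h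
      · exact hanti h (hself (m + 1)) m hm
      · exact (hanti h (hself i) m (hlt (m + 1))).symm
    have hwE : (g w).2 ∈ closure (E []) :=
      subset_closure ⟨σ, rfl, fun i => ⟨_, hσ i⟩, w, rfl, hwc⟩
    have hwS := hS ⟨(hgB w).1, by rw [(hgB w).2]; exact hwE⟩
    obtain ⟨n, hn⟩ := mem_iUnion.1 hwS
    exact hnx n (σ n) w (hwc (n + 1)) hn
end

section
/- Let I be a calibrated σ-ideal on a compactum X without isolated points containing all singletons, and let f : B → Y be a Borel-measurable map from a Borel set B ⊆ X into a countable-dimensional compactum Y. Let K_i (i ∈ ℕ) be compact subsets of Y such that H = Y \ ⋃_i K_i is zero-dimensional. Suppose G ⊆ B is a nonempty G_δ subset of X such that every nonempty relatively open subset of G does not belong to I, the restriction f|G is continuous, and f(G) ⊆ H. Then for every nonempty relatively open subset U of G there exist compact sets L ⊆ cl(U) and M ⊆ cl(f(U)) (closures in X and in Y respectively) such that: L is boundary in cl(U) and L ∉ I; M is zero-dimensional; and L ⊆ f̌_U[M]. -/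
open MeasureTheory Topology Filter Set

/-- The compact-valued map `f̌_U`: `x ∈ f̌_U(y)` iff there is a sequence `(xₙ)` in `U`
with `xₙ → x` and `f(xₙ) → y`. -/
def fCheck {X Y : Type*} [TopologicalSpace X] [TopologicalSpace Y]
    (f : X → Y) (U : Set X) (y : Y) : Set X :=
  {x | ∃ u : ℕ → X, (∀ n, u n ∈ U) ∧ Tendsto u atTop (nhds x) ∧
    Tendsto (fun n => f (u n)) atTop (nhds y)}

/-- `f̌_U[M] = ⋃_{y ∈ M} f̌_U(y)`. -/
def fCheckImage {X Y : Type*} [TopologicalSpace X] [TopologicalSpace Y]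
    (f : X → Y) (U : Set X) (M : Set Y) : Set X :=
  ⋃ y ∈ M, fCheck f U y

/-- `L` is boundary in `F`: `L ⊆ F` and `L` has empty interior in the subspace
topology of `F`. -/
def BoundaryIn {X : Type*} [TopologicalSpace X] (L F : Set X) : Prop :=
  L ⊆ F ∧ ∀ W : Set X, IsOpen W → (W ∩ F).Nonempty → ¬ (W ∩ F ⊆ L)

/-- In a second countable space with a clopen basis, disjoint closed sets are separated by a
clopen set. -/
lemma exists_clopen_sep {T : Type*} [TopologicalSpace T] [SecondCountableTopology T]
    (hT : ∀ z : T, ∀ U : Set T, IsOpen U → z ∈ U → ∃ V : Set T, IsClopen V ∧ z ∈ V ∧ V ⊆ U)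
    {A B : Set T} (hA : IsClosed A) (hB : IsClosed B) (hAB : Disjoint A B) :
    ∃ C : Set T, IsClopen C ∧ A ⊆ C ∧ Disjoint C B := by
  classical
  have h1 : ∀ z : T, ∃ V : Set T, IsClopen V ∧ z ∈ V ∧ (Disjoint V A ∨ Disjoint V B) := by
    intro z
    by_cases hz : z ∈ A
    · obtain ⟨V, hV, hzV, hVU⟩ := hT z Bᶜ hB.isOpen_compl (fun h => disjoint_left.1 hAB hz h)
      exact ⟨V, hV, hzV, Or.inr (disjoint_left.2 fun x hx => hVU hx)⟩
    · obtain ⟨V, hV, hzV, hVU⟩ := hT z Aᶜ hA.isOpen_compl hz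
      exact ⟨V, hV, hzV, Or.inl (disjoint_left.2 fun x hx => hVU hx)⟩
  rcases isEmpty_or_nonempty T with hE | hE
  · exact ⟨∅, isClopen_empty, fun x => (hE.false x).elim, by simp⟩
  choose V hV hzV hd using h1
  obtain ⟨S, hSc, hS⟩ := TopologicalSpace.countable_cover_nhds
    (f := V) (fun z => (hV z).isOpen.mem_nhds (hzV z))
  have hSne : S.Nonempty := by
    by_contra h
    rw [not_nonempty_iff_eq_empty] at h
    obtain ⟨x⟩ := hE
    have : x ∈ ⋃ x ∈ S, V x := by rw [hS]; trivial
    simp [h] at this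
  obtain ⟨e, he⟩ := hSc.exists_eq_range hSne
  have hcov : ⋃ n, V (e n) = univ := by
    rw [← hS, he]; simp
  set D : ℕ → Set T := disjointed fun n => V (e n) with hD
  have hDc : ∀ n, IsClopen (D n) := fun n =>
    disjointedRec (p := IsClopen) (fun t i ht => ht.diff (hV _)) (hV (e n))
  have hDsub : ∀ n, D n ⊆ V (e n) := fun n => disjointed_le _ n
  have hDcov : ⋃ n, D n = univ := by rw [hD, iUnion_disjointed, hcov]
  have hDd : Pairwise (Function.onFun Disjoint D) := disjoint_disjointed _
  have hcompl : (⋃ n ∈ {n | ¬ Disjoint (D n) A}, D n)ᶜ = ⋃ n ∈ {n | Disjoint (D n) A}, D n := by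
    ext x
    simp only [mem_compl_iff, mem_iUnion, mem_ofPred_eq, not_exists]
    constructor
    · intro h
      have : x ∈ ⋃ n, D n := by rw [hDcov]; trivial
      obtain ⟨n, hn⟩ := mem_iUnion.1 this
      refine ⟨n, ?_, hn⟩
      by_contra h'
      exact h n h' hn
    · rintro ⟨n, hn, hx⟩ m hm hxm
      have : n = m := by
        by_contra hne
        exact disjoint_left.1 (hDd hne) hx hxm
      exact hm (this ▸ hn)
  refine ⟨⋃ n ∈ {n | ¬ Disjoint (D n) A}, D n, ⟨?_, ?_⟩, ?_, ?_⟩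
  · rw [← isOpen_compl_iff, hcompl]
    exact isOpen_biUnion fun n _ => (hDc n).isOpen
  · exact isOpen_biUnion fun n _ => (hDc n).isOpen
  · intro x hx
    have : x ∈ ⋃ n, D n := by rw [hDcov]; trivial
    obtain ⟨n, hn⟩ := mem_iUnion.1 this
    exact mem_biUnion (show n ∈ {n | ¬ Disjoint (D n) A} from
      fun h => disjoint_left.1 h hn hx) hn
  · rw [disjoint_left]
    intro x hx hxB
    simp only [mem_iUnion, mem_ofPred_eq] at hx
    obtain ⟨n, hn, hxn⟩ := hx
    rcases hd (e n) with h | h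
    · exact hn (h.mono_left (hDsub n))
    · exact disjoint_left.1 h (hDsub n hxn) hxB

/-- Small neighbourhoods whose frontier misses a given zero-dimensional set. -/
lemma exists_nhd_frontier_disjoint {Y : Type*} [MetricSpace Y] [CompactSpace Y]
    {Z : Set Y} (hZ : ZeroDimSubset Z) (p : Y) (O : Set Y) (hO : IsOpen O) (hp : p ∈ O) :
    ∃ V : Set Y, IsOpen V ∧ p ∈ V ∧ V ⊆ O ∧ Disjoint (frontier V) Z := by
  obtain ⟨r, hr, hrO⟩ := Metric.isOpen_iff.1 hO p hp
  have hA : IsClosed {y : Y | dist y p ≤ r / 3} := isClosed_le (by fun_prop) (by fun_prop)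
  have hB : IsClosed {y : Y | 2 * r / 3 ≤ dist y p} := isClosed_le (by fun_prop) (by fun_prop)
  have hA' : IsClosed {y : Y | dist y p ≤ 2 * r / 3} := isClosed_le (by fun_prop) (by fun_prop)
  have hB' : IsClosed {y : Y | r / 3 ≤ dist y p} := isClosed_le (by fun_prop) (by fun_prop)
  have hF : IsClosed {y : Y | r ≤ dist y p} := isClosed_le (by fun_prop) (by fun_prop)
  obtain ⟨C, hC, hAC, hCB⟩ := exists_clopen_sep (T := Z) hZ
    (hA.preimage continuous_subtype_val) (hB.preimage continuous_subtype_val)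
    (disjoint_left.2 fun x hx hx' => by
      simp only [mem_preimage, mem_ofPred_eq] at hx hx'
      linarith)
  obtain ⟨P, hP, hPC⟩ := isOpen_induced_iff.1 hC.isOpen
  obtain ⟨Q, hQ, hQC⟩ := isOpen_induced_iff.1 hC.compl.isOpen
  have hCP : ∀ z : Z, z ∈ C ↔ (z : Y) ∈ P := fun z => by rw [← hPC]; rfl
  have hCQ : ∀ z : Z, z ∉ C ↔ (z : Y) ∈ Q := fun z => by
    rw [← mem_compl_iff, ← hQC]; rfl
  have hcl1 : closure (Subtype.val '' C) ⊆ Qᶜ := by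
    refine closure_minimal ?_ hQ.isClosed_compl
    rintro _ ⟨z, hz, rfl⟩ h
    exact (hCQ z).2 h hz
  have hcl2 : closure (Subtype.val '' Cᶜ) ⊆ Pᶜ := by
    refine closure_minimal ?_ hP.isClosed_compl
    rintro _ ⟨z, hz, rfl⟩ h
    exact hz ((hCP z).2 h)
  have hcl3 : closure (Subtype.val '' C) ⊆ {y : Y | dist y p ≤ 2 * r / 3} := by
    refine closure_minimal ?_ hA'
    rintro _ ⟨z, hz, rfl⟩
    have := disjoint_left.1 hCB hz
    simp only [mem_preimage, mem_ofPred_eq, not_le] at this ⊢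
    exact this.le
  have hcl4 : closure (Subtype.val '' Cᶜ) ⊆ {y : Y | r / 3 ≤ dist y p} := by
    refine closure_minimal ?_ hB'
    rintro _ ⟨z, hz, rfl⟩
    have : ¬ dist (z : Y) p ≤ r / 3 := fun h => hz (hAC h)
    simp only [mem_ofPred_eq]
    linarith
  have key : Disjoint (𝓝ˢ (Subtype.val '' C ∪ {p}))
      (𝓝ˢ (Subtype.val '' Cᶜ ∪ {y : Y | r ≤ dist y p})) := by
    apply CompletelyNormalSpace.completely_normal
    · rw [closure_union, closure_singleton, disjoint_left]
      rintro x (hx | hx) (hx' | hx')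
      · obtain ⟨z, hz, rfl⟩ := hx'
        exact hcl1 hx ((hCQ z).1 hz)
      · have := hcl3 hx
        simp only [mem_ofPred_eq] at this hx'
        linarith
      · rw [mem_singleton_iff] at hx
        subst hx
        have := hcl4 (subset_closure hx')
        simp only [mem_ofPred_eq, dist_self] at this
        linarith
      · rw [mem_singleton_iff] at hx
        subst hx
        simp only [mem_ofPred_eq, dist_self] at hx'
        linarith
    · rw [closure_union, hF.closure_eq, disjoint_left]
      rintro x (hx | hx) (hx' | hx')
      · obtain ⟨z, hz, rfl⟩ := hx
        exact hcl2 hx' ((hCP z).1 hz)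
      · have := hcl3 (subset_closure hx)
        simp only [mem_ofPred_eq] at this hx'
        linarith
      · rw [mem_singleton_iff] at hx
        subst hx
        have := hcl4 hx'
        simp only [mem_ofPred_eq, dist_self] at this
        linarith
      · rw [mem_singleton_iff] at hx
        subst hx
        simp only [mem_ofPred_eq, dist_self] at hx'
        linarith
  obtain ⟨V, W, hV, hW, hsV, htW, hVW⟩ := separatedNhds_iff_disjoint.2 key
  refine ⟨V, hV, hsV (Or.inr rfl), ?_, ?_⟩
  · intro y hy
    by_contra h
    refine disjoint_left.1 hVW hy (htW (Or.inr ?_))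
    by_contra h'
    exact h (hrO (Metric.mem_ball.2 (not_le.1 h')))
  · rw [disjoint_left]
    intro y hy hyZ
    rw [hV.frontier_eq] at hy
    by_cases hyC : (⟨y, hyZ⟩ : Z) ∈ C
    · exact hy.2 (hsV (Or.inl ⟨_, hyC, rfl⟩))
    · exact disjoint_left.1 (hVW.closure_left hW) hy.1 (htW (Or.inl ⟨_, hyC, rfl⟩))

/-- A countable base whose frontiers miss a given zero-dimensional set. -/
lemma exists_base_frontier_disjoint {Y : Type*} [MetricSpace Y] [CompactSpace Y] [Nonempty Y]
    {Z : Set Y} (hZ : ZeroDimSubset Z) :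
    ∃ V : ℕ → Set Y, TopologicalSpace.IsTopologicalBasis (range V) ∧
      ∀ n, Disjoint (frontier (V n)) Z := by
  have hb : TopologicalSpace.IsTopologicalBasis
      {V : Set Y | IsOpen V ∧ Disjoint (frontier V) Z} := by
    refine TopologicalSpace.isTopologicalBasis_of_isOpen_of_nhds (fun V hV => hV.1) ?_
    intro p O hp hO
    obtain ⟨V, h1, h2, h3, h4⟩ := exists_nhd_frontier_disjoint hZ p O hO hp
    exact ⟨V, ⟨h1, h4⟩, h2, h3⟩
  obtain ⟨s, hs, hsc, hsb⟩ := hb.exists_countable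
  have hne : s.Nonempty := by
    obtain ⟨y⟩ := ‹Nonempty Y›
    obtain ⟨v, hv, -⟩ := hsb.exists_subset_of_mem_open (mem_univ y) isOpen_univ
    exact ⟨v, hv⟩
  obtain ⟨V, rfl⟩ := hsc.exists_eq_range hne
  exact ⟨V, hsb, fun n => (hs (mem_range_self n)).2⟩

lemma mem_fCheck_iff {X Y : Type*} [MetricSpace X] [MetricSpace Y] (f : X → Y) (U : Set X)
    (x : X) (y : Y) :
    x ∈ fCheck f U y ↔ (x, y) ∈ closure ((fun x => (x, f x)) '' U) := by
  rw [mem_closure_iff_seq_limit]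
  constructor
  · rintro ⟨u, hu, h1, h2⟩
    exact ⟨fun n => (u n, f (u n)), fun n => ⟨u n, hu n, rfl⟩, h1.prodMk_nhds h2⟩
  · rintro ⟨v, hv, hlim⟩
    choose u hu huv using hv
    have h1 : Tendsto (fun n => (v n).1) atTop (𝓝 x) := (continuous_fst.tendsto _).comp hlim
    have h2 : Tendsto (fun n => (v n).2) atTop (𝓝 y) := (continuous_snd.tendsto _).comp hlim
    refine ⟨u, hu, ?_, ?_⟩
    · simpa only [← huv] using h1
    · simpa only [← huv] using h2

lemma fCheckImage_eq {X Y : Type*} [MetricSpace X] [MetricSpace Y] (f : X → Y) (U : Set X)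
    (M : Set Y) :
    fCheckImage f U M =
      Prod.fst '' (closure ((fun x => (x, f x)) '' U) ∩ Prod.snd ⁻¹' M) := by
  ext x
  simp only [fCheckImage, mem_iUnion, mem_fCheck_iff, mem_image, mem_inter_iff, mem_preimage]
  constructor
  · rintro ⟨y, hy, h⟩
    exact ⟨(x, y), ⟨h, hy⟩, rfl⟩
  · rintro ⟨⟨x', y⟩, ⟨h, hy⟩, rfl⟩
    exact ⟨y, hy, h⟩

lemma isCompact_fCheckImage {X Y : Type*} [MetricSpace X] [CompactSpace X] [MetricSpace Y]
    [CompactSpace Y] (f : X → Y) (U : Set X) {M : Set Y} (hM : IsCompact M) :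
    IsCompact (fCheckImage f U M) := by
  rw [fCheckImage_eq]
  exact ((isClosed_closure.inter (hM.isClosed.preimage continuous_snd)).isCompact).image
    continuous_fst

/-- Claim 4.1 (the key claim in the proof of Theorem 1.1(ii)). -/
theorem statement5 {X Y : Type*}
    [MetricSpace X] [CompactSpace X] [Nonempty X] [MeasurableSpace X] [BorelSpace X]
    [MetricSpace Y] [CompactSpace Y] [Nonempty Y] [MeasurableSpace Y] [BorelSpace Y]
    (hX : ∀ x : X, ¬ IsOpen ({x} : Set X))
    (hYdim : CountableDimensional Y)
    (I : Set (Set X)) (hI : Calibrated I) (hsing : ∀ x : X, {x} ∈ I)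
    (B : Set X) (hB : MeasurableSet B)
    (f : X → Y) (hf : Measurable fun x : B => f x.1)
    -- the compacta Kᵢ and the zero-dimensional set H:
    (K : ℕ → Set Y) (hK : ∀ i, IsCompact (K i))
    (H : Set Y) (hH : H = Set.univ \ ⋃ i, K i) (hHdim : ZeroDimSubset H)
    -- the set G:
    (G : Set X) (hGB : G ⊆ B) (hGδ : IsGδ G) (hGne : G.Nonempty)
    (hGI : ∀ W : Set X, IsOpen W → (W ∩ G).Nonempty → W ∩ G ∉ I)
    (hfG : ContinuousOn f G) (hfGH : f '' G ⊆ H) :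
    ∀ U : Set X, U.Nonempty → (∃ W : Set X, IsOpen W ∧ U = W ∩ G) →
      ∃ L : Set X, ∃ M : Set Y,
        IsCompact L ∧ L ⊆ closure U ∧ IsCompact M ∧ M ⊆ closure (f '' U) ∧
        BoundaryIn L (closure U) ∧ L ∉ I ∧
        ZeroDimSubset M ∧
        L ⊆ fCheckImage f U M := by
  rintro U hUne ⟨W, hW, hUW⟩
  obtain ⟨⟨hmeas, hsub, hunion⟩, -, hcal⟩ := hI
  have hempty : (∅ : Set X) ∈ I := by
    obtain ⟨x⟩ := ‹Nonempty X›
    exact hsub _ (hsing x) ∅ MeasurableSet.empty (empty_subset _)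
  have hUmeas : MeasurableSet U := by
    rw [hUW]
    exact hW.measurableSet.inter hGδ.measurableSet
  have hUI : U ∉ I := by
    rw [hUW] at hUne ⊢
    exact hGI W hW hUne
  -- the whole space has large image
  have hbig : fCheckImage f U univ ∉ I := by
    intro h
    refine hUI (hsub _ h U hUmeas ?_)
    intro x hx
    exact mem_biUnion (mem_univ (f x))
      ⟨fun _ => x, fun _ => hx, tendsto_const_nhds, tendsto_const_nhds⟩
  by_contra hcon
  -- the main step
  have step : ∀ C : Set Y, IsCompact C → fCheckImage f U C ∉ I → ∀ V : ℕ → Set Y,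
      TopologicalSpace.IsTopologicalBasis (range V) →
      ∃ n, fCheckImage f U (C ∩ frontier (V n)) ∉ I := by
    intro C hC hCI V hV
    by_contra! hall
    obtain ⟨D, hDU, hDc, hUD⟩ :=
      (TopologicalSpace.IsSeparable.of_separableSpace U).exists_countable_dense_subset
    have hDne : D.Nonempty := by
      rw [nonempty_iff_ne_empty]
      rintro rfl
      rw [closure_empty] at hUD
      exact hUne.ne_empty (subset_empty_iff.1 hUD)
    obtain ⟨d, rfl⟩ := hDc.exists_eq_range hDne
    obtain ⟨L, hL, hLsub, hLI⟩ := hcal _ (isCompact_fCheckImage f U hC) hCI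
      (fun n => fCheckImage f U (C ∩ frontier (V n)) ∪ {d n}) (by
        intro n
        refine ⟨(isCompact_fCheckImage f U (hC.inter_right isClosed_frontier)).union
          isCompact_singleton, ?_⟩
        have := hunion (fun k => if k = 0 then fCheckImage f U (C ∩ frontier (V n)) else {d n})
          (fun k => by
            by_cases hk : k = 0
            · simpa [hk] using hall n
            · simpa [hk] using hsing _)
        refine hsub _ this _ ?_ ?_
        · exact (hmeas _ (hall n)).union (hmeas _ (hsing _))
        · rintro x (hx | hx)
          · exact mem_iUnion.2 ⟨0, by simpa using hx⟩
          · exact mem_iUnion.2 ⟨1, by simpa using hx⟩)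
    have hLcl : L ⊆ closure U := by
      intro x hx
      obtain ⟨y, -, hy⟩ := mem_iUnion₂.1 (hLsub hx).1
      obtain ⟨u, hu, hux, -⟩ := hy
      exact mem_closure_of_tendsto hux (Eventually.of_forall hu)
    set Γ : Set (X × Y) := closure ((fun x => (x, f x)) '' U) with hΓ
    set M : Set Y := Prod.snd '' (Γ ∩ L ×ˢ C) with hM
    have hMC : IsCompact M :=
      ((hL.prod hC).inter_left isClosed_closure).image continuous_snd
    have hMdisj : ∀ n, ∀ y ∈ M, y ∉ frontier (V n) := by
      rintro n _ ⟨⟨x, y⟩, ⟨hxy, hx, hy⟩, rfl⟩ hfr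
      refine (hLsub hx).2 (mem_iUnion.2 ⟨n, Or.inl ?_⟩)
      exact mem_biUnion (show y ∈ C ∩ frontier (V n) from ⟨hy, hfr⟩)
        ((mem_fCheck_iff f U x y).2 hxy)
    refine hcon ⟨L, M, hL, hLcl, hMC, ?_, ⟨hLcl, ?_⟩, hLI, ?_, ?_⟩
    · rintro _ ⟨⟨x, y⟩, ⟨hxy, hx, hy⟩, rfl⟩
      obtain ⟨u, hu, -, huy⟩ := (mem_fCheck_iff f U x y).2 hxy
      exact mem_closure_of_tendsto huy (Eventually.of_forall fun n => mem_image_of_mem f (hu n))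
    · rintro O hO ⟨x, hxO, hxU⟩ hOL
      have hx' : x ∈ closure (range d) := closure_minimal hUD isClosed_closure hxU
      obtain ⟨_, hyO, n, rfl⟩ := mem_closure_iff.1 hx' O hO hxO
      exact (hLsub (hOL ⟨hyO, subset_closure (hDU (mem_range_self n))⟩)).2
        (mem_iUnion.2 ⟨n, Or.inr rfl⟩)
    · rintro z S hS hz
      obtain ⟨O, hO, rfl⟩ := isOpen_induced_iff.1 hS
      obtain ⟨_, ⟨n, rfl⟩, hzn, hnO⟩ := hV.exists_subset_of_mem_open hz hO
      have hVo : IsOpen (V n) := hV.isOpen (mem_range_self n)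
      refine ⟨Subtype.val ⁻¹' (V n), ⟨?_, hVo.preimage continuous_subtype_val⟩, hzn,
        preimage_mono hnO⟩
      have : (Subtype.val ⁻¹' (V n) : Set M) = Subtype.val ⁻¹' (closure (V n)) := by
        ext w
        refine ⟨fun h => subset_closure h, fun h => ?_⟩
        by_contra h'
        exact hMdisj n w w.2 (by rw [hVo.frontier_eq]; exact ⟨h, h'⟩)
      rw [this]
      exact isClosed_closure.preimage continuous_subtype_val
    · intro x hx
      obtain ⟨y, hyC, hy⟩ := mem_iUnion₂.1 (hLsub hx).1
      exact mem_biUnion (show y ∈ M from ⟨(x, y), ⟨(mem_fCheck_iff f U x y).1 hy, hx, hyC⟩, rfl⟩) hy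
  -- iterate through the zero-dimensional pieces
  obtain ⟨Z, hZ, hZcov⟩ := hYdim
  choose V hVb hVd using fun n => exists_base_frontier_disjoint (hZ n)
  have step' : ∀ (n : ℕ) (C : {C : Set Y // IsCompact C ∧ fCheckImage f U C ∉ I}),
      ∃ C' : {C : Set Y // IsCompact C ∧ fCheckImage f U C ∉ I},
        C'.1 ⊆ C.1 ∧ Disjoint C'.1 (Z n) := by
    rintro n ⟨C, hC, hCI⟩
    obtain ⟨k, hk⟩ := step C hC hCI (V n) (hVb n)
    exact ⟨⟨C ∩ frontier (V n k), hC.inter_right isClosed_frontier, hk⟩, inter_subset_left,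
      (hVd n k).mono_left inter_subset_right⟩
  choose g hg1 hg2 using step'
  let c : ℕ → {C : Set Y // IsCompact C ∧ fCheckImage f U C ∉ I} :=
    fun n => Nat.rec ⟨univ, isCompact_univ, hbig⟩ (fun n C => g n C) n
  have hc : ∀ n, c (n + 1) = g n (c n) := fun n => rfl
  obtain ⟨y, hy⟩ := IsCompact.nonempty_iInter_of_sequence_nonempty_isCompact_isClosed
    (fun n => (c n).1) (fun n => by rw [hc]; exact hg1 n (c n))
    (fun n => by
      rw [nonempty_iff_ne_empty]
      intro h
      apply (c n).2.2
      have h' : (c n).1 = ∅ := h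
      rw [h']
      simpa [fCheckImage] using hempty)
    (c 0).2.1 (fun n => (c n).2.1.isClosed)
  have : y ∈ ⋃ n, Z n := by rw [hZcov]; trivial
  obtain ⟨n, hn⟩ := mem_iUnion.1 this
  have h1 := mem_iInter.1 hy (n + 1)
  rw [hc] at h1
  exact disjoint_left.1 (hg2 n (c n)) h1 hn
end

section
/- Let μ be a semifinite nonatomic Borel measure on a compactum X with μ(X) > 0. Assume moreover that μ is not σ-finite, that there exists a Borel set Y ⊆ X with Y ∉ J_f(μ) and μ(Y) < ∞, and that the map K ↦ μ(K) is Borel-measurable on the hyperspace of nonempty compact subsets of X equipped with the Hausdorff metric. Then the σ-ideal J_f(μ) is not homogeneous; that is, there exists a Borel set E ⊆ X with E ∉ J_f(μ) such that for every Borel-measurable map f : X → X with range contained in E there is a set A ∈ J_f(μ) with f⁻¹(A) ∉ J_f(μ). -/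
open MeasureTheory Topology Filter Set ENNReal

/-- `J₀(μ)`: Borel sets coverable by countably many compact sets of `μ`-measure zero. -/
def Jzero {X : Type*} [TopologicalSpace X] [MeasurableSpace X] (μ : Measure X) :
    Set (Set X) :=
  {A | MeasurableSet A ∧
    ∃ K : ℕ → Set X, (∀ n, IsCompact (K n) ∧ μ (K n) = 0) ∧ A ⊆ ⋃ n, K n}

/-- `J_f(μ)`: Borel sets coverable by countably many compact sets of finite `μ`-measure. -/
def Jfin {X : Type*} [TopologicalSpace X] [MeasurableSpace X] (μ : Measure X) :
    Set (Set X) :=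
  {A | MeasurableSet A ∧
    ∃ K : ℕ → Set X, (∀ n, IsCompact (K n) ∧ μ (K n) < ⊤) ∧ A ⊆ ⋃ n, K n}

/-- `μ` is semifinite: every Borel set of positive measure contains a Borel subset of
finite positive measure. -/
def Semifinite {X : Type*} [MeasurableSpace X] (μ : Measure X) : Prop :=
  ∀ A : Set X, MeasurableSet A → 0 < μ A →
    ∃ B ⊆ A, MeasurableSet B ∧ 0 < μ B ∧ μ B < ⊤

open TopologicalSpace in
/-- Dependent choice along the natural numbers with access to all earlier values. -/
lemma s8_exists_seq {α : Type*} (P : ∀ n : ℕ, (Fin n → α) → α → Prop)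
    (h : ∀ n v, ∃ y, P n v y) : ∃ a : ℕ → α, ∀ n, P n (fun i => a i) (a n) := by
  choose g hg using h
  let a : ℕ → α := fun n =>
    Nat.strongRec (motive := fun _ => α) (fun n ih => g n (fun i => ih i i.2)) n
  refine ⟨a, fun n => ?_⟩
  have : a n = g n (fun i => a i) := by
    simp only [a]
    rw [Nat.strongRec_eq]
  rw [this]
  exact hg n _

open TopologicalSpace in
/-- The tree-like sequence of compact sets. -/
lemma s8_tree {Z α : Type*} [MetricSpace Z] [TopologicalSpace α] [T1Space α] [Nonempty α]
    (hα : ∀ x : α, (𝓝[≠] x).NeBot) (κ : α → NonemptyCompacts Z) (hκ : Continuous κ)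
    (c : ℕ → α → ℝ) (hc : ∀ k, Continuous (c k)) :
    ∃ a : ℕ → α, Function.Injective a ∧ ∀ m : ℕ,
      dist (κ (a (m + 1))) (κ (a (Nat.unpair m).1)) < (1 / 2 : ℝ) ^ (m + 1) ∧
      ∀ k ≤ m, |c k (a (m + 1)) - c k (a (Nat.unpair m).1)| < (1 / 2 : ℝ) ^ (m + 1) := by
  obtain ⟨a, ha⟩ := s8_exists_seq (α := α)
    (fun n v y => ∀ m (hm : n = m + 1), (∀ i, y ≠ v i) ∧
      ∀ p : Fin n, (p : ℕ) = (Nat.unpair m).1 →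
        dist (κ y) (κ (v p)) < (1 / 2 : ℝ) ^ (m + 1) ∧
        ∀ k ≤ m, |c k y - c k (v p)| < (1 / 2 : ℝ) ^ (m + 1)) (by
    intro n v
    rcases n with _ | m
    · obtain ⟨y⟩ := ‹Nonempty α›
      exact ⟨y, fun m hm => by omega⟩
    have hlt : (Nat.unpair m).1 < m + 1 := Nat.lt_succ_of_le (Nat.unpair_left_le m)
    set x := v ⟨_, hlt⟩ with hx
    have hpos : (0 : ℝ) < (1 / 2 : ℝ) ^ (m + 1) := by positivity
    have h1 : ∀ᶠ y in 𝓝[≠] x, dist (κ y) (κ x) < (1 / 2 : ℝ) ^ (m + 1) :=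
      ((hκ.tendsto x).eventually (Metric.ball_mem_nhds _ hpos)).filter_mono nhdsWithin_le_nhds
    have h2 : ∀ᶠ y in 𝓝[≠] x, ∀ k ∈ Finset.range (m + 1),
        |c k y - c k x| < (1 / 2 : ℝ) ^ (m + 1) := by
      rw [Filter.eventually_all_finset]
      intro k _
      have := ((hc k).tendsto x).eventually (Metric.ball_mem_nhds _ hpos)
      exact (this.mono fun y hy => by simpa [Real.dist_eq] using hy).filter_mono
        nhdsWithin_le_nhds
    have h3 : ∀ᶠ y in 𝓝[≠] x, ∀ i, y ≠ v i := by
      rw [Filter.eventually_all]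
      intro i
      by_cases hi : v i = x
      · rw [hi]; exact eventually_mem_nhdsWithin
      · exact (eventually_ne_nhds (Ne.symm hi)).filter_mono nhdsWithin_le_nhds
    have := hα x
    obtain ⟨y, hy1, hy2, hy3⟩ := (h1.and (h2.and h3)).exists
    refine ⟨y, fun m' hm' => ?_⟩
    obtain rfl : m = m' := by omega
    refine ⟨hy3, fun p hp => ?_⟩
    have : v p = x := by rw [hx]; congr 1; exact Fin.ext hp
    rw [this]
    exact ⟨hy1, fun k hk => hy2 k (by simp; omega)⟩)
  refine ⟨a, ?_, fun m => ?_⟩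
  · have key : ∀ i j, i < j → a j ≠ a i := by
      intro i j hij
      rcases j with _ | m
      · omega
      exact (ha (m + 1) m rfl).1 ⟨i, hij⟩
    intro i j hij
    rcases lt_trichotomy i j with h | h | h
    · exact absurd hij.symm (key i j h)
    · exact h
    · exact absurd hij (key j i h)
  · have hlt : (Nat.unpair m).1 < m + 1 := Nat.lt_succ_of_le (Nat.unpair_left_le m)
    exact (ha (m + 1) m rfl).2 ⟨_, hlt⟩ rfl

open TopologicalSpace in
/-- Total boundedness of the union of a tree-like sequence. -/
lemma s8_compact {Z : Type*} [MetricSpace Z] [CompleteSpace Z]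
    (K : ℕ → NonemptyCompacts Z)
    (hK : ∀ m : ℕ, dist (K (m + 1)) (K (Nat.unpair m).1) < (1 / 2 : ℝ) ^ (m + 1)) :
    IsCompact (closure (⋃ n, (K n : Set Z))) := by
  refine isCompact_iff_totallyBounded_isComplete.2
    ⟨TotallyBounded.closure ?_, isClosed_closure.isComplete⟩
  have key : ∀ n i : ℕ, ∀ x ∈ K i, ∃ j ≤ n, ∃ y ∈ K j,
      dist x y ≤ (1 / 2 : ℝ) ^ n - (1 / 2 : ℝ) ^ (max n i) := by
    intro n i
    induction i using Nat.strong_induction_on with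
    | _ i ih =>
      intro x hx
      by_cases hin : i ≤ n
      · exact ⟨i, hin, x, hx, by simp [hin]⟩
      rcases i with _ | m
      · omega
      have hle : (Nat.unpair m).1 ≤ m := Nat.unpair_left_le m
      have h1 := hK m
      rw [Metric.NonemptyCompacts.dist_eq] at h1
      obtain ⟨z, hz, hxz⟩ := Metric.exists_dist_lt_of_hausdorffDist_lt
        (x := x) hx h1 (Metric.hausdorffEDist_ne_top_of_nonempty_of_bounded
          (K _).nonempty (K _).nonempty (K _).isCompact.isBounded (K _).isCompact.isBounded)
      obtain ⟨j, hj, y, hy, hzy⟩ := ih _ (Nat.lt_succ_of_le hle) z hz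
      refine ⟨j, hj, y, hy, ?_⟩
      have h2 : (1 / 2 : ℝ) ^ m ≤ (1 / 2 : ℝ) ^ (max n (Nat.unpair m).1) :=
        pow_le_pow_of_le_one (by norm_num) (by norm_num) (by omega)
      have h3 : max n (m + 1) = m + 1 := by omega
      rw [h3]
      have h4 := dist_triangle x z y
      have h5 : (1 / 2 : ℝ) ^ m = 2 * (1 / 2 : ℝ) ^ (m + 1) := by rw [pow_succ]; ring
      linarith
  rw [Metric.totallyBounded_iff]
  intro ε hε
  obtain ⟨n, hn⟩ := exists_pow_lt_of_lt_one (half_pos hε) (by norm_num : (1 / 2 : ℝ) < 1)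
  have hc : IsCompact (⋃ j ∈ Finset.range (n + 1), (K j : Set Z)) :=
    (Finset.range (n + 1)).isCompact_biUnion fun j _ => (K j).isCompact
  obtain ⟨t, ht, htc⟩ := Metric.totallyBounded_iff.1 hc.totallyBounded (ε / 2) (half_pos hε)
  refine ⟨t, ht, fun x hx => ?_⟩
  obtain ⟨i, hi⟩ := mem_iUnion.1 hx
  obtain ⟨j, hj, y, hy, hxy⟩ := key n i x hi
  have hy' : y ∈ ⋃ j ∈ Finset.range (n + 1), (K j : Set Z) := by
    simp only [mem_iUnion]
    exact ⟨j, by simp; omega, hy⟩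
  obtain ⟨w, hw, hyw⟩ := mem_iUnion₂.1 (htc hy')
  refine mem_iUnion₂.2 ⟨w, hw, ?_⟩
  rw [Metric.mem_ball] at hyw ⊢
  have := dist_triangle x y w
  have : (0 : ℝ) < (1 / 2 : ℝ) ^ (max n i) := by positivity
  linarith

open TopologicalSpace in
/-- An uncountable disjoint family of compact sets with full support. -/
lemma s8_family {Z : Type*} [TopologicalSpace Z] [PolishSpace Z] [MeasurableSpace Z]
    [BorelSpace Z] (μ : Measure Z) (hs : Semifinite μ) (hnsf : ¬ SigmaFinite μ) :
    ∃ T : Set (NonemptyCompacts Z), ¬ T.Countable ∧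
      (∀ K ∈ T, μ (K : Set Z) < ⊤ ∧ ∀ U, IsOpen U → ((K : Set Z) ∩ U).Nonempty →
        0 < μ ((K : Set Z) ∩ U)) ∧
      T.Pairwise (fun K L => Disjoint (K : Set Z) (L : Set Z)) := by
  let Good : NonemptyCompacts Z → Prop := fun K =>
    μ (K : Set Z) < ⊤ ∧ ∀ U, IsOpen U → ((K : Set Z) ∩ U).Nonempty → 0 < μ ((K : Set Z) ∩ U)
  obtain ⟨T, hT⟩ := zorn_subset {T : Set (NonemptyCompacts Z) | (∀ K ∈ T, Good K) ∧
      T.Pairwise (fun K L => Disjoint (K : Set Z) (L : Set Z))} (by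
    intro C hC hchain
    refine ⟨⋃₀ C, ⟨?_, ?_⟩, fun s hs => subset_sUnion_of_mem hs⟩
    · rintro K ⟨S, hS, hKS⟩
      exact (hC hS).1 K hKS
    · exact (pairwise_sUnion hchain.directedOn).2 fun S hS => (hC hS).2)
  refine ⟨T, fun hcount => ?_, hT.prop.1, hT.prop.2⟩
  -- the union of a countable family is measurable and σ-finite
  set S : Set Z := ⋃ K ∈ T, (K : Set Z) with hS
  have hSm : MeasurableSet S := MeasurableSet.biUnion hcount fun K _ => K.isCompact.measurableSet
  have hpos : 0 < μ Sᶜ := by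
    rw [pos_iff_ne_zero]
    intro h0
    apply hnsf
    refine Measure.sigmaFinite_of_countable (S := insert Sᶜ ((fun K : NonemptyCompacts Z => (K : Set Z)) '' T))
      ((hcount.image _).insert _) ?_ ?_
    · rintro s (rfl | ⟨K, hK, rfl⟩)
      · rw [h0]; simp
      · exact (hT.prop.1 K hK).1
    · rw [sUnion_insert, sUnion_image, ← hS, compl_union_self]
  obtain ⟨B, hBS, hBm, hB0, hBt⟩ := hs _ hSm.compl hpos
  obtain ⟨K, hKB, hKc, hK0⟩ := hBm.exists_lt_isCompact_of_ne_top hBt.ne hB0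
  have hKt : μ K < ⊤ := (measure_mono hKB).trans_lt hBt
  -- shrink to the support
  set N : Set Z := ⋃ U ∈ {U ∈ countableBasis Z | μ (K ∩ U) = 0}, U with hN
  have hcb : {U ∈ countableBasis Z | μ (K ∩ U) = 0}.Countable :=
    (countable_countableBasis Z).mono fun _ h => h.1
  have hNo : IsOpen N := isOpen_biUnion fun U hU => isOpen_of_mem_countableBasis hU.1
  have hKN : μ (K ∩ N) = 0 := by
    rw [hN, inter_iUnion₂]
    exact (measure_biUnion_null_iff hcb).2 fun U hU => hU.2
  have hdiff : ∀ V : Set Z, μ ((K \ N) ∩ V) = μ (K ∩ V) := by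
    intro V
    apply le_antisymm (measure_mono (inter_subset_inter_left _ sdiff_subset))
    calc μ (K ∩ V) ≤ μ ((K \ N) ∩ V ∪ (K ∩ N)) := measure_mono (by
            rintro x ⟨h1, h2⟩
            by_cases h : x ∈ N
            · exact Or.inr ⟨h1, h⟩
            · exact Or.inl ⟨⟨h1, h⟩, h2⟩)
      _ ≤ μ ((K \ N) ∩ V) + μ (K ∩ N) := measure_union_le _ _
      _ = _ := by rw [hKN, add_zero]
  have hK'pos : 0 < μ (K \ N) := by
    have := hdiff univ
    simp only [inter_univ] at this
    rwa [this]
  have hne : (K \ N).Nonempty := nonempty_of_measure_ne_zero hK'pos.ne'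
  let L : NonemptyCompacts Z := ⟨⟨K \ N, hKc.diff hNo⟩, hne⟩
  have hLc : (L : Set Z) = K \ N := rfl
  have hLgood : Good L := by
    refine ⟨(measure_mono sdiff_subset).trans_lt hKt, fun U hU hUne => ?_⟩
    rw [hLc] at hUne ⊢
    rw [hdiff, pos_iff_ne_zero]
    intro h0
    obtain ⟨x, ⟨hxK, hxN⟩, hxU⟩ := hUne
    obtain ⟨V, hV, hxV, hVU⟩ := (isBasis_countableBasis Z).exists_subset_of_mem_open hxU hU
    exact hxN (mem_biUnion (x := V)
      ⟨hV, measure_mono_null (inter_subset_inter_right _ hVU) h0⟩ hxV)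
  have hLdisj : ∀ M ∈ T, Disjoint (L : Set Z) (M : Set Z) := by
    intro M hM
    rw [Set.disjoint_left]
    intro x hxL hxM
    exact hBS (hKB hxL.1) (mem_biUnion (x := M) hM hxM)
  have hLT : L ∈ T := by
    refine hT.le_of_ge (y := insert L T) ⟨?_, ?_⟩ (subset_insert _ _) (mem_insert _ _)
    · rintro M (rfl | hM)
      · exact hLgood
      · exact hT.prop.1 M hM
    · refine hT.prop.2.insert fun M hM _ => ⟨hLdisj M hM, (hLdisj M hM).symm⟩
  obtain ⟨x, hx⟩ := L.nonempty
  exact Set.disjoint_left.1 (hLdisj L hLT) hx hx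

open TopologicalSpace in
lemma s8_main {Z : Type*} [TopologicalSpace Z] [PolishSpace Z] [MeasurableSpace Z]
    [BorelSpace Z] (μ : Measure Z) (hs : Semifinite μ) (hnsf : ¬ SigmaFinite μ) :
    ∃ D : Set Z, IsCompact D ∧ ∀ C : ℕ → Set Z, (∀ n, IsClosed (C n) ∧ μ (C n) < ⊤) →
      ¬ D ⊆ ⋃ n, C n := by
  let _ := upgradeIsCompletelyMetrizable Z
  obtain ⟨T, hTu, hTg, hTd⟩ := s8_family μ hs hnsf
  have hT0 : T.Nonempty := by
    rw [nonempty_iff_ne_empty]; rintro rfl; exact hTu countable_empty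
  obtain ⟨K0, hK0⟩ := hT0
  have : Nonempty Z := K0.nonempty.to_subtype.map Subtype.val
  obtain ⟨u, hu⟩ := (countable_countableBasis Z).exists_eq_range
    (by
      obtain ⟨z⟩ := this
      obtain ⟨V, hV, -⟩ := (isBasis_countableBasis Z).exists_subset_of_mem_open
        (mem_univ z) isOpen_univ
      exact ⟨V, hV⟩)
  have hub : IsTopologicalBasis (range u) := hu ▸ isBasis_countableBasis Z
  have huo : ∀ k, IsOpen (u k) := fun k => hub.isOpen (mem_range_self k)
  -- coding
  let code : NonemptyCompacts Z → NonemptyCompacts Z × (ℕ → ℝ) :=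
    fun K => (K, fun k => (μ ((K : Set Z) ∩ u k)).toReal)
  have hinj : Function.Injective code := fun K L h => congrArg Prod.fst h
  let S := code '' T
  have hSu : ¬ S.Countable := fun h => hTu (countable_of_injective_of_countable_image hinj.injOn h)
  have hSu' : ¬ (univ : Set S).Countable := fun h => hSu (by
    rw [countable_univ_iff] at h; exact h)
  obtain ⟨P, hP, hPne, -⟩ := exists_perfect_nonempty_of_isClosed_of_not_countable
    isClosed_univ hSu'
  have : Nonempty P := hPne.to_subtype
  have hα : ∀ x : P, (𝓝[≠] x).NeBot := by
    rintro ⟨x, hx⟩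
    have h := hP.acc x hx
    rw [accPt_iff_frequently] at h
    rw [← Filter.frequently_true_iff_neBot, frequently_nhdsWithin_iff, nhds_subtype_eq_comap]
    rw [Filter.frequently_comap]
    refine h.mono fun y hy => ⟨⟨y, hy.2⟩, rfl, trivial, fun h => hy.1 (congrArg Subtype.val h)⟩
  let κ : P → NonemptyCompacts Z := fun x => x.1.1.1
  have hκ : Continuous κ := by fun_prop
  let c : ℕ → P → ℝ := fun k x => x.1.1.2 k
  have hc : ∀ k, Continuous (c k) := fun k => by fun_prop
  have hκT : ∀ x, κ x ∈ T := by
    rintro ⟨⟨_, K, hK, rfl⟩, hx⟩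
    exact hK
  have hcκ : ∀ k x, c k x = (μ ((κ x : Set Z) ∩ u k)).toReal := by
    rintro k ⟨⟨_, K, hK, rfl⟩, hx⟩
    rfl
  have hκinj : Function.Injective κ := by
    rintro ⟨⟨_, K, hK, rfl⟩, hx⟩ ⟨⟨_, L, hL, rfl⟩, hy⟩ h
    have : K = L := h
    subst this
    rfl
  obtain ⟨a, ainj, ha⟩ := s8_tree hα κ hκ c hc
  have hcomp := s8_compact (fun n => κ (a n)) (fun m => (ha m).1)
  set D := closure (⋃ n, (κ (a n) : Set Z)) with hD
  have hsubD : ∀ n, (κ (a n) : Set Z) ⊆ D := fun n =>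
    (subset_iUnion (fun n => (κ (a n) : Set Z)) n).trans subset_closure
  have hDne : D.Nonempty := (κ (a 0)).nonempty.mono (hsubD 0)
  refine ⟨D, hcomp, fun C hC hDC => ?_⟩
  have : CompactSpace D := isCompact_iff_compactSpace.1 hcomp
  have : Nonempty D := hDne.to_subtype
  obtain ⟨n, x, hx⟩ := nonempty_interior_of_iUnion_of_closed
    (f := fun n => ((↑) : D → Z) ⁻¹' C n)
    (fun n => (hC n).1.preimage continuous_subtype_val) (by
      rw [← preimage_iUnion, eq_univ_iff_forall]
      exact fun x => hDC x.2)
  obtain ⟨V, hV, hVeq⟩ := isOpen_induced_iff.1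
    (isOpen_interior (s := ((↑) : D → Z) ⁻¹' C n))
  have hVC : V ∩ D ⊆ C n := by
    rintro y ⟨hyV, hyD⟩
    have h1 : (⟨y, hyD⟩ : D) ∈ ((↑) : D → Z) ⁻¹' V := hyV
    rw [hVeq] at h1
    exact (interior_subset h1 : (⟨y, hyD⟩ : D) ∈ ((↑) : D → Z) ⁻¹' C n)
  have hxV : (x : Z) ∈ V := by rw [← hVeq] at hx; exact hx
  obtain ⟨z, hzV, hz⟩ := mem_closure_iff.1 x.2 V hV hxV
  obtain ⟨i, hzi⟩ := mem_iUnion.1 hz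
  obtain ⟨_, ⟨k, rfl⟩, hzk, hkV⟩ := hub.exists_subset_of_mem_open hzV hV
  have hpos := (hTg _ (hκT (a i))).2 (u k) (huo k) ⟨z, hzi, hzk⟩
  have hfin : ∀ y, μ ((κ y : Set Z) ∩ u k) ≠ ⊤ := fun y =>
    ((measure_mono inter_subset_left).trans_lt (hTg _ (hκT y)).1).ne
  have hη : 0 < c k (a i) := by
    rw [hcκ]; exact ENNReal.toReal_pos hpos.ne' (hfin _)
  set η := c k (a i) with hηdef
  -- the children
  let b : ℕ → P := fun j => a (Nat.pair i j + 1)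
  have hbinj : Function.Injective b := by
    intro j j' h
    have := ainj h
    simpa using this
  have hfinite := Measure.finite_const_le_meas_of_disjoint_iUnion μ
    (ε := ENNReal.ofReal (η / 2)) (by simpa using hη)
    (As := fun j => (κ (b j) : Set Z) ∩ u k)
    (fun j => (κ (b j)).isCompact.measurableSet.inter (huo k).measurableSet)
    (by
      intro j j' hjj
      have h1 : κ (b j) ≠ κ (b j') := fun h => hjj (hbinj (hκinj h))
      exact (hTd (hκT _) (hκT _) h1).mono inter_subset_left inter_subset_left)
    (by
      refine ((measure_mono ?_).trans_lt (hC n).2).ne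
      refine iUnion_subset fun j => ?_
      rintro y ⟨hy1, hy2⟩
      exact hVC ⟨hkV hy2, hsubD _ hy1⟩)
  obtain ⟨m, hm⟩ := exists_pow_lt_of_lt_one (half_pos hη) (by norm_num : (1 / 2 : ℝ) < 1)
  refine (Set.Ici_infinite (max m k)) (hfinite.subset fun j hj => ?_)
  have hj' : max m k ≤ j := hj
  have hjp : j ≤ Nat.pair i j := Nat.right_le_pair i j
  have h1 := (ha (Nat.pair i j)).2 k (by omega)
  rw [Nat.unpair_pair] at h1
  have h2 : (1 / 2 : ℝ) ^ (Nat.pair i j + 1) ≤ (1 / 2 : ℝ) ^ m :=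
    pow_le_pow_of_le_one (by norm_num) (by norm_num) (by omega)
  have h3 : η / 2 ≤ c k (b j) := by
    have := (abs_lt.1 h1).1
    change -_ < c k (b j) - η at this
    linarith
  rw [hcκ] at h3
  exact ENNReal.ofReal_le_of_le_toReal h3

/-- A null set outside `Jfin`. -/
lemma s8_null {X : Type*} [MetricSpace X] [CompactSpace X] [MeasurableSpace X] [BorelSpace X]
    (μ : Measure X) (Y : Set X) (hYm : MeasurableSet Y) (hYnI : Y ∉ Jfin μ) (hYfin : μ Y < ⊤) :
    ∃ N : Set X, MeasurableSet N ∧ N ∉ Jfin μ ∧ μ N = 0 := by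
  have h : ∀ n : ℕ, ∃ K, K ⊆ Y ∧ IsCompact K ∧ μ (Y \ K) < ((n : ℝ≥0∞) + 1)⁻¹ := fun n =>
    hYm.exists_isCompact_sdiff_lt hYfin.ne (by simp)
  choose K hKY hKc hK using h
  have hKm : MeasurableSet (⋃ n, K n) := MeasurableSet.iUnion fun n => (hKc n).measurableSet
  refine ⟨Y \ ⋃ n, K n, hYm.diff hKm, ?_, ?_⟩
  · rintro ⟨-, C, hC, hsub⟩
    apply hYnI
    refine ⟨hYm, fun n => if Even n then K (n / 2) else C (n / 2), fun n => ?_, fun y hy => ?_⟩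
    · by_cases hn : Even n
      · simp only [hn, if_true]
        exact ⟨hKc _, (measure_mono (hKY _)).trans_lt hYfin⟩
      · simp only [hn, if_false]
        exact hC _
    · by_cases hyK : y ∈ ⋃ n, K n
      · obtain ⟨n, hn⟩ := mem_iUnion.1 hyK
        exact mem_iUnion.2 ⟨2 * n, by simpa using hn⟩
      · obtain ⟨n, hn⟩ := mem_iUnion.1 (hsub ⟨hy, hyK⟩)
        refine mem_iUnion.2 ⟨2 * n + 1, ?_⟩
        have h1 : ¬ Even (2 * n + 1) := by simp
        have h2 : (2 * n + 1) / 2 = n := by omega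
        simp only [h1, if_false, h2]
        exact hn
  · by_contra h0
    obtain ⟨n, hn⟩ := ENNReal.exists_inv_nat_lt h0
    have h1 : μ (Y \ ⋃ n, K n) ≤ μ (Y \ K n) :=
      measure_mono (sdiff_subset_sdiff_right (subset_iUnion K n))
    have h2 : ((n : ℝ≥0∞) + 1)⁻¹ ≤ (n : ℝ≥0∞)⁻¹ := ENNReal.inv_le_inv.2 le_self_add
    exact absurd (((h1.trans_lt (hK n)).trans_le h2).trans hn) (lt_irrefl _)

/-- Proposition 6.1(ii): if moreover `μ` is not σ-finite, some Borel set `Y ∉ J_f(μ)` has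
finite measure, and `K ↦ μ(K)` is Borel on the hyperspace of nonempty compact subsets of
`X` (with the Hausdorff metric), then `J_f(μ)` is not homogeneous. -/
theorem statement8 {X : Type*}
    [MetricSpace X] [CompactSpace X] [Nonempty X] [MeasurableSpace X] [BorelSpace X]
    (μ : Measure X) (hμna : ∀ x : X, μ {x} = 0) (hμsemi : Semifinite μ)
    (hμpos : 0 < μ Set.univ)
    (hμnsf : ¬ SigmaFinite μ)
    (Y : Set X) (hYm : MeasurableSet Y) (hYnI : Y ∉ Jfin μ) (hYfin : μ Y < ⊤)
    (hμhyp : @Measurable (TopologicalSpace.NonemptyCompacts X) ℝ≥0∞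
      (borel (TopologicalSpace.NonemptyCompacts X)) inferInstance
      (fun K => μ (K : Set X))) :
    ∃ E : Set X, MeasurableSet E ∧ E ∉ Jfin μ ∧
      ∀ f : X → X, Measurable f → Set.range f ⊆ E →
        ∃ A ∈ Jfin μ, f ⁻¹' A ∉ Jfin μ := by
  obtain ⟨N, hNm, hNJ, hN0⟩ := s8_null μ Y hYm hYnI hYfin
  refine ⟨N, hNm, hNJ, fun f hf hrange => ?_⟩
  have hpolX : PolishSpace X := inferInstance
  have hbX : ‹MeasurableSpace X› = borel X := BorelSpace.measurable_eq
  have key : ∃ D : Set X, IsCompact (f '' D) ∧ ∀ C : ℕ → Set X,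
      (∀ n, IsClosed (C n) ∧ μ (C n) < ⊤) → ¬ D ⊆ ⋃ n, C n := by
    obtain ⟨t', ht', hft', hpol⟩ := hf.exists_continuous
    have hborel : @BorelSpace X t' _ :=
      @BorelSpace.mk X t' _
        (hbX.trans (@borel_eq_borel_of_le X t' UniformSpace.toTopologicalSpace hpol hpolX ht').symm)
    obtain ⟨D, hDc, hD⟩ := @s8_main X t' hpol _ hborel μ hμsemi hμnsf
    refine ⟨D, @IsCompact.image X X t' UniformSpace.toTopologicalSpace D f hDc hft',
      fun C hC => hD C fun n => ⟨?_, (hC n).2⟩⟩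
    exact @IsClosed.mono X t' UniformSpace.toTopologicalSpace (C n) (hC n).1 ht'
  obtain ⟨D, hfD, hD⟩ := key
  have hfD0 : μ (f '' D) = 0 :=
    measure_mono_null ((image_subset_range f D).trans hrange) hN0
  refine ⟨f '' D, ⟨hfD.measurableSet, fun _ => f '' D, fun _ => ⟨hfD, by simp [hfD0]⟩,
    fun x hx => mem_iUnion.2 ⟨0, hx⟩⟩, ?_⟩
  rintro ⟨-, C, hC, hsub⟩
  exact hD C (fun n => ⟨(hC n).1.isClosed, (hC n).2⟩)
    ((subset_preimage_image f D).trans hsub)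
end

section
/- There is a copy of the irrationals P in [0,1] such that: (a) P cannot be covered by countably many compact subsets of [0,1] of λ-measure zero; and (b) for every semifinite nonatomic Borel measure μ on a compactum X and every Borel set B ⊆ X with B ∉ J₀(μ), there is a topological embedding h : P → X with h(P) ⊆ B such that for every subset A ⊆ P: A can be covered by countably many compact subsets of [0,1] of λ-measure zero if and only if h(A) can be covered by countably many compact subsets of X of μ-measure zero. -/
open MeasureTheory Topology Filter Set ENNReal

/-- `A` can be covered by countably many compact sets of `μ`-measure zero. -/
def CovNull {X : Type*} [TopologicalSpace X] [MeasurableSpace X] (μ : Measure X)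
    (A : Set X) : Prop :=
  ∃ K : ℕ → Set X, (∀ n, IsCompact (K n) ∧ μ (K n) = 0) ∧ A ⊆ ⋃ n, K n

theorem aux_cdf_cont (κ : Measure ℝ) [IsProbabilityMeasure κ] (hκ : ∀ x, κ {x} = 0) :
    Continuous (ProbabilityTheory.cdf κ) := by
  rw [continuous_iff_continuousAt]
  intro a
  have h1 := (ProbabilityTheory.cdf κ).measure_singleton a
  rw [ProbabilityTheory.measure_cdf, hκ] at h1
  have h2 : (ProbabilityTheory.cdf κ) a ≤ Function.leftLim (ProbabilityTheory.cdf κ) a := by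
    have := ENNReal.ofReal_eq_zero.1 h1.symm
    linarith
  have h3 := (ProbabilityTheory.monotone_cdf κ).leftLim_le (le_refl a)
  have h4 := le_antisymm h3 h2
  rw [(ProbabilityTheory.monotone_cdf κ).continuousAt_iff_leftLim_eq_rightLim, h4,
    StieltjesFunction.rightLim_eq]

theorem aux_cdf_Iic (κ : Measure ℝ) [IsProbabilityMeasure κ] (hκ : ∀ x, κ {x} = 0) (t : ℝ)
    (h0 : 0 < t) (h1 : t < 1) :
    κ ((ProbabilityTheory.cdf κ) ⁻¹' (Iic t)) = ENNReal.ofReal t := by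
  have hc := aux_cdf_cont κ hκ
  have hm := ProbabilityTheory.monotone_cdf κ
  set G := ProbabilityTheory.cdf κ with hG
  obtain ⟨a, ha⟩ := ((ProbabilityTheory.tendsto_cdf_atBot κ).eventually (gt_mem_nhds h0)).exists
  obtain ⟨b, hb⟩ := ((ProbabilityTheory.tendsto_cdf_atTop κ).eventually (lt_mem_nhds h1)).exists
  obtain ⟨x, hx⟩ : ∃ x, G x = t :=
    mem_range_of_exists_le_of_exists_ge hc ⟨a, ha.le⟩ ⟨b, hb.le⟩
  have hcl : IsClosed (G ⁻¹' (Iic t)) := isClosed_Iic.preimage hc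
  have hne : (G ⁻¹' (Iic t)).Nonempty := ⟨x, hx.le⟩
  have hbd : BddAbove (G ⁻¹' (Iic t)) := by
    refine ⟨b, fun y hy => ?_⟩
    by_contra hlt
    have := hm (not_le.1 hlt).le
    have h' : G y ≤ t := hy
    linarith
  have hz := hcl.csSup_mem hne hbd
  set z := sSup (G ⁻¹' (Iic t)) with hzdef
  have hzt : G z = t := le_antisymm hz (by rw [← hx]; exact hm (le_csSup hbd hx.le))
  have : G ⁻¹' (Iic t) = Iic z := by
    ext y
    exact ⟨fun hy => le_csSup hbd hy, fun hy => (hm hy).trans hzt.le⟩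
  rw [this, ← ProbabilityTheory.ofReal_cdf κ z, ← hG, hzt]

theorem aux_map_cdf (κ : Measure ℝ) [IsProbabilityMeasure κ] (hκ : ∀ x, κ {x} = 0) :
    κ.map (ProbabilityTheory.cdf κ) = volume.restrict (Icc 0 1) := by
  have hc := aux_cdf_cont κ hκ
  have hfin : IsProbabilityMeasure (κ.map (ProbabilityTheory.cdf κ)) :=
    Measure.isProbabilityMeasure_map hc.measurable.aemeasurable
  apply Measure.ext_of_Iic
  intro b
  have key : ∀ t, κ.map (ProbabilityTheory.cdf κ) (Iic t) = volume.restrict (Icc 0 1) (Iic t) := by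
    intro t
    rw [Measure.map_apply hc.measurable measurableSet_Iic,
      Measure.restrict_apply measurableSet_Iic]
    have hlt : ∀ t, 0 < t → t < 1 → κ ((ProbabilityTheory.cdf κ) ⁻¹' (Iic t)) = ENNReal.ofReal t :=
      aux_cdf_Iic κ hκ
    rcases le_or_gt t 0 with h0 | h0
    · have e1 : volume (Iic t ∩ Icc 0 1) = 0 := by
        refine measure_mono_null (t := {0}) ?_ (by simp)
        rintro x ⟨hx, hx', _⟩
        exact le_antisymm (le_trans hx h0) hx'
      rw [e1]
      have : ∀ n : ℕ, κ ((ProbabilityTheory.cdf κ) ⁻¹' (Iic t)) ≤ ENNReal.ofReal (1 / ((n : ℝ) + 2)) := by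
        intro n
        rw [← hlt _ (by positivity) (by rw [div_lt_one (by positivity)]; linarith [n.cast_nonneg (α := ℝ)])]
        refine measure_mono (preimage_mono (Iic_subset_Iic.2 (h0.trans (by positivity))))
      refine le_antisymm (ge_of_tendsto' (x := atTop) ?_ this) zero_le
      have h2 : Tendsto (fun n : ℕ => 1 / ((n : ℝ) + 2)) atTop (𝓝 0) := by
        refine Tendsto.div_atTop tendsto_const_nhds ?_
        exact tendsto_atTop_add_const_right _ _ tendsto_natCast_atTop_atTop
      simpa using ENNReal.tendsto_ofReal h2
    rcases lt_or_ge t 1 with h1 | h1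
    · rw [hlt t h0 h1]
      have : Iic t ∩ Icc 0 1 = Icc 0 t := by
        ext x; simp only [mem_inter_iff, mem_Iic, mem_Icc]
        constructor
        · rintro ⟨h, h', _⟩; exact ⟨h', h⟩
        · rintro ⟨h, h'⟩; exact ⟨h', h, h'.trans h1.le⟩
      rw [this]; simp
    · have e1 : (ProbabilityTheory.cdf κ) ⁻¹' (Iic t) = univ :=
        eq_univ_of_forall fun x => (ProbabilityTheory.cdf_le_one κ x).trans h1
      have e2 : Iic t ∩ Icc 0 1 = Icc (0:ℝ) 1 := inter_eq_right.2 fun x hx => hx.2.trans h1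
      rw [e1, e2]; simp
  exact key b

/-- Lusin type statement. -/
theorem aux_lusin {X : Type*} [MetricSpace X] [CompactSpace X] [MeasurableSpace X] [BorelSpace X]
    (μ : Measure X) (K : Set X) (hK : MeasurableSet K) (h0 : 0 < μ K) (h1 : μ K < ⊤)
    (θ : X → ℝ) (hθ : Measurable θ) :
    ∃ L ⊆ K, IsCompact L ∧ 0 < μ L ∧ ContinuousOn θ L := by
  let Φ : X → X × ℝ := fun x => (x, θ x)
  have hΦ : Measurable Φ := measurable_id.prodMk hθ
  have : IsFiniteMeasure (μ.restrict K) := ⟨by simpa using h1⟩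
  let m := (μ.restrict K).map Φ
  have hgr : MeasurableSet {p : X × ℝ | p.1 ∈ K ∧ θ p.1 = p.2} :=
    (measurable_fst hK).inter (measurableSet_eq_fun (hθ.comp measurable_fst) measurable_snd)
  have hpos : 0 < m {p : X × ℝ | p.1 ∈ K ∧ θ p.1 = p.2} := by
    rw [Measure.map_apply hΦ hgr]
    have : Φ ⁻¹' {p : X × ℝ | p.1 ∈ K ∧ θ p.1 = p.2} = K := by
      ext x; simp [Φ]
    rw [this]; simpa using h0
  obtain ⟨M, hMs, hMc, hM0⟩ := hgr.exists_lt_isCompact_of_ne_top (measure_ne_top m _) hpos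
  refine ⟨Prod.fst '' M, ?_, hMc.image continuous_fst, ?_, ?_⟩
  · rintro _ ⟨p, hp, rfl⟩; exact (hMs hp).1
  · rw [Measure.map_apply hΦ hMc.measurableSet] at hM0
    have h2 := hM0.trans_le (Measure.restrict_apply_le _ _)
    refine h2.trans_le (measure_mono ?_)
    intro x hx
    exact ⟨_, hx, rfl⟩
  · rw [continuousOn_iff_isClosed]
    intro t ht
    refine ⟨Prod.fst '' (M ∩ Prod.snd ⁻¹' t),
      ((hMc.inter_right (ht.preimage continuous_snd)).image continuous_fst).isClosed, ?_⟩
    ext x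
    constructor
    · rintro ⟨hx, p, hp, rfl⟩
      exact ⟨⟨p, ⟨hp, by have := (hMs hp).2; rw [mem_preimage, ← this]; exact hx⟩, rfl⟩, p, hp, rfl⟩
    · rintro ⟨⟨p, ⟨hp, hpt⟩, rfl⟩, h⟩
      exact ⟨by have := (hMs hp).2; rw [mem_preimage, this]; exact hpt, h⟩

theorem aux_pi {X : Type*} [MetricSpace X] [CompactSpace X] [MeasurableSpace X] [BorelSpace X]
    (μ : Measure X) (hat : ∀ x, μ {x} = 0)
    (K : Set X) (hK : MeasurableSet K) (h0 : 0 < μ K) (h1 : μ K < ⊤) :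
    ∃ L ⊆ K, IsCompact L ∧ ∃ π : X → ℝ, ContinuousOn π L ∧ π '' L = Icc 0 1 ∧
      ∀ F ⊆ L, IsClosed F → (μ F = 0 ↔ volume (π '' F) = 0) := by
  obtain ⟨θ, hθ⟩ := exists_measurableEmbedding_real X
  obtain ⟨L, hLK, hLc, hL0, hθc⟩ := aux_lusin μ K hK h0 h1 θ hθ.measurable
  have hLtop : μ L ≠ ⊤ := ((measure_mono hLK).trans_lt h1).ne
  refine ⟨L, hLK, hLc, ?_⟩
  let ρ := ProbabilityTheory.cond μ L
  have : IsProbabilityMeasure ρ := ProbabilityTheory.cond_isProbabilityMeasure_of_finite hL0.ne' hLtop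
  have hρ0 : ∀ s, μ s = 0 → ρ s = 0 := fun s hs => ProbabilityTheory.cond_absolutelyContinuous hs
  have hρ1 : ∀ s ⊆ L, MeasurableSet s → ρ s = 0 → μ s = 0 := by
    intro s hs hsm h
    rw [ProbabilityTheory.cond_apply hLc.measurableSet, inter_eq_right.2 hs] at h
    rcases mul_eq_zero.1 h with h | h
    · exact absurd h (ENNReal.inv_ne_zero.2 hLtop)
    · exact h
  let κ := ρ.map θ
  have : IsProbabilityMeasure κ := Measure.isProbabilityMeasure_map hθ.measurable.aemeasurable
  have hκ : ∀ x, κ {x} = 0 := by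
    intro x
    rw [Measure.map_apply hθ.measurable (measurableSet_singleton x)]
    apply hρ0
    have hs : (θ ⁻¹' {x}).Subsingleton := by
      intro a ha b hb
      exact hθ.injective (ha.trans hb.symm)
    rcases hs.eq_empty_or_singleton with h | ⟨y, h⟩
    · rw [h]; simp
    · rw [h]; exact hat y
  let G := ProbabilityTheory.cdf κ
  have hGc : Continuous G := aux_cdf_cont κ hκ
  have hGm : Monotone G := ProbabilityTheory.monotone_cdf κ
  have hπm : Measurable (fun x => G (θ x)) := hGc.measurable.comp hθ.measurable
  have hmap : ρ.map (fun x => G (θ x)) = volume.restrict (Icc 0 1) := by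
    rw [← aux_map_cdf κ hκ, Measure.map_map hGc.measurable hθ.measurable]
    rfl
  have hval : ∀ x, G (θ x) ∈ Icc (0:ℝ) 1 := fun x =>
    ⟨ProbabilityTheory.cdf_nonneg κ _, ProbabilityTheory.cdf_le_one κ _⟩
  have hpre : ∀ E, MeasurableSet E → E ⊆ Icc 0 1 → volume E = ρ ((fun x => G (θ x)) ⁻¹' E) := by
    intro E hE hE1
    rw [← Measure.map_apply hπm hE, hmap, Measure.restrict_apply hE, inter_eq_left.2 hE1]
  have hπc : ContinuousOn (fun x => G (θ x)) L := hGc.comp_continuousOn hθc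
  have hρL : ρ Lᶜ = 0 := by
    rw [ProbabilityTheory.cond_apply hLc.measurableSet]; simp
  refine ⟨fun x => G (θ x), hπc, ?_, ?_⟩
  · have hsub : (fun x => G (θ x)) '' L ⊆ Icc 0 1 := by rintro _ ⟨x, -, rfl⟩; exact hval x
    have hcl : IsClosed ((fun x => G (θ x)) '' L) := (hLc.image_of_continuousOn hπc).isClosed
    refine subset_antisymm hsub ?_
    -- full measure closed set
    have hnull : volume (Ioo 0 1 \ (fun x => G (θ x)) '' L) = 0 := by
      rw [hpre _ (measurableSet_Ioo.diff hcl.measurableSet) (sdiff_subset.trans Ioo_subset_Icc_self)]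
      refine measure_mono_null ?_ hρL
      intro x hx hxL
      exact hx.2 ⟨x, hxL, rfl⟩
    have hemp : Ioo 0 1 \ (fun x => G (θ x)) '' L = ∅ :=
      (isOpen_Ioo.sdiff hcl).measure_eq_zero_iff volume |>.1 hnull
    have : Ioo 0 1 ⊆ (fun x => G (θ x)) '' L := sdiff_eq_empty.1 hemp
    rw [← closure_Ioo (zero_ne_one' ℝ)]
    exact closure_minimal this hcl
  · intro F hFL hF
    have hFc : IsCompact F := hLc.of_isClosed_subset hF hFL
    have hi : MeasurableSet ((fun x => G (θ x)) '' F) :=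
      (hFc.image_of_continuousOn (hπc.mono hFL)).measurableSet
    have hi1 : (fun x => G (θ x)) '' F ⊆ Icc 0 1 := by rintro _ ⟨x, -, rfl⟩; exact hval x
    rw [hpre _ hi hi1]
    constructor
    · intro h
      -- countable set of bad values
      have hcnt : {q : ℝ | ∃ x y, x < y ∧ G x = q ∧ G y = q}.Countable := by
        have := hGm.countable_setOfPred_two_preimages
        refine this.mono ?_
        rintro q ⟨x, y, h⟩
        exact ⟨x, y, h⟩
      have hsub : (fun x => G (θ x)) ⁻¹' ((fun x => G (θ x)) '' F) ⊆
          F ∪ ⋃ q ∈ {q : ℝ | ∃ x y, x < y ∧ G x = q ∧ G y = q}, (fun x => G (θ x)) ⁻¹' ({q} ∩ Icc 0 1) := by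
        rintro x ⟨y, hy, hyx⟩
        by_cases hxy : x = y
        · left; rw [hxy]; exact hy
        right
        have hne : θ x ≠ θ y := fun h => hxy (hθ.injective h)
        refine mem_biUnion (x := G (θ x)) ?_ ⟨rfl, hval x⟩
        rcases lt_or_gt_of_ne hne with h | h
        · exact ⟨_, _, h, rfl, hyx⟩
        · exact ⟨_, _, h, hyx, rfl⟩
      refine measure_mono_null hsub (measure_union_null (hρ0 _ h) ?_)
      rw [measure_biUnion_null_iff hcnt]
      intro q _
      rw [← hpre _ ((measurableSet_singleton q).inter measurableSet_Icc) inter_subset_right]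
      exact measure_mono_null inter_subset_left (by simp)
    · intro h
      exact hρ1 F hFL hF.measurableSet (measure_mono_null (subset_preimage_image _ _) h)

/-- The set of cluster points of the sequence `g` along `S`. -/
def clus {X : Type*} [TopologicalSpace X] (g : ℕ → X) (S : Set ℕ) : Set X :=
  {y | MapClusterPt y (atTop ⊓ 𝓟 S) g}

theorem mem_clus {X : Type*} [TopologicalSpace X] {g : ℕ → X} {S : Set ℕ} {y : X} :
    y ∈ clus g S ↔ ∃ U : Ultrafilter ℕ, ↑U ≤ (atTop ⊓ 𝓟 S) ∧ Tendsto g U (𝓝 y) :=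
  mapClusterPt_iff_ultrafilter

theorem isClosed_clus {X : Type*} [TopologicalSpace X] (g : ℕ → X) (S : Set ℕ) :
    IsClosed (clus g S) := isClosed_setOfPred_clusterPt

theorem clus_subset {X : Type*} [TopologicalSpace X] {g : ℕ → X} {L : Set X} (hL : IsClosed L)
    (hg : ∀ n, g n ∈ L) (S : Set ℕ) : clus g S ⊆ L := by
  intro y hy
  obtain ⟨U, -, hU⟩ := mem_clus.1 hy
  exact hL.mem_of_tendsto hU (Eventually.of_forall hg)

theorem image_clus {X : Type*} [TopologicalSpace X] [T2Space X] {g : ℕ → X} {L : Set X}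
    (hL : IsCompact L) (hg : ∀ n, g n ∈ L) {π : X → ℝ} (hπ : ContinuousOn π L) (S : Set ℕ) :
    π '' clus g S = clus (fun n => π (g n)) S := by
  have key : ∀ (U : Ultrafilter ℕ) (y : X), y ∈ L → Tendsto g U (𝓝 y) →
      Tendsto (fun n => π (g n)) U (𝓝 (π y)) := by
    intro U y hy hU
    have : Tendsto g U (𝓝[L] y) :=
      tendsto_nhdsWithin_iff.2 ⟨hU, Eventually.of_forall hg⟩
    exact (hπ y hy).tendsto.comp this
  ext q
  constructor
  · rintro ⟨y, hy, rfl⟩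
    have hyL := clus_subset hL.isClosed hg S hy
    obtain ⟨U, h1, hU⟩ := mem_clus.1 hy
    exact mem_clus.2 ⟨U, h1, key U y hyL hU⟩
  · intro hq
    obtain ⟨U, h1, hU⟩ := mem_clus.1 hq
    obtain ⟨y, hyL, hy⟩ := hL.ultrafilter_le_nhds (U.map g) (by
      rw [le_principal_iff]
      exact Eventually.of_forall (f := (U : Filter ℕ)) hg)
    have hy' : Tendsto g U (𝓝 y) := hy
    exact ⟨y, mem_clus.2 ⟨U, h1, hy'⟩, tendsto_nhds_unique (key U y hyL hy') hU⟩

/-- A fixed sequence in `[0,1]` all of whose tails are dense. -/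
noncomputable def cseq (n : ℕ) : ℝ :=
  (TopologicalSpace.denseSeq unitInterval (Nat.unpair n).1 : unitInterval)

theorem cseq_mem (n : ℕ) : cseq n ∈ Icc (0:ℝ) 1 := Subtype.property _

theorem clus_cseq : Icc (0:ℝ) 1 ⊆ clus cseq univ := by
  intro q hq
  show MapClusterPt q (atTop ⊓ 𝓟 univ) cseq
  rw [principal_univ, inf_top_eq, mapClusterPt_iff_frequently]
  intro s hs
  rw [frequently_atTop]
  intro N
  have h2 : ((↑) : unitInterval → ℝ) ⁻¹' s ∈ 𝓝 (⟨q, hq⟩ : unitInterval) :=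
    continuous_subtype_val.continuousAt hs
  obtain ⟨y, hy, k, rfl⟩ := mem_closure_iff_nhds.1
    (TopologicalSpace.denseRange_denseSeq unitInterval ⟨q, hq⟩) _ h2
  refine ⟨Nat.pair k N, Nat.right_le_pair k N, ?_⟩
  simpa [cseq] using hy

theorem aux_step {X : Type*} [MetricSpace X] [CompactSpace X] [MeasurableSpace X] [BorelSpace X]
    (μ : Measure X) (hat : ∀ x, μ {x} = 0) (hsf : Semifinite μ)
    {Y : Type*} [MetricSpace Y] (f : Y → X) (hf : Continuous f)
    (hpos : ∀ U : Set Y, IsOpen U → U.Nonempty → 0 < μ (closure (f '' U)))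
    (U : Set Y) (hU : IsOpen U) (hUne : U.Nonempty) (ε : ℝ) (hε : 0 < ε) :
    ∃ (g : ℕ → X) (V : ℕ → Set Y) (W : ℕ → Set X),
      (∀ S, μ (clus g S) = 0 ↔ volume (clus cseq S) = 0) ∧
      (∀ n, IsOpen (V n) ∧ (V n).Nonempty ∧ closure (V n) ⊆ U ∧
        (∀ y ∈ V n, ∀ z ∈ V n, dist y z ≤ ε) ∧ IsOpen (W n) ∧ (∀ y ∈ V n, f y ∈ W n) ∧
        ∀ w ∈ W n, dist w (g n) ≤ 1 / ((n : ℝ) + 1)) ∧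
      ∀ n m, n < m → Disjoint (W n) (W m) := by
  obtain ⟨D, hDs, hDc, hDd⟩ :=
    (TopologicalSpace.IsSeparable.of_separableSpace (f '' U)).exists_countable_dense_subset
  have hD0 : μ D = 0 := by
    rw [← biUnion_of_singleton D]
    exact (measure_biUnion_null_iff hDc).2 fun x _ => hat x
  have h1 : 0 < μ (closure (f '' U) \ D) := by
    rw [measure_sdiff_null hD0]; exact hpos U hU hUne
  obtain ⟨K, hKs, hKm, hK0, hK1⟩ := hsf _ (isClosed_closure.measurableSet.diff hDc.measurableSet) h1
  obtain ⟨L, hLK, hLc, π, hπc, hπL, hπ⟩ := aux_pi μ hat K hKm hK0 hK1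
  have hex : ∀ n, ∃ x ∈ L, π x = cseq n := by
    intro n
    have := cseq_mem n
    rw [← hπL] at this
    exact this
  choose g hgL hgπ using hex
  have hgD : ∀ n, g n ∈ closure D := fun n =>
    closure_minimal hDd isClosed_closure (hKs (hLK (hgL n))).1
  have hpick : ∀ (n : ℕ) (δ : ℝ), ∃ p ∈ D, 0 < δ → dist p (g n) < δ := by
    intro n δ
    by_cases hδ : 0 < δ
    · obtain ⟨p, hp, h⟩ := Metric.mem_closure_iff.1 (hgD n) δ hδ
      exact ⟨p, hp, fun _ => by rwa [dist_comm]⟩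
    · obtain ⟨p, hp, h⟩ := Metric.mem_closure_iff.1 (hgD n) 1 one_pos
      exact ⟨p, hp, fun h => absurd h hδ⟩
  choose pick hpD hpd using hpick
  obtain ⟨p, hp0, hp_succ⟩ : ∃ p : ℕ → X, p 0 = pick 0 (1/2) ∧ ∀ n, p (n + 1) =
      pick (n + 1) (min (Metric.infDist (p n) L / 3) (1 / (2 * ((n : ℝ) + 2)))) :=
    ⟨fun n => Nat.rec (pick 0 (1/2))
    (fun n q => pick (n + 1) (min (Metric.infDist q L / 3) (1 / (2 * ((n : ℝ) + 2))))) n,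
    rfl, fun n => rfl⟩
  have hpmem : ∀ n, p n ∈ D := by
    intro n
    cases n with
    | zero => rw [hp0]; exact hpD _ _
    | succ n => rw [hp_succ]; exact hpD _ _
  have hLne : L.Nonempty := ⟨g 0, hgL 0⟩
  obtain ⟨δ, hδdef⟩ : ∃ δ : ℕ → ℝ, ∀ n, Metric.infDist (p n) L = δ n := ⟨_, fun n => rfl⟩
  simp only [hδdef] at hp_succ
  have hδ0 : ∀ n, 0 < δ n := by
    intro n
    rw [← hδdef]
    refine (hLc.isClosed.notMem_iff_infDist_pos hLne).1 fun h => ?_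
    exact (hKs (hLK h)).2 (hpmem n)
  have hδd : ∀ n, δ n ≤ dist (p n) (g n) := fun n => hδdef n ▸ Metric.infDist_le_dist_of_mem (hgL n)
  have hδs : ∀ n, dist (p (n + 1)) (g (n + 1)) < min (δ n / 3) (1 / (2 * ((n : ℝ) + 2))) := by
    intro n
    rw [hp_succ]
    apply hpd
    refine lt_min ?_ (by positivity)
    have := hδ0 n
    positivity
  have hδn : ∀ n, dist (p n) (g n) ≤ 1 / (2 * ((n : ℝ) + 1)) := by
    intro n
    cases n with
    | zero =>
      have : dist (pick 0 (1/2)) (g 0) < 1/2 := hpd 0 (1/2) (by norm_num)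
      rw [← hp0] at this
      simpa using this.le
    | succ n =>
      refine (hδs n).le.trans ((min_le_right _ _).trans (le_of_eq ?_))
      push_cast; ring
  have hδ3 : ∀ n, δ (n + 1) < δ n / 3 := fun n =>
    (hδd _).trans_lt ((hδs n).trans_le (min_le_left _ _))
  have hδlt : ∀ n m, n < m → δ m < δ n / 3 := by
    intro n m hnm
    induction m, hnm using Nat.le_induction with
    | base => exact hδ3 n
    | succ m _ ih => have := hδ3 m; have := hδ0 m; linarith
  choose y hyU hyp using fun n => hDs (hpmem n)
  have hball : ∀ n, ∃ r > 0, Metric.closedBall (y n) r ⊆ U ∩ f ⁻¹' (Metric.ball (p n) (δ n / 3)) := by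
    intro n
    refine Metric.nhds_basis_closedBall.mem_iff.1 ?_
    refine (hU.inter (Metric.isOpen_ball.preimage hf)).mem_nhds ⟨hyU n, ?_⟩
    rw [mem_preimage, hyp]
    exact Metric.mem_ball_self (by have := hδ0 n; positivity)
  choose r hr0 hr using hball
  have hsub : ∀ n, Metric.ball (y n) (min (r n) (ε / 2)) ⊆ Metric.closedBall (y n) (r n) := fun n =>
    Metric.ball_subset_closedBall.trans (Metric.closedBall_subset_closedBall (min_le_left _ _))
  refine ⟨g, fun n => Metric.ball (y n) (min (r n) (ε / 2)),
    fun n => Metric.ball (p n) (δ n / 3), ?_, ?_, ?_⟩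
  · intro S
    rw [hπ _ (clus_subset hLc.isClosed hgL S) (isClosed_clus g S), image_clus hLc hgL hπc]
    simp only [hgπ]
  · intro n
    refine ⟨Metric.isOpen_ball, ⟨y n, Metric.mem_ball_self (lt_min (hr0 n) (by positivity))⟩,
      ?_, ?_, Metric.isOpen_ball, ?_, ?_⟩
    · exact (closure_minimal (hsub n) Metric.isClosed_closedBall).trans
        ((hr n).trans inter_subset_left)
    · intro a ha b hb
      have h1 := (Metric.mem_ball.1 ha).trans_le (min_le_right _ _)
      have h2 := (Metric.mem_ball.1 hb).trans_le (min_le_right _ _)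
      have := dist_triangle_right a b (y n)
      linarith
    · intro a ha
      exact (hr n (hsub n ha)).2
    · intro w hw
      have h1 := Metric.mem_ball.1 hw
      have h2 := dist_triangle w (p n) (g n)
      have h3 := hδd n
      have h4 := hδn n
      have h5 : 1 / ((n : ℝ) + 1) = 2 * (1 / (2 * ((n : ℝ) + 1))) := by field_simp
      have h6 : 0 ≤ dist (p n) (g n) := dist_nonneg
      linarith
  · intro n m hnm
    rw [Set.disjoint_left]
    intro w hw hw'
    have h1 := Metric.mem_ball.1 hw
    have h2 := Metric.mem_ball.1 hw'
    have h3 : Metric.infDist w L ≤ Metric.infDist (p m) L + dist w (p m) :=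
      Metric.infDist_le_infDist_add_dist
    have h4 : Metric.infDist (p n) L ≤ Metric.infDist w L + dist (p n) w :=
      Metric.infDist_le_infDist_add_dist
    rw [dist_comm] at h4
    have h5 := hδlt n m hnm
    have h6 := hδ0 n
    rw [hδdef] at h3 h4
    linarith

open PiNat in
theorem aux_embed {X : Type*} [MetricSpace X] [CompactSpace X] [MeasurableSpace X] [BorelSpace X]
    (μ : Measure X) (hat : ∀ x, μ {x} = 0) (hsf : Semifinite μ)
    {Y : Type*} [MetricSpace Y] [CompleteSpace Y] [Nonempty Y] (f : Y → X) (hf : Continuous f)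
    (hpos : ∀ U : Set Y, IsOpen U → U.Nonempty → 0 < μ (closure (f '' U))) :
    ∃ (h : (ℕ → ℕ) → X) (g : List ℕ → ℕ → X), IsEmbedding h ∧ range h ⊆ range f ∧
      (∀ l S, μ (clus (g l) S) = 0 ↔ volume (clus cseq S) = 0) ∧
      ∀ x k, dist (h x) (g (res x k) (x k)) ≤ 1 / ((x k : ℝ) + 1) := by
  have hstep := fun (U : {U : Set Y // IsOpen U ∧ U.Nonempty}) (k : ℕ) =>
    aux_step μ hat hsf f hf hpos U.1 U.2.1 U.2.2 (1 / ((k : ℝ) + 1)) (by positivity)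
  choose g V W hg hV hW using hstep
  obtain ⟨A, hA⟩ : ∃ A : List ℕ → {U : Set Y // IsOpen U ∧ U.Nonempty},
      ∀ n l, (A (n :: l)).1 = V (A l) l.length n :=
    ⟨fun l => List.rec ⟨univ, isOpen_univ, univ_nonempty⟩
      (fun n l ih => ⟨V ih l.length n, (hV ih l.length n).1, (hV ih l.length n).2.1⟩) l,
      fun n l => rfl⟩
  let A' : List ℕ → Set Y := fun l => (A l).1
  have hanti : CantorScheme.ClosureAntitone A' := by
    intro l n
    show closure (A (n :: l)).1 ⊆ (A l).1
    rw [hA]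
    exact (hV (A l) l.length n).2.2.1
  have hdiam : CantorScheme.VanishingDiam A' := by
    intro x
    rw [← tendsto_add_atTop_iff_nat 1]
    have hb : ∀ n : ℕ, Metric.ediam (A' (res x (n + 1))) ≤ ENNReal.ofReal (1 / ((n : ℝ) + 1)) := by
      intro n
      refine Metric.ediam_le_of_forall_dist_le ?_
      show ∀ a ∈ (A (x n :: res x n)).1, ∀ b ∈ (A (x n :: res x n)).1, _
      rw [hA]
      have := (hV (A (res x n)) (res x n).length (x n)).2.2.2.1
      rw [res_length] at this ⊢
      exact this
    refine tendsto_of_tendsto_of_tendsto_of_le_of_le tendsto_const_nhds ?_ (fun _ => zero_le) hb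
    simpa using ENNReal.tendsto_ofReal (tendsto_one_div_add_atTop_nhds_zero_nat (𝕜 := ℝ))
  have hdom := hanti.map_of_vanishingDiam hdiam (fun l => (A l).2.2)
  let i : (ℕ → ℕ) → Y := fun x => (CantorScheme.inducedMap A').2 ⟨x, hdom ▸ mem_univ x⟩
  have hic : Continuous i := hdiam.map_continuous.comp (by fun_prop)
  have him : ∀ x n, i x ∈ (A (res x n)).1 := fun x n =>
    CantorScheme.map_mem (A := A') ⟨x, hdom ▸ mem_univ x⟩ n
  have hfW : ∀ x k, f (i x) ∈ W (A (res x k)) k (x k) := by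
    intro x k
    have h1 := him x (k + 1)
    rw [res_succ, hA] at h1
    have h2 := (hV (A (res x k)) (res x k).length (x k)).2.2.2.2.2.1 _ h1
    rwa [res_length] at h2
  have hfc : Continuous (fun x => f (i x)) := hf.comp hic
  have hsep : ∀ (x : ℕ → ℕ) (k : ℕ), ∃ O : Set X, IsOpen O ∧ f (i x) ∈ O ∧
      ∀ x', f (i x') ∈ O → res x' k = res x k := by
    intro x k
    induction k with
    | zero => exact ⟨univ, isOpen_univ, mem_univ _, fun _ _ => rfl⟩
    | succ k ih =>
      obtain ⟨O, hO, hxO, h⟩ := ih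
      refine ⟨O ∩ W (A (res x k)) k (x k), hO.inter (hV _ _ _).2.2.2.2.1, ⟨hxO, hfW x k⟩, ?_⟩
      rintro x' ⟨h1, h2⟩
      have h3 := h x' h1
      have h4 := hfW x' k
      rw [h3] at h4
      rw [res_succ, res_succ, h3]
      congr 1
      by_contra hne
      rcases lt_or_gt_of_ne hne with hlt | hlt
      · exact Set.disjoint_left.1 (hW _ _ _ _ hlt) h4 h2
      · exact Set.disjoint_left.1 (hW _ _ _ _ hlt) h2 h4
  refine ⟨fun x => f (i x), fun l => g (A l) l.length, ⟨?_, ?_⟩, ?_, ?_, ?_⟩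
  · rw [isInducing_iff_nhds]
    intro x
    refine le_antisymm (hfc.tendsto x).le_comap ?_
    intro s hs
    obtain ⟨n, hn⟩ : ∃ n, cylinder x n ⊆ s := by
      obtain ⟨t, hts, ht, hxt⟩ := mem_nhds_iff.1 hs
      obtain ⟨t', ⟨y, n, rfl⟩, hx, hsub⟩ :=
        (isTopologicalBasis_cylinders (fun _ : ℕ => ℕ)).exists_subset_of_mem_open hxt ht
      refine ⟨n, ?_⟩
      rw [← mem_cylinder_iff_eq.1 hx] at hsub
      exact hsub.trans hts
    obtain ⟨O, hO, hxO, h⟩ := hsep x n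
    refine ⟨O, hO.mem_nhds hxO, fun x' hx' => hn ?_⟩
    rw [cylinder_eq_res]
    exact h x' hx'
  · intro x x' hxx
    apply res_injective
    funext k
    obtain ⟨O, hO, hxO, h⟩ := hsep x' k
    exact h x (by simp only at hxx; rw [hxx]; exact hxO)
  · rintro _ ⟨x, rfl⟩; exact ⟨_, rfl⟩
  · intro l S; exact hg _ _ _
  · intro x k
    simp only [res_length]
    exact (hV _ _ _).2.2.2.2.2.2 _ (hfW x k)

/-- Successors of `s` in the tree of `A`. -/
def succs (A : Set (ℕ → ℕ)) (s : List ℕ) : Set ℕ :=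
  {n | ∃ x ∈ A, PiNat.res x s.length = s ∧ x s.length = n}

/-- The combinatorial ideal. -/
def Jfam : Set (Set (ℕ → ℕ)) :=
  {A | ∃ Ak : ℕ → Set (ℕ → ℕ), A ⊆ ⋃ k, Ak k ∧ ∀ k s, volume (clus cseq (succs (Ak k) s)) = 0}

open PiNat in
theorem univ_notMem_Jfam : univ ∉ Jfam := by
  rintro ⟨Ak, hcov, h⟩
  obtain ⟨k, x, hx⟩ := nonempty_interior_of_iUnion_of_closed (f := fun k => closure (Ak k))
    (fun k => isClosed_closure)
    (univ_subset_iff.1 (hcov.trans (iUnion_mono fun k => subset_closure)))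
  obtain ⟨t, ⟨y, n, rfl⟩, hxt, hsub⟩ :=
    (isTopologicalBasis_cylinders (fun _ : ℕ => ℕ)).exists_subset_of_mem_open hx isOpen_interior
  have hs : succs (Ak k) (res y n) = univ := by
    refine eq_univ_of_forall fun m => ?_
    let z : ℕ → ℕ := fun j => if j < n then y j else m
    have hz : z ∈ cylinder y n := by
      intro j hj
      simp [z, hj]
    have hz2 : z ∈ closure (Ak k) := interior_subset (hsub hz)
    obtain ⟨w, hw, hwA⟩ := mem_closure_iff.1 hz2 (cylinder z (n + 1))
      (isOpen_cylinder _ z (n + 1)) (self_mem_cylinder z (n + 1))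
    refine ⟨w, hwA, ?_, ?_⟩
    · rw [res_length, res_eq_res]
      intro j hj
      rw [hw j (by omega), hz j hj]
    · rw [res_length, hw n (by omega)]
      simp [z]
  have h1 := h k (res y n)
  rw [hs] at h1
  have h2 := measure_mono_null clus_cseq h1
  simp at h2

open PiNat in
theorem closure_sub {X : Type*} [MetricSpace X] (h : (ℕ → ℕ) → X) (hc : Continuous h)
    (g : List ℕ → ℕ → X)
    (hd : ∀ x k, dist (h x) (g (res x k) (x k)) ≤ 1 / ((x k : ℝ) + 1)) (A : Set (ℕ → ℕ)) :
    closure (h '' A) ⊆ range h ∪ ⋃ s, clus (g s) (succs A s) := by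
  intro y hy
  by_contra hcon
  rw [mem_union, not_or, mem_iUnion, not_exists] at hcon
  obtain ⟨hyr, hyc⟩ := hcon
  have step : ∀ s : List ℕ, y ∈ closure (h '' (A ∩ {x | res x s.length = s})) →
      ∃ n, y ∈ closure (h '' (A ∩ {x | res x (n :: s).length = n :: s})) := by
    intro s hs
    rw [mem_closure_iff_clusterPt, ← map_principal] at hs
    obtain ⟨U, hU, hUy⟩ := mapClusterPt_iff_ultrafilter.1 hs
    rw [le_principal_iff] at hU
    by_cases hn : ∃ n, {x : ℕ → ℕ | x s.length = n} ∈ U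
    · obtain ⟨n, hn⟩ := hn
      refine ⟨n, mem_closure_of_tendsto hUy ?_⟩
      filter_upwards [hU, hn] with x hx hxn
      refine ⟨x, ⟨hx.1, ?_⟩, rfl⟩
      show res x (s.length + 1) = n :: s
      rw [res_succ, hx.2, hxn]
    · exfalso
      push Not at hn
      have hatTop : Tendsto (fun x : ℕ → ℕ => x s.length) U atTop := by
        rw [← Nat.cofinite_eq_atTop, Tendsto, le_cofinite_iff_compl_singleton_mem]
        intro n
        exact Ultrafilter.compl_mem_iff_notMem.2 (hn n)
      refine hyc s (mem_clus.2 ⟨U.map (fun x => x s.length), ?_, ?_⟩)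
      · refine le_inf hatTop ?_
        rw [le_principal_iff]
        show (fun x : ℕ → ℕ => x s.length) ⁻¹' _ ∈ U
        filter_upwards [hU] with x hx
        exact ⟨x, hx.1, hx.2, rfl⟩
      · show Tendsto (g s ∘ fun x : ℕ → ℕ => x s.length) U (𝓝 y)
        refine tendsto_of_tendsto_of_dist hUy ?_
        have h0 : Tendsto (fun x : ℕ → ℕ => 1 / ((x s.length : ℝ) + 1)) U (𝓝 0) :=
          (tendsto_one_div_add_atTop_nhds_zero_nat (𝕜 := ℝ)).comp hatTop
        refine squeeze_zero' (Eventually.of_forall fun _ => dist_nonneg) ?_ h0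
        filter_upwards [hU] with x hx
        have := hd x s.length
        rw [hx.2] at this
        exact this
  choose! nx hnx using step
  -- the branch
  let L : ℕ → List ℕ := fun k => Nat.rec [] (fun _ l => nx l :: l) k
  let x : ℕ → ℕ := fun k => nx (L k)
  have hL : ∀ k, res x k = L k := by
    intro k
    induction k with
    | zero => rfl
    | succ k ih => rw [res_succ, ih]
  have hmem : ∀ k, y ∈ closure (h '' (A ∩ {z | res z (L k).length = L k})) := by
    intro k
    induction k with
    | zero =>
      have : A ∩ {z | res z (L 0).length = L 0} = A := inter_eq_left.2 fun z _ => rfl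
      rw [this]; exact hy
    | succ k ih => exact hnx _ ih
  apply hyr
  refine ⟨x, ?_⟩
  by_contra hne
  obtain ⟨O1, O2, hO1, hO2, hx1, hy2, hdis⟩ := t2_separation hne
  obtain ⟨t', ⟨y', n, rfl⟩, hx, hsub⟩ :=
    (isTopologicalBasis_cylinders (fun _ : ℕ => ℕ)).exists_subset_of_mem_open
      (show x ∈ h ⁻¹' O1 from hx1) (hO1.preimage hc)
  rw [← mem_cylinder_iff_eq.1 hx] at hsub
  obtain ⟨_, hz, z, hzA, rfl⟩ := mem_closure_iff.1 (hmem n) O2 hO2 hy2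
  refine Set.disjoint_left.1 hdis (hsub ?_) hz
  rw [cylinder_eq_res]
  have := hzA.2
  rw [← hL, res_length] at this
  exact this

open PiNat in
theorem aux_char {X : Type*} [MetricSpace X] [CompactSpace X] [MeasurableSpace X] [BorelSpace X]
    (μ : Measure X) (h : (ℕ → ℕ) → X) (hc : Continuous h) (h0 : μ (range h) = 0)
    (g : List ℕ → ℕ → X) (hg : ∀ l S, μ (clus (g l) S) = 0 ↔ volume (clus cseq S) = 0)
    (hd : ∀ x k, dist (h x) (g (res x k) (x k)) ≤ 1 / ((x k : ℝ) + 1)) (A : Set (ℕ → ℕ)) :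
    A ∈ Jfam ↔ CovNull μ (h '' A) := by
  constructor
  · rintro ⟨Ak, hcov, hA⟩
    refine ⟨fun k => closure (h '' Ak k), fun k => ⟨isClosed_closure.isCompact, ?_⟩, ?_⟩
    · refine measure_mono_null (closure_sub h hc g hd (Ak k)) (measure_union_null h0 ?_)
      exact measure_iUnion_null fun s => (hg s _).2 (hA k s)
    · rintro _ ⟨x, hx, rfl⟩
      obtain ⟨k, hk⟩ := mem_iUnion.1 (hcov hx)
      exact mem_iUnion.2 ⟨k, subset_closure ⟨x, hk, rfl⟩⟩
  · rintro ⟨K, hK, hcov⟩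
    refine ⟨fun k => h ⁻¹' K k, ?_, ?_⟩
    · intro x hx
      obtain ⟨k, hk⟩ := mem_iUnion.1 (hcov ⟨x, hx, rfl⟩)
      exact mem_iUnion.2 ⟨k, hk⟩
    · intro k s
      rw [← hg s]
      refine measure_mono_null ?_ (hK k).2
      intro y hy
      obtain ⟨U, hU, hUy⟩ := mem_clus.1 hy
      rw [le_inf_iff, le_principal_iff] at hU
      have hex : ∀ n, ∃ x, n ∈ succs (h ⁻¹' K k) s → h x ∈ K k ∧ res x s.length = s ∧ x s.length = n := by
        intro n
        by_cases hn : n ∈ succs (h ⁻¹' K k) s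
        · obtain ⟨x, hx⟩ := hn
          exact ⟨x, fun _ => hx⟩
        · exact ⟨fun _ => 0, fun h => absurd h hn⟩
      choose x hx using hex
      have ht : Tendsto (fun n => h (x n)) U (𝓝 y) := by
        refine tendsto_of_tendsto_of_dist hUy ?_
        refine squeeze_zero' (Eventually.of_forall fun _ => dist_nonneg) ?_
          ((tendsto_one_div_add_atTop_nhds_zero_nat (𝕜 := ℝ)).mono_left hU.1)
        filter_upwards [hU.2] with n hn
        obtain ⟨-, h2, h3⟩ := hx n hn
        have := hd (x n) s.length
        rw [h2, h3, dist_comm] at this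
        exact this
      refine (hK k).1.isClosed.mem_of_tendsto ht ?_
      filter_upwards [hU.2] with n hn
      exact (hx n hn).1

theorem CovNull.mono {X : Type*} [TopologicalSpace X] [MeasurableSpace X] {μ : Measure X}
    {A B : Set X} (hAB : A ⊆ B) (h : CovNull μ B) : CovNull μ A := by
  obtain ⟨K, hK, hc⟩ := h
  exact ⟨K, hK, hAB.trans hc⟩

theorem covNull_iUnion {X : Type*} [TopologicalSpace X] [MeasurableSpace X] {μ : Measure X}
    {ι : Type*} [Countable ι] {A : ι → Set X} (h : ∀ i, CovNull μ (A i)) :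
    CovNull μ (⋃ i, A i) := by
  choose K hK hc using h
  cases isEmpty_or_nonempty ι with
  | inl hi => exact ⟨fun _ => ∅, fun _ => ⟨isCompact_empty, measure_empty⟩, by simp⟩
  | inr hi =>
    obtain ⟨e, he⟩ := exists_surjective_nat (ι × ℕ)
    refine ⟨fun n => K (e n).1 (e n).2, fun n => hK _ _, ?_⟩
    refine iUnion_subset fun i x hx => ?_
    obtain ⟨k, hk⟩ := mem_iUnion.1 (hc i hx)
    obtain ⟨n, hn⟩ := he (i, k)
    exact mem_iUnion.2 ⟨n, by rw [hn]; exact hk⟩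

theorem aux_null {X : Type*} [MetricSpace X] [CompactSpace X] [MeasurableSpace X] [BorelSpace X]
    (μ : Measure X) (hat : ∀ x, μ {x} = 0) (hsf : Semifinite μ) (B : Set X)
    (hB : MeasurableSet B) (hBn : ¬ CovNull μ B) :
    ∃ B' ⊆ B, MeasurableSet B' ∧ μ B' = 0 ∧ ¬ CovNull μ B' := by
  rcases eq_or_ne (μ B) 0 with h0 | h0
  · exact ⟨B, subset_rfl, hB, h0, hBn⟩
  obtain ⟨B1, hB1, hB1m, hB10, hB1t⟩ := hsf B hB (pos_iff_ne_zero.2 h0)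
  obtain ⟨K, hKB, hKc, hK0, -⟩ := aux_lusin μ B1 hB1m hB10 hB1t (fun _ => 0) measurable_const
  have hKt : μ K < ⊤ := (measure_mono hKB).trans_lt hB1t
  have hfin : IsFiniteMeasure (μ.restrict K) := ⟨by simpa using hKt⟩
  let ρ := μ.restrict K
  let S := ρ.support
  have hSc : IsClosed S := Measure.isClosed_support
  have hSK : S ⊆ K := by
    refine Measure.support_subset_of_isClosed hKc.isClosed ?_
    rw [mem_ae_iff, Measure.restrict_apply hKc.isClosed.measurableSet.compl]
    simp
  have hSnull : ρ Sᶜ = 0 := Measure.measure_compl_support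
  have hSpos : ∀ x ∈ S, ∀ O : Set X, IsOpen O → x ∈ O → 0 < μ (O ∩ S) := by
    intro x hx O hO hxO
    have h1 : 0 < ρ O := Measure.mem_support_iff_forall x |>.1 hx O (hO.mem_nhds hxO)
    have h2 : ρ O ≤ ρ (O ∩ S) := by
      calc ρ O ≤ ρ ((O ∩ S) ∪ Sᶜ) := measure_mono fun z hz => by
            by_cases hzS : z ∈ S
            · exact Or.inl ⟨hz, hzS⟩
            · exact Or.inr hzS
        _ ≤ ρ (O ∩ S) + ρ Sᶜ := measure_union_le _ _
        _ = ρ (O ∩ S) := by rw [hSnull, add_zero]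
    exact h1.trans_le (h2.trans (Measure.restrict_apply_le _ _))
  have hSne : S.Nonempty := by
    by_contra hne
    rw [not_nonempty_iff_eq_empty] at hne
    rw [hne, compl_empty, Measure.restrict_apply_univ] at hSnull
    exact hK0.ne' hSnull
  obtain ⟨D, hDs, hDc, hDd⟩ :=
    (TopologicalSpace.IsSeparable.of_separableSpace S).exists_countable_dense_subset
  have hD0 : ρ D = 0 := by
    refine le_antisymm ((Measure.restrict_apply_le _ _).trans ?_) zero_le
    rw [← biUnion_of_singleton D]
    exact ((measure_biUnion_null_iff hDc).2 fun x _ => hat x).le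
  have hV : ∀ n : ℕ, ∃ V ⊇ D, IsOpen V ∧ ρ V < ENNReal.ofReal (1 / ((n : ℝ) + 1)) := by
    intro n
    exact D.exists_isOpen_lt_of_lt _ (by rw [hD0, ENNReal.ofReal_pos]; positivity)
  choose V hDV hVo hVm using hV
  refine ⟨S ∩ ⋂ n, V n, ?_, ?_, ?_, ?_⟩
  · exact inter_subset_left.trans (hSK.trans (hKB.trans hB1))
  · exact hSc.measurableSet.inter (MeasurableSet.iInter fun n => (hVo n).measurableSet)
  · have h1 : μ (S ∩ ⋂ n, V n) = ρ (S ∩ ⋂ n, V n) := by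
      rw [Measure.restrict_eq_self _ (inter_subset_left.trans hSK)]
    rw [h1]
    have h2 : ∀ n : ℕ, ρ (S ∩ ⋂ n, V n) ≤ ENNReal.ofReal (1 / ((n : ℝ) + 1)) := fun n =>
      (measure_mono (inter_subset_right.trans (iInter_subset _ n))).trans (hVm n).le
    refine le_antisymm (ge_of_tendsto' (x := atTop) ?_ h2) zero_le
    simpa using ENNReal.tendsto_ofReal (tendsto_one_div_add_atTop_nhds_zero_nat (𝕜 := ℝ))
  · rintro ⟨C, hC, hcov⟩
    have hcs : CompactSpace S := isCompact_iff_compactSpace.1 hSc.isCompact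
    have hne : Nonempty S := hSne.to_subtype
    have hd1 : ∀ n, Dense (((↑) : S → X) ⁻¹' (V n)) := by
      intro n x
      rw [mem_closure_iff]
      intro o ho hx
      obtain ⟨O, hO, rfl⟩ := isOpen_induced_iff.1 ho
      obtain ⟨z, hzO, hzD⟩ := mem_closure_iff.1 (hDd x.2) O hO hx
      exact ⟨⟨z, hDs hzD⟩, hzO, hDV n hzD⟩
    have hd2 : ∀ n, Dense (((↑) : S → X) ⁻¹' (C n)ᶜ) := by
      intro n x
      rw [mem_closure_iff]
      intro o ho hx
      obtain ⟨O, hO, rfl⟩ := isOpen_induced_iff.1 ho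
      by_contra hcon
      have hsub : O ∩ S ⊆ C n := by
        rintro z ⟨hzO, hzS⟩
        by_contra hzC
        exact hcon ⟨⟨z, hzS⟩, hzO, hzC⟩
      exact (hSpos x x.2 O hO hx).ne' (measure_mono_null hsub (hC n).2)
    have ho1 : ∀ n, IsOpen (((↑) : S → X) ⁻¹' (V n)) := fun n =>
      (hVo n).preimage continuous_subtype_val
    have ho2 : ∀ n, IsOpen (((↑) : S → X) ⁻¹' (C n)ᶜ) := fun n =>
      (hC n).1.isClosed.isOpen_compl.preimage continuous_subtype_val
    obtain ⟨z, hz⟩ := (dense_iInter_of_isOpen (fun n => (ho1 n).inter (ho2 n))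
      (fun n => (hd1 n).inter_of_isOpen_left (hd2 n) (ho1 n))).nonempty
    rw [mem_iInter] at hz
    obtain ⟨n, hn⟩ := mem_iUnion.1 (hcov ⟨z.2, mem_iInter.2 fun n => (hz n).1⟩)
    exact (hz n).2 hn

theorem aux_kernel {X : Type*} [MetricSpace X] [CompactSpace X] [MeasurableSpace X] [BorelSpace X]
    (μ : Measure X) (B : Set X) (hB : MeasurableSet B) (hBn : ¬ CovNull μ B) :
    ∃ (Y : Type) (_ : MetricSpace Y) (_ : CompleteSpace Y) (_ : Nonempty Y) (f : Y → X),
      Continuous f ∧ range f ⊆ B ∧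
      ∀ U : Set Y, IsOpen U → U.Nonempty → 0 < μ (closure (f '' U)) := by
  have hAn := hB.analyticSet
  rw [AnalyticSet] at hAn
  rcases hAn with rfl | ⟨f, hf, rfl⟩
  · exact absurd ⟨fun _ => ∅, fun _ => ⟨isCompact_empty, measure_empty⟩, empty_subset _⟩ hBn
  let ι := {U : Set (ℕ → ℕ) // IsOpen U ∧ CovNull μ (f '' U)}
  let R : Set (ℕ → ℕ) := ⋃ i : ι, i.1
  have hRo : IsOpen R := isOpen_iUnion fun i => i.2.1
  have hR : CovNull μ (f '' R) := by
    obtain ⟨T, hT, hTU⟩ := TopologicalSpace.isOpen_iUnion_countable (fun i : ι => i.1)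
      (fun i => i.2.1)
    have : f '' R = ⋃ i : T, f '' (i.1 : ι).1 := by
      show f '' (⋃ i : ι, i.1) = _
      rw [← hTU, biUnion_eq_iUnion, image_iUnion]
    rw [this]
    have := hT.to_subtype
    exact covNull_iUnion fun i => i.1.2.2
  have hcl : IsClosed Rᶜ := hRo.isClosed_compl
  have hpol : PolishSpace ↥(Rᶜ) := hcl.polishSpace
  let m := TopologicalSpace.upgradeIsCompletelyMetrizable ↥(Rᶜ)
  refine ⟨↥(Rᶜ), m.toMetricSpace, m.toCompleteSpace, ?_, fun y => f y, ?_, ?_, ?_⟩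
  · by_contra hne
    rw [nonempty_subtype, not_exists] at hne
    apply hBn
    have : R = univ := eq_univ_of_forall fun x => not_not.1 (hne x)
    rwa [this, image_univ] at hR
  · exact hf.comp continuous_subtype_val
  · rintro _ ⟨y, rfl⟩; exact ⟨_, rfl⟩
  · intro U hU hUne
    rw [pos_iff_ne_zero]
    intro h0
    obtain ⟨x, hx⟩ := hUne
    obtain ⟨O, hO, rfl⟩ := isOpen_induced_iff.1 hU
    refine x.2 (mem_iUnion.2 ⟨(⟨O, hO, ?_⟩ : ι), hx⟩)
    have h1 : CovNull μ (closure ((fun y : ↥(Rᶜ) => f y) '' (Subtype.val ⁻¹' O))) :=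
      ⟨fun _ => closure ((fun y : ↥(Rᶜ) => f y) '' (Subtype.val ⁻¹' O)),
        fun _ => ⟨isClosed_closure.isCompact, h0⟩, fun z hz => mem_iUnion.2 ⟨0, hz⟩⟩
    have h2 := covNull_iUnion (ι := Bool) (A := fun b => cond b
      (closure ((fun y : ↥(Rᶜ) => f y) '' (Subtype.val ⁻¹' O))) (f '' R))
      (fun b => by cases b; exacts [hR, h1])
    refine h2.mono ?_
    rintro _ ⟨z, hz, rfl⟩
    by_cases hzR : z ∈ R
    · exact mem_iUnion.2 ⟨false, z, hzR, rfl⟩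
    · exact mem_iUnion.2 ⟨true, subset_closure ⟨⟨z, hzR⟩, hz, rfl⟩⟩

theorem aux_main {X : Type*} [MetricSpace X] [CompactSpace X] [MeasurableSpace X] [BorelSpace X]
    (μ : Measure X) (hat : ∀ x, μ {x} = 0) (hsf : Semifinite μ) (B : Set X)
    (hB : MeasurableSet B) (hBn : ¬ CovNull μ B) :
    ∃ h : (ℕ → ℕ) → X, IsEmbedding h ∧ range h ⊆ B ∧
      ∀ A : Set (ℕ → ℕ), A ∈ Jfam ↔ CovNull μ (h '' A) := by
  obtain ⟨B', hB'B, hB'm, hB'0, hB'n⟩ := aux_null μ hat hsf B hB hBn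
  obtain ⟨Y, _, _, _, f, hf, hfB, hpos⟩ := aux_kernel μ B' hB'm hB'n
  obtain ⟨h, g, hemb, hr, hg, hd⟩ := aux_embed μ hat hsf f hf hpos
  exact ⟨h, hemb, hr.trans (hfB.trans hB'B), fun A =>
    aux_char μ h hemb.continuous (measure_mono_null (hr.trans hfB) hB'0) g hg hd A⟩

/-- Theorem 6.4(ii): there is a copy of the irrationals `P` in `[0,1]`, not coverable by
countably many compacta of Lebesgue measure zero, such that for every semifinite
nonatomic Borel measure `μ` on a compactum `X` and every Borel `B ∉ J₀(μ)`, there is a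
topological embedding `h : P → B` with `A ∈ J₀(λ) ↔ h(A) ∈ J₀(μ)` for all `A ⊆ P`. -/
theorem statement11 :
    ∃ P : Set unitInterval, Nonempty (P ≃ₜ (ℕ → ℕ)) ∧
      ¬ CovNull (volume : Measure unitInterval) P ∧
      ∀ (X : Type*) [MetricSpace X] [CompactSpace X] [Nonempty X]
        [MeasurableSpace X] [BorelSpace X] (μ : Measure X),
        (∀ x : X, μ {x} = 0) →
        Semifinite μ →
        ∀ B : Set X, MeasurableSet B → B ∉ Jzero μ →
          ∃ h : P → X, Topology.IsEmbedding h ∧ Set.range h ⊆ B ∧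
            ∀ A : Set P,
              CovNull (volume : Measure unitInterval) ((↑) '' A) ↔ CovNull μ (h '' A) := by
  have hvol : ∀ x : unitInterval, (volume : Measure unitInterval) {x} = 0 := fun x => by simp
  have hsf0 : Semifinite (volume : Measure unitInterval) := fun A hA h =>
    ⟨A, subset_rfl, hA, h, measure_lt_top _ _⟩
  have huniv : ¬ CovNull (volume : Measure unitInterval) univ := by
    rintro ⟨K, hK, hcov⟩
    have := measure_mono_null hcov (measure_iUnion_null fun n => (hK n).2)
    simp at this
  obtain ⟨h₀, hemb₀, -, hJ₀⟩ := aux_main (volume : Measure unitInterval) hvol hsf0 univ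
    MeasurableSet.univ huniv
  refine ⟨range h₀, ⟨hemb₀.toHomeomorph.symm⟩, ?_, ?_⟩
  · rw [← image_univ, ← hJ₀]
    exact univ_notMem_Jfam
  · intro X _ _ _ _ _ μ hat hsf B hB hBn
    obtain ⟨h, hemb, hr, hJ⟩ := aux_main μ hat hsf B hB (fun hc => hBn ⟨hB, hc⟩)
    refine ⟨fun p => h (hemb₀.toHomeomorph.symm p), hemb.comp hemb₀.toHomeomorph.symm.isEmbedding,
      ?_, ?_⟩
    · rintro _ ⟨p, rfl⟩; exact hr ⟨_, rfl⟩
    · intro A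
      have e1 : ((↑) '' A : Set unitInterval) = h₀ '' (hemb₀.toHomeomorph.symm '' A) := by
        rw [image_image]
        refine image_congr fun p _ => ?_
        have := congrArg Subtype.val (hemb₀.toHomeomorph.apply_symm_apply p)
        exact this.symm
      have e2 : (fun p => h (hemb₀.toHomeomorph.symm p)) '' A
          = h '' (hemb₀.toHomeomorph.symm '' A) := by
        rw [image_image]
      rw [e1, e2, ← hJ₀, ← hJ]
end
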